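/- Arbitrary orientations of Hamilton cycles in robust outexpanders: For every η ∈ (0,1) there exists τ₀ > 0 such that for every τ ∈ (0, τ₀] and every ν ∈ (0, τ] there exists an integer n₀ so that the following holds. Every digraph G on n ≥ n₀ vertices with δ⁰(G) ≥ ηn that is a robust (ν, τ)-outexpander contains every orientation of a Hamilton cycle: for every function c : ℤ/nℤ → {+1, −1} there is a bijection v : ℤ/nℤ → V(G) such that for each i ∈ ℤ/nℤ, (v(i), v(i+1)) ∈ E(G) if c(i) = +1 and (v(i+1), v(i)) ∈ E(G) if c(i) = −1. -/

import Mathlib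

open Finset
open scoped Classical

/-- The out-degree of a vertex in a digraph given by its edge relation. -/
noncomputable def outDeg {V : Type*} [Fintype V] (G : V → V → Prop) (x : V) : ℕ :=
  (Finset.univ.filter fun y => G x y).card

/-- The in-degree of a vertex in a digraph given by its edge relation. -/
noncomputable def inDeg {V : Type*} [Fintype V] (G : V → V → Prop) (x : V) : ℕ :=
  (Finset.univ.filter fun y => G y x).card

/-- The `ν`-robust outneighbourhood of `S`: all vertices with at least `νn`
in-neighbours in `S`. -/
noncomputable def robustOutNbhd {V : Type*} [Fintype V] (G : V → V → Prop) (ν : ℝ)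
    (S : Finset V) : Finset V :=
  Finset.univ.filter fun v => ν * (Fintype.card V : ℝ) ≤ ((S.filter fun s => G s v).card : ℝ)

/-- The `ν`-robust inneighbourhood of `S`: all vertices with at least `νn`
out-neighbours in `S`. -/
noncomputable def robustInNbhd {V : Type*} [Fintype V] (G : V → V → Prop) (ν : ℝ)
    (S : Finset V) : Finset V :=
  Finset.univ.filter fun v => ν * (Fintype.card V : ℝ) ≤ ((S.filter fun s => G v s).card : ℝ)

/-- `G` is a robust `(ν,τ)`-outexpander. -/
def RobustOutexpander {V : Type*} [Fintype V] (G : V → V → Prop) (ν τ : ℝ) : Prop :=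
  ∀ S : Finset V, τ * (Fintype.card V : ℝ) < (S.card : ℝ) →
    (S.card : ℝ) < (1 - τ) * (Fintype.card V : ℝ) →
    (S.card : ℝ) + ν * (Fintype.card V : ℝ) ≤ ((robustOutNbhd G ν S).card : ℝ)

/-- `G` is a robust `(ν,τ)`-inexpander. -/
def RobustInexpander {V : Type*} [Fintype V] (G : V → V → Prop) (ν τ : ℝ) : Prop :=
  ∀ S : Finset V, τ * (Fintype.card V : ℝ) < (S.card : ℝ) →
    (S.card : ℝ) < (1 - τ) * (Fintype.card V : ℝ) →
    (S.card : ℝ) + ν * (Fintype.card V : ℝ) ≤ ((robustInNbhd G ν S).card : ℝ)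

/-- A directed Hamilton cycle in the digraph `G`: a cyclic ordering of all the
vertices such that consecutive vertices are joined by a directed edge. -/
def HasDiHamCycle {V : Type*} [Fintype V] (G : V → V → Prop) : Prop :=
  ∃ e : ZMod (Fintype.card V) ≃ V, ∀ i, G (e i) (e (i + 1))

/-- The step relation of a signed walk: `true` follows an edge forwards, `false` backwards. -/
def stepRel {V : Type*} (G : V → V → Prop) : Bool → V → V → Prop
  | true, x, y => G x y
  | false, x, y => G y x

/-- `Trail R l x y S`: a walk from `x` to `y` whose steps are labelled by `l`, and whose vertices
other than the initial one are pairwise distinct and form the set `S`. -/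
inductive Trail {V σ : Type*} (R : σ → V → V → Prop) : List σ → V → V → Finset V → Prop
  | nil (x : V) : Trail R [] x x ∅
  | cons {s : σ} {l : List σ} {x z y : V} {S : Finset V} :
      R s x z → Trail R l z y S → z ∉ S → Trail R (s :: l) x y (insert z S)

namespace Trail

variable {V σ : Type*} {R : σ → V → V → Prop}

theorem append {l l' : List σ} {x y z : V} {S S' : Finset V} (h : Trail R l x y S)
    (h' : Trail R l' y z S') (hd : Disjoint S S') : Trail R (l ++ l') x z (S ∪ S') := by
  induction h with
  | nil x => simpa using h'
  | cons hr _ hz ih =>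
    rw [Finset.disjoint_insert_left] at hd
    rw [Finset.insert_union, List.cons_append]
    exact .cons hr (ih h' hd.2) (by simp [hz, hd.1])

theorem card_eq {l : List σ} {x y : V} {S : Finset V} (h : Trail R l x y S) :
    S.card = l.length := by
  induction h with
  | nil x => simp
  | cons hr _ hz ih => simp [hz, ih]

theorem end_mem {l : List σ} {x y : V} {S : Finset V} (h : Trail R l x y S) (hl : l ≠ []) :
    y ∈ S := by
  induction h with
  | nil x => exact absurd rfl hl
  | @cons s l x z y S hr h hz ih =>
    rcases l with _ | ⟨t, l⟩
    · cases h; simp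
    · exact Finset.mem_insert_of_mem (ih (by simp))

theorem single {s : σ} {x y : V} (h : R s x y) : Trail R [s] x y {y} := by
  simpa using Trail.cons h (Trail.nil y) (by simp)

theorem exists_fun {l : List σ} {x y : V} {S : Finset V} (h : Trail R l x y S) :
    ∃ f : ℕ → V, f 0 = x ∧ f l.length = y ∧
      (∀ i (hi : i < l.length), R (l[i]) (f i) (f (i + 1))) ∧
      (∀ i < l.length, f (i + 1) ∈ S) ∧
      ∀ i < l.length, ∀ j < l.length, f (i + 1) = f (j + 1) → i = j := by
  induction h with
  | nil x => exact ⟨fun _ => x, rfl, rfl, by simp⟩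
  | @cons s l x z y S hr h hz ih =>
    obtain ⟨f, h0, h1, h2, h3, h4⟩ := ih
    refine ⟨fun i => i.casesOn x f, rfl, h1, ?_, ?_, ?_⟩
    · rintro (_ | i) hi
      · simpa [h0] using hr
      · simpa using h2 i (by simpa using hi)
    · rintro (_ | i) hi
      · simp [h0]
      · exact Finset.mem_insert_of_mem (h3 i (by simpa using hi))
    · rintro (_ | i) hi (_ | j) hj hij
      · rfl
      · exact absurd (h3 j (by simpa using hj)) (by simpa [← hij, h0] using hz)
      · exact absurd (h3 i (by simpa using hi)) (by simpa [hij, h0] using hz)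
      · simpa using h4 i (by simpa using hi) j (by simpa using hj) hij

end Trail

/-- The word `c a, c (a+1), …, c (a+k-1)`. -/
def seg (c : ℕ → Bool) : ℕ → ℕ → List Bool
  | _, 0 => []
  | a, k + 1 => c a :: seg c (a + 1) k

@[simp] theorem seg_length (c : ℕ → Bool) (a k : ℕ) : (seg c a k).length = k := by
  induction k generalizing a with
  | zero => rfl
  | succ k ih => simp [seg, ih]

theorem seg_add (c : ℕ → Bool) (a k k' : ℕ) : seg c a (k + k') = seg c a k ++ seg c (a + k) k' := by
  induction k generalizing a with
  | zero => simp [seg]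
  | succ k ih =>
    rw [Nat.add_right_comm, seg, ih, seg, List.cons_append, Nat.add_assoc, Nat.add_comm 1 k]

theorem seg_getElem (c : ℕ → Bool) (a k i : ℕ) (hi : i < (seg c a k).length) :
    (seg c a k)[i] = c (a + i) := by
  induction k generalizing a i with
  | zero => simp at hi
  | succ k ih =>
    rcases i with _ | i
    · simp [seg]
    · simp only [seg, List.getElem_cons_succ]
      rw [ih]; congr 1; omega

/-- A closed trail through all vertices is a Hamilton cycle with the prescribed orientation. -/
theorem Trail.exists_equiv {V : Type*} [Fintype V] {G : V → V → Prop} {n : ℕ}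
    (hn : Fintype.card V = n) (hpos : 0 < n) (c : ℕ → Bool) {x : V} {S : Finset V}
    (h : Trail (stepRel G) (seg c 0 n) x x S) :
    ∃ e : ZMod n ≃ V, ∀ i : ZMod n, stepRel G (c i.val) (e i) (e (i + 1)) := by
  have : NeZero n := ⟨hpos.ne'⟩
  obtain ⟨f, h0, h1, h2, -, h4⟩ := h.exists_fun
  simp only [seg_length, seg_getElem, Nat.zero_add] at h1 h2 h4
  have hper : ∀ i : ZMod n, f (i + 1).val = f (i.val + 1) := by
    intro i
    have hi := ZMod.val_lt i
    by_cases hlt : i.val + 1 < n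
    · rw [ZMod.val_add_of_lt]
      · rcases Nat.lt_or_ge 1 n with h | h
        · have : Fact (1 < n) := ⟨h⟩
          rw [ZMod.val_one]
        · omega
      · rcases Nat.lt_or_ge 1 n with h | h
        · have : Fact (1 < n) := ⟨h⟩
          rwa [ZMod.val_one]
        · omega
    · have : i.val + 1 = n := by omega
      have h' : i + 1 = 0 := by
        rw [← ZMod.natCast_zmod_val i]
        rw [← Nat.cast_one, ← Nat.cast_add, this, ZMod.natCast_self]
      rw [h', ZMod.val_zero, h0, this, h1]
  have hinj : Function.Injective fun i : ZMod n => f i.val := by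
    have hinj' : Function.Injective fun i : ZMod n => f (i + 1).val := by
      intro i j hij
      simp only [hper] at hij
      exact ZMod.val_injective n (h4 _ (ZMod.val_lt i) _ (ZMod.val_lt j) hij)
    intro i j hij
    have := @hinj' (i - 1) (j - 1) (by simpa using hij)
    simpa using this
  refine ⟨Equiv.ofBijective _ ((Fintype.bijective_iff_injective_and_card _).2
    ⟨hinj, by rw [ZMod.card, hn]⟩), fun i => ?_⟩
  simp only [Equiv.ofBijective_apply, hper]
  exact h2 _ (ZMod.val_lt i)

/-- Robust expansion in both directions, for all sets of size at least `κ n`. -/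
structure Expander {V : Type*} [Fintype V] (R : V → V → Prop) (κ μ : ℝ) : Prop where
  outDeg_ge : ∀ x, κ * Fintype.card V ≤ (univ.filter fun z => R x z).card
  inDeg_ge : ∀ x, κ * Fintype.card V ≤ (univ.filter fun z => R z x).card
  pred_ge : ∀ S : Finset V, κ * Fintype.card V ≤ S.card →
    min (Fintype.card V : ℝ) (S.card + μ * Fintype.card V) ≤
      (univ.filter fun x => μ * Fintype.card V ≤ (S.filter fun z => R x z).card).card
  succ_ge : ∀ S : Finset V, κ * Fintype.card V ≤ S.card →
    min (Fintype.card V : ℝ) (S.card + μ * Fintype.card V) ≤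
      (univ.filter fun x => μ * Fintype.card V ≤ (S.filter fun z => R z x).card).card

namespace Expander

variable {V : Type*} [Fintype V] {R : V → V → Prop} {κ μ : ℝ}

theorem swap (h : Expander R κ μ) : Expander (fun x y => R y x) κ μ :=
  ⟨h.inDeg_ge, h.outDeg_ge, h.succ_ge, h.pred_ge⟩

theorem mono (h : Expander R κ μ) {μ' : ℝ} (hμ : μ' ≤ μ) : Expander R κ μ' := by
  have hm : μ' * Fintype.card V ≤ μ * Fintype.card V := by gcongr
  refine ⟨h.outDeg_ge, h.inDeg_ge, fun S hS => ?_, fun S hS => ?_⟩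
  · refine (min_le_min le_rfl (by linarith)).trans ((h.pred_ge S hS).trans ?_)
    exact_mod_cast Finset.card_le_card (Finset.monotone_filter_right _ fun x _ hx => hm.trans hx)
  · refine (min_le_min le_rfl (by linarith)).trans ((h.succ_ge S hS).trans ?_)
    exact_mod_cast Finset.card_le_card (Finset.monotone_filter_right _ fun x _ hx => hm.trans hx)

theorem stepRel {G : V → V → Prop} (h : Expander G κ μ) (s : Bool) :
    Expander (stepRel G s) κ μ := by
  cases s
  · exact h.swap
  · exact h

end Expander

theorem cast_card_le_univ {V : Type*} [Fintype V] (S : Finset V) :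
    (S.card : ℝ) ≤ Fintype.card V := by
  exact_mod_cast Finset.card_le_univ S

theorem card_filter_add_card_ge {V : Type*} [Fintype V] (S : Finset V) (p : V → Prop) :
    ((univ.filter p).card : ℝ) + S.card ≤ (S.filter p).card + Fintype.card V := by
  norm_cast
  have h1 := Finset.card_union_add_card_inter (univ.filter p) S
  have h2 : (univ.filter p) ∩ S = S.filter p := by ext; simp [and_comm]
  have h3 := Finset.card_le_univ ((univ.filter p) ∪ S)
  rw [h2] at h1
  omega

theorem RobustOutexpander.pred_ge {V : Type*} [Fintype V] {G : V → V → Prop} {η ν τ : ℝ}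
    (hη1 : η < 1) (hν : 0 < ν) (hντ : ν ≤ τ) (hτ : τ ≤ η / 4)
    (hpos : 0 < Fintype.card V)
    (hdeg : ∀ v : V, η * (Fintype.card V : ℝ) ≤ (outDeg G v : ℝ) ∧
        η * (Fintype.card V : ℝ) ≤ (inDeg G v : ℝ))
    (hG : RobustOutexpander G ν τ) (S : Finset V) (hS : η / 2 * Fintype.card V ≤ S.card) :
    min (Fintype.card V : ℝ) (S.card + ν ^ 2 / 2 * Fintype.card V) ≤
      (univ.filter fun x =>
        ν ^ 2 / 2 * Fintype.card V ≤ ((S.filter fun z => G x z).card : ℝ)).card := by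
  have hn : (0 : ℝ) < Fintype.card V := by exact_mod_cast hpos
  set n := (Fintype.card V : ℝ) with hn_def
  have hτ0 : 0 < τ := hν.trans_le hντ
  have hη0 : 0 < η := by linarith
  have hμν : ν ^ 2 / 2 ≤ ν / 2 := by nlinarith
  set μ := ν ^ 2 / 2 with hμ_def
  have hμ0 : 0 < μ := by positivity
  simp only [outDeg, inDeg] at hdeg
  by_contra! hlt
  set P := univ.filter fun x => μ * n ≤ ((S.filter fun z => G x z).card : ℝ) with hP
  set T := univ.filter fun x => ¬ μ * n ≤ ((S.filter fun z => G x z).card : ℝ) with hT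
  have hPT : (P.card : ℝ) + T.card = n := by
    rw [hn_def, ← Finset.card_univ (α := V)]
    exact_mod_cast Finset.card_filter_add_card_filter_not _
  obtain ⟨hlt1, hlt2⟩ := lt_min_iff.1 hlt
  have hTpos : 0 < T.card := by
    have : (0 : ℝ) < T.card := by linarith
    exact_mod_cast this
  obtain ⟨t, ht⟩ := Finset.card_pos.1 hTpos
  have hTn : (T.card : ℝ) ≤ n := cast_card_le_univ T
  have hdc : (∑ t ∈ T, ((S.filter fun z => G t z).card : ℝ)) =
      ∑ z ∈ S, ((T.filter fun t => G t z).card : ℝ) := by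
    exact_mod_cast Finset.sum_card_bipartiteAbove_eq_sum_card_bipartiteBelow G
  have hup : (∑ t ∈ T, ((S.filter fun z => G t z).card : ℝ)) ≤ μ * n ^ 2 := by
    refine (Finset.sum_le_card_nsmul T _ (μ * n) fun t ht => ?_).trans ?_
    · have := (Finset.mem_filter.1 ht).2
      linarith
    · rw [nsmul_eq_mul]
      have : 0 ≤ μ * n := by positivity
      nlinarith
  by_cases h1 : (T.card : ℝ) ≤ τ * n
  · have := (Finset.mem_filter.1 ht).2
    apply this
    have h2 : ((univ.filter fun z => G t z).card : ℝ) + S.card ≤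
      (S.filter fun z => G t z).card + n := card_filter_add_card_ge S _
    have h3 := (hdeg t).1
    nlinarith
  by_cases h2 : (T.card : ℝ) < (1 - τ) * n
  · have h3 := hG T (lt_of_not_ge h1) h2
    have h4 : ((robustOutNbhd G ν T).card : ℝ) + S.card ≤
        ((robustOutNbhd G ν T ∩ S).card : ℝ) + n := by
      have := card_filter_add_card_ge S (· ∈ robustOutNbhd G ν T)
      simp only [Finset.filter_mem_eq_inter, Finset.univ_inter] at this
      rw [Finset.inter_comm]
      exact this
    have h5 : ((robustOutNbhd G ν T ∩ S).card : ℝ) * (ν * n) ≤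
        ∑ z ∈ S, ((T.filter fun t => G t z).card : ℝ) := by
      rw [← nsmul_eq_mul]
      refine (Finset.card_nsmul_le_sum _ (fun z => ((T.filter fun t => G t z).card : ℝ)) _
        fun z hz => ?_).trans (Finset.sum_le_sum_of_subset_of_nonneg Finset.inter_subset_right
          fun _ _ _ => by positivity)
      exact (Finset.mem_filter.1 (Finset.mem_inter.1 hz).1).2
    have h6 : (ν - μ) * n < ((robustOutNbhd G ν T ∩ S).card : ℝ) := by
      nlinarith
    have h7 : (ν - μ) * n * (ν * n) < μ * n ^ 2 := by
      have : 0 < ν * n := by positivity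
      nlinarith
    have h8 : (ν - μ) * ν < μ := by
      have : (ν - μ) * ν * n ^ 2 < μ * n ^ 2 := by nlinarith
      exact lt_of_mul_lt_mul_right this (by positivity)
    nlinarith
  · push Not at h2
    have h5 : (S.card : ℝ) * ((η - τ) * n) ≤
        ∑ z ∈ S, ((T.filter fun t => G t z).card : ℝ) := by
      rw [← nsmul_eq_mul]
      refine Finset.card_nsmul_le_sum _ (fun z => ((T.filter fun t => G t z).card : ℝ)) _
        fun z hz => ?_
      have h3 := (hdeg z).2
      have h4 : ((univ.filter fun y => G y z).card : ℝ) + T.card ≤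
        (T.filter fun y => G y z).card + n := card_filter_add_card_ge T _
      nlinarith
    have h6 : (η / 2 * n) * ((η - τ) * n) ≤ μ * n ^ 2 := by
      have : 0 ≤ (η - τ) * n := by
        apply mul_nonneg <;> linarith
      exact (mul_le_mul_of_nonneg_right hS this).trans (h5.trans (hdc ▸ hup))
    have h8 : (η / 2) * (η - τ) ≤ μ := by
      have : ((η / 2) * (η - τ)) * n ^ 2 ≤ μ * n ^ 2 := by
        refine le_trans (le_of_eq ?_) h6
        ring
      exact le_of_mul_le_mul_right this (by positivity)
    have h9 : η * (3 * η / 4) ≤ η * (η - τ) := mul_le_mul_of_nonneg_left (by linarith) hη0.le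
    have h10 : ν ^ 2 ≤ (η / 4) ^ 2 := by gcongr; linarith
    have h11 : 0 < η ^ 2 := by positivity
    linarith [show μ = ν ^ 2 / 2 from hμ_def]

theorem RobustOutexpander.expander {V : Type*} [Fintype V] {G : V → V → Prop} {η ν τ : ℝ}
    (hη1 : η < 1) (hν : 0 < ν) (hντ : ν ≤ τ) (hτ : τ ≤ η / 4)
    (hpos : 0 < Fintype.card V)
    (hdeg : ∀ v : V, η * (Fintype.card V : ℝ) ≤ (outDeg G v : ℝ) ∧
        η * (Fintype.card V : ℝ) ≤ (inDeg G v : ℝ))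
    (hG : RobustOutexpander G ν τ) : Expander G (η / 2) (ν ^ 2 / 2) := by
  have hpred := hG.pred_ge hη1 hν hντ hτ hpos hdeg
  have hn : (0 : ℝ) < Fintype.card V := by exact_mod_cast hpos
  set n := (Fintype.card V : ℝ) with hn_def
  have hτ0 : 0 < τ := hν.trans_le hντ
  have hη0 : 0 < η := by linarith
  have hμν : ν ^ 2 / 2 ≤ ν / 2 := by nlinarith
  set μ := ν ^ 2 / 2 with hμ_def
  have hμ0 : 0 < μ := by positivity
  simp only [outDeg, inDeg] at hdeg
  refine ⟨fun x => le_trans (by nlinarith) (hdeg x).1, fun x => le_trans (by nlinarith) (hdeg x).2,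
    hpred, fun S hS => ?_⟩
  by_cases h1 : (S.card : ℝ) < (1 - τ) * n
  · refine (min_le_right _ _).trans (le_trans ?_ ((hG S (by nlinarith) h1).trans ?_))
    · nlinarith
    · have : μ * n ≤ ν * n := by nlinarith
      exact_mod_cast Finset.card_le_card
        (Finset.monotone_filter_right _ fun x _ hx => this.trans hx)
  · refine (min_le_left _ _).trans ?_
    rw [Finset.filter_true_of_mem]
    · simp
    · intro x _
      have h3 := (hdeg x).2
      have h4 : ((univ.filter fun y => G y x).card : ℝ) + S.card ≤
        (S.filter fun y => G y x).card + n := card_filter_add_card_ge S _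
      nlinarith

/-- Two vertices having at least `μ n` common out-neighbours. -/
def Aco {V : Type*} [Fintype V] (R : V → V → Prop) (μ : ℝ) (u v : V) : Prop :=
  μ * Fintype.card V ≤ (univ.filter fun x => R u x ∧ R v x).card

theorem Aco.symm {V : Type*} [Fintype V] {R : V → V → Prop} {μ : ℝ} {u v : V} (h : Aco R μ u v) :
    Aco R μ v u := by
  simpa [Aco, and_comm] using h

theorem Aco.comm {V : Type*} [Fintype V] {R : V → V → Prop} {μ : ℝ} {u v : V} :
    Aco R μ u v ↔ Aco R μ v u := ⟨Aco.symm, Aco.symm⟩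

/-- If the average of `f ≤ n` over at most `n` elements is at least `a n`, many values are at least
`a n / 2`. -/
theorem card_filter_ge_of_sum_ge {ι : Type*} (S : Finset ι) (f : ι → ℝ) {n a : ℝ} (hn : 0 < n)
    (ha : 0 ≤ a)
    (hS : (S.card : ℝ) ≤ n) (hf : ∀ i ∈ S, f i ≤ n) (hsum : a * n ^ 2 ≤ ∑ i ∈ S, f i) :
    a / 2 * n ≤ ((S.filter fun i => a / 2 * n ≤ f i).card : ℝ) := by
  have h1 := Finset.sum_filter_add_sum_filter_not S (fun i => a / 2 * n ≤ f i) f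
  have h2 : ∑ i ∈ S.filter (fun i => a / 2 * n ≤ f i), f i ≤
      (S.filter fun i => a / 2 * n ≤ f i).card • n :=
    Finset.sum_le_card_nsmul _ _ _ fun i hi => hf i (Finset.mem_filter.1 hi).1
  have h3 : ∑ i ∈ S.filter (fun i => ¬ a / 2 * n ≤ f i), f i ≤
      (S.filter fun i => ¬ a / 2 * n ≤ f i).card • (a / 2 * n) :=
    Finset.sum_le_card_nsmul _ _ _ fun i hi => (lt_of_not_ge (Finset.mem_filter.1 hi).2).le
  have h4 : ((S.filter fun i => ¬ a / 2 * n ≤ f i).card : ℝ) ≤ n :=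
    le_trans (by exact_mod_cast Finset.card_filter_le _ _) hS
  rw [nsmul_eq_mul] at h2 h3
  have h5 : 0 ≤ a / 2 * n := by positivity
  have h6 : a / 2 * n * n ≤ (S.filter fun i => a / 2 * n ≤ f i).card * n := by nlinarith
  exact le_of_mul_le_mul_right h6 hn

theorem Expander.aco {V : Type*} [Fintype V] {R : V → V → Prop} {κ μ : ℝ} (h : Expander R κ μ)
    (hpos : 0 < Fintype.card V) (hκ : κ ≤ 1) (hμ0 : 0 < μ) (hμ1 : μ ≤ 1) :
    Expander (Aco R (μ ^ 2 / 2)) κ (μ ^ 2 / 2) := by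
  have hn : (0 : ℝ) < Fintype.card V := by exact_mod_cast hpos
  set n := (Fintype.card V : ℝ) with hn_def
  have hμ' : μ ^ 2 / 2 ≤ μ := by nlinarith
  have hmn : μ ^ 2 / 2 * n ≤ μ * n := by gcongr
  have hdeg : ∀ x, κ * n ≤ ((univ.filter fun z => Aco R (μ ^ 2 / 2) x z).card : ℝ) := by
    intro x
    have h1 := h.pred_ge _ (h.outDeg_ge x)
    have h2 : κ * n ≤ min n (((univ.filter fun z => R x z).card : ℝ) + μ * n) := by
      refine le_min (by nlinarith) ?_
      have := h.outDeg_ge x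
      nlinarith
    refine (h2.trans h1).trans ?_
    refine Nat.cast_le.2 (Finset.card_le_card (Finset.monotone_filter_right _ fun v _ hv => ?_))
    rw [Finset.filter_filter] at hv
    exact hmn.trans hv
  have hexp : ∀ S : Finset V, κ * n ≤ S.card → min n (S.card + μ ^ 2 / 2 * n) ≤
      ((univ.filter fun x => μ ^ 2 / 2 * n ≤
        ((S.filter fun z => Aco R (μ ^ 2 / 2) x z).card : ℝ)).card : ℝ) := by
    intro S hS
    set P := univ.filter fun x => μ * n ≤ ((S.filter fun z => R z x).card : ℝ) with hP
    have h1 : min n (S.card + μ * n) ≤ (P.card : ℝ) := h.succ_ge S hS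
    have hSn : (S.card : ℝ) ≤ n := cast_card_le_univ S
    have h2 : (S.card : ℝ) ≤ P.card := (le_min hSn (by nlinarith)).trans h1
    have h3 := h.pred_ge P (hS.trans h2)
    refine (min_le_min le_rfl ?_).trans (h3.trans ?_)
    · linarith
    refine Nat.cast_le.2 (Finset.card_le_card (Finset.monotone_filter_right _ fun u _ hu => ?_))
    have hdc : (∑ x ∈ P.filter (fun x => R u x), ((S.filter fun z => R z x).card : ℝ)) =
        ∑ z ∈ S, (((P.filter fun x => R u x).filter fun x => R z x).card : ℝ) := by
      exact_mod_cast (Finset.sum_card_bipartiteAbove_eq_sum_card_bipartiteBelow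
        (s := P.filter (fun x => R u x)) (t := S) (fun x z => R z x))
    have hlow : μ ^ 2 * n ^ 2 ≤
        ∑ x ∈ P.filter (fun x => R u x), ((S.filter fun z => R z x).card : ℝ) := by
      have := Finset.card_nsmul_le_sum (P.filter (fun x => R u x))
        (fun x => ((S.filter fun z => R z x).card : ℝ)) (μ * n) fun x hx =>
          (Finset.mem_filter.1 (Finset.mem_filter.1 hx).1).2
      rw [nsmul_eq_mul] at this
      have h0 : 0 < μ * n := by positivity
      nlinarith
    have hle : ∀ z ∈ S, (((P.filter fun x => R u x).filter fun x => R z x).card : ℝ) ≤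
        ((univ.filter fun x => R u x ∧ R z x).card : ℝ) := by
      intro z _
      rw [Finset.filter_filter]
      exact_mod_cast Finset.card_le_card (Finset.filter_subset_filter _ (Finset.subset_univ _))
    rw [hdc] at hlow
    exact card_filter_ge_of_sum_ge S _ hn (by positivity) hSn
      (fun z _ => cast_card_le_univ _) (hlow.trans (Finset.sum_le_sum hle))
  exact ⟨hdeg, fun x => by simpa only [Aco.comm (v := x)] using hdeg x, hexp,
    fun S hS => by
      have := hexp S hS
      simp only [Aco.comm (R := R)] at this ⊢
      convert this using 8⟩

/-- The vertices from which `y` can be reached robustly along the word `l`. -/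
noncomputable def reach {V σ : Type*} [Fintype V] (R : σ → V → V → Prop) (t : ℝ) (y : V) :
    List σ → Finset V
  | [] => {y}
  | [s] => univ.filter fun x => R s x y
  | s :: r :: l => univ.filter fun x => t ≤ ((reach R t y (r :: l)).filter fun z => R s x z).card

section Connect

variable {V σ : Type*} [Fintype V] {R : σ → V → V → Prop} {κ μ : ℝ}

theorem le_card_reach (hR : ∀ s, Expander (R s) κ μ) (hμ : 0 ≤ μ) (y : V) (l : List σ)
    (hl : l ≠ []) : min (Fintype.card V : ℝ) ((κ + μ * (l.length - 1)) * Fintype.card V) ≤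
      ((reach R (μ * Fintype.card V) y l).card : ℝ) := by
  induction l with
  | nil => exact absurd rfl hl
  | cons s l ih =>
    rcases l with _ | ⟨r, l⟩
    · refine (min_le_right _ _).trans ?_
      simpa [reach] using (hR s).inDeg_ge y
    · have ih := ih (by simp)
      have hn : (0 : ℝ) ≤ Fintype.card V := by positivity
      rcases le_total (κ * Fintype.card V) ((reach R (μ * Fintype.card V) y (r :: l)).card : ℝ)
        with h | h
      · refine le_trans ?_ ((hR s).pred_ge _ h)
        refine le_min (min_le_left _ _) ?_
        rcases min_le_iff.1 ih with h' | h'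
        · refine (min_le_left _ _).trans (h'.trans ?_)
          nlinarith [mul_nonneg hμ hn]
        · refine (min_le_right _ _).trans ?_
          push_cast [List.length_cons] at h' ⊢
          nlinarith
      · rcases min_le_iff.1 ih with h' | h'
        · have h2 : ((reach R (μ * Fintype.card V) y (r :: l)).card : ℝ) ≤ Fintype.card V :=
            cast_card_le_univ _
          have h3 : ((reach R (μ * Fintype.card V) y (r :: l)).card : ℝ) = Fintype.card V := by
            linarith
          have h4 : reach R (μ * Fintype.card V) y (r :: l) = univ :=
            (Finset.card_eq_iff_eq_univ _).1 (by exact_mod_cast h3)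
          rw [reach, h4]
          have h5 := (hR s).pred_ge univ
          rw [Finset.card_univ] at h5
          refine le_trans ?_ (h5 ?_)
          · exact le_min (min_le_left _ _) ((min_le_left _ _).trans
              (le_add_of_nonneg_right (mul_nonneg hμ hn)))
          · rw [← h3, h3]
            have := (hR s).outDeg_ge y
            exact this.trans (cast_card_le_univ _)
        · have h0 : κ * Fintype.card V ≤ ((reach R (μ * Fintype.card V) y (r :: l)).card : ℝ) := by
            refine le_trans ?_ h'
            gcongr
            push_cast [List.length_cons]
            nlinarith [mul_nonneg hμ (Nat.cast_nonneg (α := ℝ) l.length)]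
          refine le_trans ?_ ((hR s).pred_ge _ h0)
          refine min_le_min le_rfl ?_
          push_cast [List.length_cons] at h' ⊢
          nlinarith

theorem exists_trail_of_mem_reach {l : List σ} {x y : V} {t : ℝ} (hx : x ∈ reach R t y l)
    (hl : l ≠ []) (Z : Finset V) (hZ : (Z.card : ℝ) + l.length ≤ t) :
    ∃ S, y ∉ S ∧ Disjoint S Z ∧ Trail R l x y (insert y S) := by
  induction l generalizing x Z with
  | nil => exact absurd rfl hl
  | cons s l ih =>
    rcases l with _ | ⟨r, l⟩
    · refine ⟨∅, by simp, by simp, ?_⟩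
      simpa using Trail.single (R := R) (Finset.mem_filter.1 hx).2
    · have h1 := (Finset.mem_filter.1 hx).2
      have h2 : (insert y Z).card < ((reach R t y (r :: l)).filter fun z => R s x z).card := by
        have h3 : ((insert y Z).card : ℝ) ≤ Z.card + 1 := by
          exact_mod_cast Finset.card_insert_le _ _
        push_cast [List.length_cons] at hZ
        have : (0 : ℝ) ≤ l.length := by positivity
        have h4 : ((insert y Z).card : ℝ) <
            ((reach R t y (r :: l)).filter fun z => R s x z).card := by linarith
        exact_mod_cast h4
      obtain ⟨z, hz1, hz2⟩ := Finset.exists_mem_notMem_of_card_lt_card h2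
      rw [Finset.mem_filter] at hz1
      simp only [Finset.mem_insert, not_or] at hz2
      obtain ⟨S, hyS, hSZ, hS⟩ := ih hz1.1 (by simp) (insert z Z) (by
        have h3 : ((insert z Z).card : ℝ) ≤ Z.card + 1 := by
          exact_mod_cast Finset.card_insert_le _ _
        push_cast [List.length_cons] at hZ ⊢
        linarith)
      rw [Finset.disjoint_insert_right] at hSZ
      refine ⟨insert z S, ?_, ?_, ?_⟩
      · simp only [Finset.mem_insert, not_or]
        exact ⟨fun h => hz2.1 h.symm, hyS⟩
      · rw [Finset.disjoint_insert_left]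
        exact ⟨hz2.2, hSZ.2⟩
      · rw [Finset.insert_comm]
        refine .cons hz1.2 hS ?_
        simp only [Finset.mem_insert, not_or]
        exact ⟨hz2.1, hSZ.1⟩

/-- Any two vertices are joined by a trail with a given long enough label word avoiding a given
small set. -/
theorem exists_connecting_trail (hR : ∀ s, Expander (R s) κ μ) (hμ : 0 ≤ μ) {L : ℕ}
    (hL : 1 ≤ κ + μ * (L - 1)) (l : List σ) (hl : L ≤ l.length) (hl0 : l ≠ []) (x y : V)
    (Z : Finset V) (hZ : (Z.card : ℝ) + l.length ≤ μ * Fintype.card V) :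
    ∃ S, y ∉ S ∧ Disjoint S Z ∧ Trail R l x y (insert y S) := by
  refine exists_trail_of_mem_reach (t := μ * Fintype.card V) ?_ hl0 Z hZ
  have h := le_card_reach hR hμ y l hl0
  have h1 : (1 : ℝ) ≤ κ + μ * (l.length - 1) := by
    have : (L : ℝ) ≤ l.length := by exact_mod_cast hl
    nlinarith
  rw [min_eq_left (by nlinarith [Nat.cast_nonneg (α := ℝ) (Fintype.card V)])] at h
  have h2 : reach R (μ * Fintype.card V) y l = univ :=
    (Finset.card_eq_iff_eq_univ _).1 (le_antisymm (Finset.card_le_univ _) (by exact_mod_cast h))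
  rw [h2]; exact Finset.mem_univ x

/-- Greedy embedding of a path with a free end. -/
theorem exists_free_trail (hR : ∀ s x, κ * Fintype.card V ≤ (univ.filter fun z => R s x z).card)
    (l : List σ) (x : V) (Z : Finset V) (hZ : (Z.card : ℝ) + l.length ≤ κ * Fintype.card V) :
    ∃ y S, Disjoint S Z ∧ Trail R l x y S := by
  induction l generalizing x Z with
  | nil => exact ⟨x, ∅, by simp, .nil x⟩
  | cons s l ih =>
    push_cast [List.length_cons] at hZ
    have h1 : Z.card < (univ.filter fun z => R s x z).card := by
      have h4 : (Z.card : ℝ) < (univ.filter fun z => R s x z).card := by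
        have := hR s x
        have : (0 : ℝ) ≤ l.length := by positivity
        linarith
      exact_mod_cast h4
    obtain ⟨z, hz1, hz2⟩ := Finset.exists_mem_notMem_of_card_lt_card h1
    obtain ⟨y, S, hS, hT⟩ := ih z (insert z Z) (by
      rw [Finset.card_insert_of_notMem hz2]; push_cast; linarith)
    rw [Finset.disjoint_insert_right] at hS
    exact ⟨y, insert z S, Finset.disjoint_insert_left.2 ⟨hz2, hS.2⟩,
      .cons (Finset.mem_filter.1 hz1).2 hT hS.1⟩

end Connect

/-- Weighted averaging: some element of `T` passes tests of total weight at least the average. -/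
theorem exists_weighted_average {ι α : Type*} (I : Finset ι) (T : Finset α) (hT : T.Nonempty)
    (P : ι → α → Prop) (w : ι → ℝ) (hw : ∀ i ∈ I, 0 ≤ w i) {N ρ : ℝ} (hρ : 0 ≤ ρ)
    (hTN : (T.card : ℝ) ≤ N) (hP : ∀ i ∈ I, ρ * N ≤ ((T.filter fun a => P i a).card : ℝ)) :
    ∃ a ∈ T, ρ * ∑ i ∈ I, w i ≤ ∑ i ∈ I with P i a, w i := by
  by_contra! hcon
  have h1 := Finset.sum_lt_sum_of_nonempty hT hcon
  have hW : 0 ≤ ∑ i ∈ I, w i := Finset.sum_nonneg hw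
  have h2 : ∑ a ∈ T, ∑ i ∈ I with P i a, w i =
      ∑ i ∈ I, ((T.filter fun a => P i a).card : ℝ) * w i := by
    simp_rw [Finset.sum_filter]
    rw [Finset.sum_comm]
    refine Finset.sum_congr rfl fun i _ => ?_
    rw [← Finset.sum_filter, Finset.sum_const, nsmul_eq_mul]
  have h3 : ρ * N * ∑ i ∈ I, w i ≤ ∑ i ∈ I, ((T.filter fun a => P i a).card : ℝ) * w i := by
    rw [Finset.mul_sum]
    exact Finset.sum_le_sum fun i hi => mul_le_mul_of_nonneg_right (hP i hi) (hw i hi)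
  rw [h2, Finset.sum_const, nsmul_eq_mul] at h1
  nlinarith [mul_nonneg hρ hW]

/-- Multiplicative weights: if at every stage there is an admissible item avoiding what was used
before and passing tests of at least an `a`-fraction of any given weight, then there is a sequence
of disjoint items such that every test is passed often. -/
theorem exists_sequence_passing {ι O V : Type*} [Fintype ι] (acc : O → ι → Prop)
    (used : O → Finset V) (ok : ℕ → O → O → Prop) (Z₀ : Finset V) (K : ℕ → ℕ) (s : ℕ) (o₀ : O)
    {a θ : ℝ}
    (hθ0 : 0 < θ) (hθ1 : θ < 1)
    (H : ∀ j < s, ∀ prev, ∀ Z : Finset V, Z₀ ⊆ Z → Z.card ≤ Z₀.card + ∑ i ∈ range j, K i →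
      ∀ w : ι → ℝ, (∀ i, 0 < w i) → ∃ o, ok j prev o ∧ Disjoint (used o) Z ∧ (used o).card ≤ K j ∧
        a * ∑ i, w i ≤ ∑ i with acc o i, w i) :
    ∃ f : ℕ → O, f 0 = o₀ ∧ (∀ j < s, ok j (f j) (f (j + 1))) ∧
      (∀ j < s, Disjoint (used (f (j + 1))) Z₀ ∧ (used (f (j + 1))).card ≤ K j) ∧
      (∀ i < s, ∀ j < s, i ≠ j → Disjoint (used (f (i + 1))) (used (f (j + 1)))) ∧
      ∀ i, θ ^ ((range s).filter fun j => acc (f (j + 1)) i).card ≤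
        Fintype.card ι * (1 - a * (1 - θ)) ^ s := by
  suffices h : ∃ f : ℕ → O, f 0 = o₀ ∧ (∀ j < s, ok j (f j) (f (j + 1))) ∧
      (∀ j < s, Disjoint (used (f (j + 1))) Z₀ ∧ (used (f (j + 1))).card ≤ K j) ∧
      (∀ i < s, ∀ j < s, i ≠ j → Disjoint (used (f (i + 1))) (used (f (j + 1)))) ∧
      ∑ i, θ ^ ((range s).filter fun j => acc (f (j + 1)) i).card ≤
        Fintype.card ι * (1 - a * (1 - θ)) ^ s by
    obtain ⟨f, h0, h1, h2, h3, h4⟩ := h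
    refine ⟨f, h0, h1, h2, h3, fun i => le_trans ?_ h4⟩
    exact Finset.single_le_sum
      (f := fun i => θ ^ ((range s).filter fun j => acc (f (j + 1)) i).card)
      (fun _ _ => by positivity) (Finset.mem_univ i)
  induction s with
  | zero => exact ⟨fun _ => o₀, rfl, by simp, by simp, by simp, by simp⟩
  | succ s ih =>
    obtain ⟨f, h0, h1, h2, h3, h4⟩ := ih fun j hj => H j (by omega)
    obtain ⟨o, ho1, ho2, ho3, ho4⟩ := H s (by omega) (f s)
      (Z₀ ∪ (range s).biUnion fun j => used (f (j + 1))) Finset.subset_union_left (by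
        refine (Finset.card_union_le _ _).trans (Nat.add_le_add_left ?_ _)
        exact Finset.card_biUnion_le.trans
          (Finset.sum_le_sum fun j hj => (h2 j (Finset.mem_range.1 hj)).2))
      (fun i => θ ^ ((range s).filter fun j => acc (f (j + 1)) i).card) (fun i => by positivity)
    rw [Finset.disjoint_union_right, Finset.disjoint_biUnion_right] at ho2
    set g : ℕ → O := fun j => if j = s + 1 then o else f j with hg
    have hgs : g (s + 1) = o := by simp [hg]
    have hgj : ∀ j < s + 1, g j = f j := fun j hj => by simp [hg, show j ≠ s + 1 by omega]
    refine ⟨g, by rw [hgj _ (by omega), h0], fun j hj => ?_, fun j hj => ?_,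
      fun i hi j hj hij => ?_, ?_⟩
    · rcases (Nat.lt_succ_iff_lt_or_eq.1 hj) with h | rfl
      · rw [hgj _ (by omega), hgj _ (by omega)]; exact h1 j h
      · rw [hgs, hgj _ (by omega)]; exact ho1
    · rcases (Nat.lt_succ_iff_lt_or_eq.1 hj) with h | rfl
      · rw [hgj _ (by omega)]; exact h2 j h
      · rw [hgs]; exact ⟨ho2.1, ho3⟩
    · rcases (Nat.lt_succ_iff_lt_or_eq.1 hi) with h | rfl <;>
        rcases (Nat.lt_succ_iff_lt_or_eq.1 hj) with h' | rfl
      · rw [hgj _ (by omega), hgj _ (by omega)]; exact h3 i h j h' hij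
      · rw [hgs, hgj _ (by omega)]; exact (ho2.2 i (by simpa using h)).symm
      · rw [hgs, hgj _ (by omega)]; exact ho2.2 j (by simpa using h')
      · exact absurd rfl hij
    · have key : ∀ i, θ ^ ((range (s + 1)).filter fun j => acc (g (j + 1)) i).card =
          θ ^ ((range s).filter fun j => acc (f (j + 1)) i).card - (1 - θ) *
            (if acc o i then θ ^ ((range s).filter fun j => acc (f (j + 1)) i).card else 0) := by
        intro i
        have e : ((range s).filter fun j => acc (g (j + 1)) i) =
            (range s).filter fun j => acc (f (j + 1)) i :=
          Finset.filter_congr fun j hj => by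
            rw [hgj _ (by have := Finset.mem_range.1 hj; omega)]
        rw [Finset.range_add_one, Finset.filter_insert, hgs, e]
        split_ifs with h
        · rw [Finset.card_insert_of_notMem (by simp), pow_succ]; ring
        · simp
      rw [Finset.sum_congr rfl fun i _ => key i, Finset.sum_sub_distrib, ← Finset.mul_sum,
        ← Finset.sum_filter, pow_succ]
      have h5 : 0 < 1 - θ := by linarith
      have h6 := mul_le_mul_of_nonneg_left ho4 h5.le
      have h7 : (∑ i, θ ^ ((range s).filter fun j => acc (f (j + 1)) i).card) *
          (1 - a * (1 - θ)) ≤ Fintype.card ι * (1 - a * (1 - θ)) ^ s * (1 - a * (1 - θ)) ∨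
          1 - a * (1 - θ) < 0 := by
        rcases lt_or_ge (1 - a * (1 - θ)) 0 with h | h
        · exact .inr h
        · exact .inl (mul_le_mul_of_nonneg_right h4 h)
      rcases h7 with h7 | h7
      · linarith
      · have hW : 0 ≤ ∑ i, θ ^ ((range s).filter fun j => acc (f (j + 1)) i).card :=
          Finset.sum_nonneg fun i _ => by positivity
        have h8 : ∑ i with acc o i, θ ^ ((range s).filter fun j => acc (f (j + 1)) i).card ≤
            ∑ i, θ ^ ((range s).filter fun j => acc (f (j + 1)) i).card :=
          Finset.sum_le_sum_of_subset_of_nonneg (Finset.filter_subset _ _)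
            fun i _ _ => by positivity
        have h9 : (∑ i, θ ^ ((range s).filter fun j => acc (f (j + 1)) i).card) = 0 := by
          nlinarith
        have h10 : IsEmpty ι := by
          by_contra hne
          rw [not_isEmpty_iff] at hne
          have := Finset.sum_pos (s := univ)
            (f := fun i => θ ^ ((range s).filter fun j => acc (f (j + 1)) i).card)
            (fun i _ => by positivity) Finset.univ_nonempty
          linarith
        simp

/-- Averaging over a set of vertices from which a small set has been deleted. -/
theorem exists_average_notMem {ι V : Type*} [Fintype V] (I : Finset ι) (T F : Finset V)
    (P : ι → V → Prop) (w : ι → ℝ) (hw : ∀ i, 0 ≤ w i) {ρ : ℝ} (hρ : 0 ≤ ρ)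
    (hT : ρ * Fintype.card V ≤ T.card)
    (hP : ∀ i ∈ I, ρ * Fintype.card V ≤ ((T.filter fun a => P i a).card : ℝ))
    (hF : (F.card : ℝ) + 1 ≤ ρ / 2 * Fintype.card V) :
    ∃ a ∈ T, a ∉ F ∧ ρ / 2 * ∑ i ∈ I, w i ≤ ∑ i ∈ I with P i a, w i := by
  have hsub : ∀ A : Finset V, (A.card : ℝ) ≤ (A \ F).card + F.card := fun A => by
    exact_mod_cast Finset.card_le_card_sdiff_add_card
  have hnn : 0 ≤ ρ * Fintype.card V := by positivity
  have hne : (T \ F).Nonempty := by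
    rw [← Finset.card_pos]
    have := hsub T
    have : (0 : ℝ) < (T \ F).card := by linarith
    exact_mod_cast this
  obtain ⟨a, ha, h⟩ := exists_weighted_average I (T \ F) hne P w (fun i _ => hw i)
    (N := Fintype.card V) (ρ := ρ / 2) (by positivity) (cast_card_le_univ _) (fun i hi => by
      have h1 := hP i hi
      have h2 := hsub (T.filter fun a => P i a)
      have h3 : (T.filter fun a => P i a) \ F = (T \ F).filter fun a => P i a := by
        ext; simp; tauto
      rw [h3] at h2
      linarith)
  rw [Finset.mem_sdiff] at ha
  exact ⟨a, ha.1, ha.2, h⟩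

theorem exists_mem_filter_notMem {V : Type*} {A F : Finset V} {t : ℝ} (hA : t ≤ A.card)
    (hF : (F.card : ℝ) < t) : ∃ a ∈ A, a ∉ F :=
  Finset.exists_mem_notMem_of_card_lt_card (by exact_mod_cast hF.trans_le hA)

/-- A trail along `β` from `x` to `y` with vertex set `W` which misses one vertex; any vertex of
`Acc` outside `W` can be inserted. -/
structure SlotAbs {V : Type*} (G : V → V → Prop) (β : List Bool) (x y : V) (W Acc : Finset V) :
    Prop where
  card_eq : W.card + 1 = β.length
  end_mem : y ∈ W
  trail : ∀ u ∈ Acc, u ∉ W → Trail (stepRel G) β x y (insert u W)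

theorem SlotAbs.append {V : Type*} {G : V → V → Prop} {β β' : List Bool} {x y z : V}
    {W Acc S : Finset V} (h : SlotAbs G β x y W Acc) (h' : Trail (stepRel G) β' y z S)
    (hd : Disjoint W S) : SlotAbs G (β ++ β') x z (W ∪ S) Acc where
  card_eq := by
    rw [Finset.card_union_of_disjoint hd, List.length_append, ← h.card_eq, h'.card_eq]; omega
  end_mem := by
    by_cases hβ : β' = []
    · subst hβ; cases h'; simpa using h.end_mem
    · exact Finset.mem_union_right _ (h'.end_mem hβ)
  trail u hu huW := by
    rw [Finset.mem_union, not_or] at huW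
    rw [← Finset.insert_union]
    exact (h.trail u hu huW.1).append h' (Finset.disjoint_insert_left.2 ⟨huW.2, hd⟩)

/-- A slot absorber for the word `β` can be found, from any starting point, avoiding any set of
size at most `z n`, and rejecting only a `δ`-fraction of any given weight. -/
def Slottable {V : Type*} [Fintype V] (G : V → V → Prop) (δ z : ℝ) (β : List Bool) : Prop :=
  ∀ (x : V) (Z : Finset V), (Z.card : ℝ) ≤ z * Fintype.card V → ∀ w : V → ℝ, (∀ v, 0 ≤ w v) →
    ∃ y W Acc, SlotAbs G β x y W Acc ∧ Disjoint W Z ∧ ∑ u ∈ Accᶜ, w u ≤ δ * ∑ u, w u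

/-- Concatenation of the words `l ++ [s, !s]`. -/
def sinkWord (s : Bool) (ls : List (List Bool)) : List Bool :=
  ls.flatMap fun l => l ++ [s, !s]

theorem stepRel_not {V : Type*} (G : V → V → Prop) (s : Bool) (x y : V) :
    stepRel G (!s) x y ↔ stepRel G s y x := by
  cases s <;> rfl

theorem trail_sink {V : Type*} {G : V → V → Prop} {s : Bool} {x y u : V}
    (hx : stepRel G s x u) (hy : stepRel G s y u) (huy : u ≠ y) :
    Trail (stepRel G) [s, !s] x y {u, y} :=
  .cons hx (.single ((stepRel_not G s u y).2 hy)) (by simpa using huy)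

/-- The first slot. -/
theorem SlotAbs.sink_init {V : Type*} {G : V → V → Prop} {s : Bool} {l : List Bool}
    {x x₀ y₀ : V} {C Acc : Finset V}
    (hC : Trail (stepRel G) l x x₀ (insert x₀ C)) (hy₀ : y₀ ∉ insert x₀ C)
    (hAcc : ∀ u ∈ Acc, stepRel G s x₀ u ∧ stepRel G s y₀ u) :
    SlotAbs G (l ++ [s, !s]) x y₀ (insert y₀ (insert x₀ C)) Acc where
  card_eq := by
    have := hC.card_eq
    rw [Finset.card_insert_of_notMem hy₀, this]
    simp
  end_mem := by simp
  trail u hu huW := by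
    rw [Finset.mem_insert, not_or] at huW
    have := hC.append (trail_sink (hAcc u hu).1 (hAcc u hu).2 huW.1) (by
      rw [Finset.disjoint_insert_right, Finset.disjoint_singleton_right]
      exact ⟨huW.2, hy₀⟩)
    convert this using 1
    ext; simp; tauto

section Sink

variable {V : Type*} [Fintype V] {G : V → V → Prop} {s : Bool} {κ μ : ℝ} {L : ℕ}

/-- Adding a further slot, whose default filling is `v`. -/
theorem SlotAbs.sink_extend {β l : List Bool} {x y x' y' v : V} {W Acc C : Finset V}
    (h : SlotAbs G β x y W Acc) (hv : v ∈ Acc) (hvW : v ∉ W)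
    (hC : Trail (stepRel G) l y x' (insert x' C))
    (hCW : Disjoint (insert x' C) W) (hvC : v ∉ insert x' C) (hy' : y' ∉ insert x' C)
    (hyW : y' ∉ W) (hyv : v ≠ y') (hx'v : stepRel G s x' v) (hy'v : stepRel G s y' v) :
    SlotAbs G (β ++ (l ++ [s, !s])) x y' (W ∪ insert x' C ∪ {v, y'})
      (Acc ∪ univ.filter fun u => stepRel G s x' u ∧ stepRel G s y' u) where
  card_eq := by
    have h1 : Disjoint (W ∪ insert x' C) {v, y'} := by
      rw [Finset.disjoint_insert_right, Finset.disjoint_singleton_right, Finset.mem_union,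
        Finset.mem_union]
      tauto
    rw [Finset.card_union_of_disjoint h1, Finset.card_union_of_disjoint hCW.symm, hC.card_eq,
      Finset.card_pair hyv]
    have := h.card_eq
    simp only [List.length_append, List.length_cons, List.length_nil]
    omega
  end_mem := by simp
  trail u hu huW := by
    simp only [Finset.mem_union, not_or] at huW
    have huv : u ≠ v := fun h => huW.2 (by simp [h])
    have huy : u ≠ y' := fun h => huW.2 (by simp [h])
    rw [Finset.mem_union, Finset.mem_filter] at hu
    rcases hu with hu | ⟨-, hu1, hu2⟩
    · have h1 := h.trail u hu huW.1.1
      have h2 := hC.append (trail_sink hx'v hy'v hyv) (by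
        rw [Finset.disjoint_insert_right, Finset.disjoint_singleton_right]
        exact ⟨hvC, hy'⟩)
      have h3 := h1.append h2 (by
        simp only [Finset.disjoint_insert_left, Finset.disjoint_union_right,
          Finset.disjoint_insert_right, Finset.disjoint_singleton_right, Finset.mem_insert,
          Finset.mem_singleton] at *
        grind)
      convert h3 using 1
      ext; simp; tauto
    · have h1 := h.trail v hv hvW
      have h2 := hC.append (trail_sink hu1 hu2 huy) (by
        rw [Finset.disjoint_insert_right, Finset.disjoint_singleton_right]
        exact ⟨huW.1.2, hy'⟩)
      have h3 := h1.append h2 (by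
        simp only [Finset.disjoint_insert_left, Finset.disjoint_union_right,
          Finset.disjoint_insert_right, Finset.disjoint_singleton_right, Finset.mem_insert,
          Finset.mem_singleton] at *
        grind)
      convert h3 using 1
      ext; simp; tauto

set_option maxHeartbeats 1000000 in
/-- Walking from an accepted vertex `v` to `v'` along a trail of pairs with many common
in-neighbours, adding one slot for each step. -/
theorem SlotAbs.sink_walk (hG : Expander G κ μ) (hμ : 0 ≤ μ) (hL : 1 ≤ κ + μ * (L - 1))
    (hL1 : 1 ≤ L) {t : List Unit} {v v' : V} {S : Finset V}
    (hS : Trail (fun _ => Aco (fun x y => stepRel G s y x) μ) t v v' S) (hvS : v ∉ S)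
    (ls : List (List Bool)) (hls : ∀ l ∈ ls, L ≤ l.length) (hlen : ls.length = t.length)
    {β : List Bool} {x y : V} {W Acc Z : Finset V}
    (h : SlotAbs G β x y W Acc) (hv : v ∈ Acc) (hvW : v ∉ W) (hWZ : Disjoint W Z)
    (hvZ : v ∉ Z) (hSZ : Disjoint S Z) (hSW : Disjoint S W)
    (hn : (Z.card : ℝ) + β.length + (sinkWord s ls).length + t.length + 5
      ≤ μ * Fintype.card V) :
    ∃ y' W' Acc', SlotAbs G (β ++ sinkWord s ls) x y' W' Acc' ∧ v' ∈ Acc' ∧ v' ∉ W' ∧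
      Disjoint W' Z ∧ Acc ⊆ Acc' := by
  induction hS generalizing ls β y W Acc with
  | nil v =>
    obtain rfl : ls = [] := List.length_eq_zero_iff.1 hlen
    exact ⟨y, W, Acc, by simpa [sinkWord] using h, hv, hvW, hWZ, Finset.Subset.refl _⟩
  | @cons a t v z v' S hA hS hz ih =>
    rcases ls with _ | ⟨l, ls⟩
    · simp at hlen
    have hScard := hS.card_eq
    have hWcard := h.card_eq
    have hlL := hls l (by simp)
    simp only [sinkWord, List.flatMap_cons, List.length_append, List.length_cons,
      List.length_nil] at hn hlen ⊢
    push_cast at hn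
    have hflat : (0 : ℝ) ≤ (ls.flatMap fun l => l ++ [s, !s]).length := by positivity
    have hl0 : (0 : ℝ) ≤ l.length := by positivity
    have hWr : (W.card : ℝ) + 1 = β.length := by exact_mod_cast hWcard
    have hSr : (S.card : ℝ) = t.length := by exact_mod_cast hScard
    rw [Finset.disjoint_insert_left] at hSW hSZ
    rw [Finset.mem_insert, not_or] at hvS
    -- the new slot
    set F := W ∪ (Z ∪ insert v (insert z S)) with hF
    have hFcard : (F.card : ℝ) ≤ W.card + (Z.card + (S.card + 2)) := by
      have h1 := Finset.card_union_le W (Z ∪ insert v (insert z S))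
      have h2 := Finset.card_union_le Z (insert v (insert z S))
      have h3 := Finset.card_insert_le v (insert z S)
      have h4 := Finset.card_insert_le z S
      have : F.card ≤ W.card + (Z.card + (S.card + 2)) := by rw [hF]; omega
      exact_mod_cast this
    obtain ⟨x', hx', hx'F⟩ := exists_mem_filter_notMem hA (F := F) (by linarith)
    obtain ⟨y', hy', hy'F⟩ := exists_mem_filter_notMem hA (F := insert x' F) (by
      have h1 : ((insert x' F).card : ℝ) ≤ F.card + 1 := by
        exact_mod_cast Finset.card_insert_le _ _
      linarith)
    rw [Finset.mem_filter] at hx' hy'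
    obtain ⟨C, hx'C, hCZ, hC⟩ := exists_connecting_trail hG.stepRel hμ hL l hlL
      (by rintro rfl; simp at hlL; omega) y x' (insert y' F) (by
        have h1 : ((insert y' F).card : ℝ) ≤ F.card + 1 := by
          exact_mod_cast Finset.card_insert_le _ _
        linarith)
    simp only [hF, Finset.disjoint_insert_right, Finset.disjoint_union_right, Finset.mem_insert,
      Finset.mem_union, not_or] at hx'F hy'F hCZ
    have hext := h.sink_extend (s := s) hv hvW hC
      (by rw [Finset.disjoint_insert_left]; grind)
      (by rw [Finset.mem_insert]; grind) (by rw [Finset.mem_insert]; grind) (by grind)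
      (by grind) hx'.2.1 hy'.2.1
    obtain ⟨y'', W', Acc', h1, h2, h3, h4, h5⟩ := ih hz ls
      (fun l hl => hls l (by simp [hl])) (by omega) hext
      (Finset.mem_union_right _ (Finset.mem_filter.2 ⟨Finset.mem_univ _, hx'.2.2, hy'.2.2⟩))
      (by
        simp only [Finset.mem_union, Finset.mem_insert, Finset.mem_singleton]
        grind)
      (by
        simp only [Finset.disjoint_union_left, Finset.disjoint_insert_left,
          Finset.disjoint_singleton_left]
        grind) hSZ.1 hSZ.2 (by
        simp only [Finset.disjoint_union_right, Finset.disjoint_insert_right,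
          Finset.disjoint_singleton_right]
        grind) (by
        simp only [sinkWord, List.length_append, List.length_cons, List.length_nil]
        push_cast
        linarith)
    refine ⟨y'', W', Acc', ?_, h2, h3, h4, Finset.Subset.trans Finset.subset_union_left h5⟩
    simpa [sinkWord, List.append_assoc] using h1

end Sink

theorem sinkWord_append (s : Bool) (ls ls' : List (List Bool)) :
    sinkWord s (ls ++ ls') = sinkWord s ls ++ sinkWord s ls' :=
  List.flatMap_append

theorem card_insert_le_cast {V : Type*} (a : V) (S : Finset V) :
    ((insert a S).card : ℝ) ≤ S.card + 1 := by
  exact_mod_cast Finset.card_insert_le a S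

theorem card_union_le_cast {V : Type*} (S T : Finset V) :
    ((S ∪ T).card : ℝ) ≤ S.card + T.card := by
  exact_mod_cast Finset.card_union_le S T

section SinkRounds

variable {V : Type*} [Fintype V] {G : V → V → Prop} {s : Bool} {κ μ : ℝ} {L : ℕ}

set_option maxHeartbeats 1000000 in
/-- One round: the weight of the rejected vertices decreases by a constant factor. -/
theorem SlotAbs.sink_round (hG : Expander G κ μ)
    (hA : Expander (Aco (fun x y => stepRel G s y x) μ) κ μ) (hμ : 0 < μ) (hμκ : μ ≤ κ)
    (hL : 1 ≤ κ + μ * (L - 1)) (hL1 : 1 ≤ L) (ls : List (List Bool)) (l : List Bool)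
    (hls : ∀ l ∈ ls, L ≤ l.length) (hl : L ≤ l.length) (hlen : ls.length = L)
    {β : List Bool} {x y : V} {W Acc Z : Finset V}
    (h : SlotAbs G β x y W Acc) (hAcc : μ * Fintype.card V ≤ Acc.card) (hWZ : Disjoint W Z)
    (w : V → ℝ) (hw : ∀ v, 0 ≤ w v)
    (hn : (Z.card : ℝ) + β.length + (sinkWord s (ls ++ [l])).length + L + 10
      ≤ μ / 2 * Fintype.card V) :
    ∃ y' W' Acc', SlotAbs G (β ++ sinkWord s (ls ++ [l])) x y' W' Acc' ∧ Disjoint W' Z ∧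
      Acc ⊆ Acc' ∧ ∑ u ∈ Acc'ᶜ, w u ≤ (1 - (μ / 2) ^ 3) * ∑ u ∈ Accᶜ, w u := by
  have hnn : (0 : ℝ) ≤ Fintype.card V := by positivity
  have hκn : μ * Fintype.card V ≤ κ * Fintype.card V := by gcongr
  have hsw : (sinkWord s (ls ++ [l])).length = (sinkWord s ls).length + (l.length + 2) := by
    rw [sinkWord_append, List.length_append]; simp [sinkWord]
  rw [hsw] at hn
  push_cast at hn
  have hWr : (W.card : ℝ) + 1 = β.length := by exact_mod_cast h.card_eq
  have hp1 : (0 : ℝ) ≤ (sinkWord s ls).length := by positivity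
  have hp2 : (0 : ℝ) ≤ l.length := by positivity
  have hp3 : (0 : ℝ) ≤ L := by positivity
  have hp4 : (0 : ℝ) ≤ Z.card := by positivity
  have hFc := card_union_le_cast W Z
  have hμ2 : μ / 2 * Fintype.card V ≤ μ * Fintype.card V := by nlinarith
  obtain ⟨v, hv, hvF⟩ := exists_mem_filter_notMem hAcc (F := W ∪ Z) (by linarith)
  obtain ⟨t, -, htF, ht⟩ := exists_average_notMem Accᶜ univ (insert v (W ∪ Z))
    (fun u a => Aco (fun x y => stepRel G s y x) μ u a) w hw hμ.le
    (hκn.trans ((hA.outDeg_ge v).trans (cast_card_le_univ _ |>.trans (by simp))))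
    (fun u _ => hκn.trans (hA.outDeg_ge u)) (by
      have := card_insert_le_cast v (W ∪ Z); linarith)
  obtain ⟨p, hpt, hpF, hp⟩ := exists_average_notMem
    (Accᶜ.filter fun u => Aco (fun x y => stepRel G s y x) μ u t)
    (univ.filter fun a => stepRel G s a t) (insert t (insert v (W ∪ Z)))
    (fun u a => stepRel G s a u) w hw hμ.le (hκn.trans ((hG.stepRel s).inDeg_ge t))
    (fun u hu => by
      rw [Finset.filter_filter]
      simpa only [Aco, and_comm] using (Finset.mem_filter.1 hu).2) (by
      have := card_insert_le_cast v (W ∪ Z)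
      have := card_insert_le_cast t (insert v (W ∪ Z)); linarith)
  obtain ⟨q, hqt, hqF, hq⟩ := exists_average_notMem
    ((Accᶜ.filter fun u => Aco (fun x y => stepRel G s y x) μ u t).filter
      fun u => stepRel G s p u)
    (univ.filter fun a => stepRel G s a t) (insert p (insert t (insert v (W ∪ Z))))
    (fun u a => stepRel G s a u) w hw hμ.le (hκn.trans ((hG.stepRel s).inDeg_ge t))
    (fun u hu => by
      rw [Finset.filter_filter]
      simpa only [Aco, and_comm] using (Finset.mem_filter.1 (Finset.mem_filter.1 hu).1).2) (by
      have := card_insert_le_cast v (W ∪ Z)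
      have := card_insert_le_cast t (insert v (W ∪ Z))
      have := card_insert_le_cast p (insert t (insert v (W ∪ Z))); linarith)
  rw [Finset.mem_filter] at hpt hqt
  obtain ⟨S, htS, hSF, hS⟩ := exists_connecting_trail (σ := Unit) (fun _ => hA) hμ.le hL
    (List.replicate L ()) (by simp) (by simp; omega) v t
    (insert q (insert p (insert v (W ∪ Z)))) (by
      have := card_insert_le_cast v (W ∪ Z)
      have := card_insert_le_cast p (insert v (W ∪ Z))
      have := card_insert_le_cast q (insert p (insert v (W ∪ Z)))
      rw [List.length_replicate]; linarith)
  simp only [Finset.mem_insert, Finset.mem_union, not_or, Finset.disjoint_insert_right,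
    Finset.disjoint_union_right] at hvF htF hpF hqF hSF
  obtain ⟨y₁, W₁, Acc₁, h1, ht1, htW1, hWZ1, hsub⟩ := SlotAbs.sink_walk (s := s) hG hμ.le hL hL1
    hS (by grind) ls hls (by simp [hlen]) (Z := insert p (insert q Z)) h hv hvF.1
    (by grind) (by grind) (by grind) (by grind) (by
      have := card_insert_le_cast q Z
      have := card_insert_le_cast p (insert q Z)
      rw [List.length_replicate]; linarith)
  have hW1c : (W₁.card : ℝ) + 1 = β.length + (sinkWord s ls).length := by
    have := h1.card_eq
    rw [List.length_append] at this
    exact_mod_cast this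
  obtain ⟨C, hpC, hCF, hC⟩ := exists_connecting_trail hG.stepRel hμ.le hL l hl
    (by rintro rfl; simp at hl; omega) y₁ p (insert q (insert t (W₁ ∪ Z))) (by
      have := card_union_le_cast W₁ Z
      have := card_insert_le_cast t (W₁ ∪ Z)
      have := card_insert_le_cast q (insert t (W₁ ∪ Z))
      linarith)
  simp only [Finset.disjoint_insert_right, Finset.disjoint_union_right] at hWZ1 hCF
  have hext := h1.sink_extend (s := s) (v := t) (y' := q) ht1 htW1 hC (by grind)
    (by grind) (by grind) (by grind) (by grind) hpt.2 hqt.2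
  refine ⟨q, W₁ ∪ insert p C ∪ {t, q},
    Acc₁ ∪ univ.filter fun u => stepRel G s p u ∧ stepRel G s q u, ?_, ?_, ?_, ?_⟩
  · rw [sinkWord_append, ← List.append_assoc]
    simpa [sinkWord] using hext
  · simp only [Finset.disjoint_union_left, Finset.disjoint_insert_left,
      Finset.disjoint_singleton_left]
    grind
  · exact Finset.Subset.trans hsub Finset.subset_union_left
  · have hle : ∑ u ∈ (Acc₁ ∪ univ.filter fun u => stepRel G s p u ∧ stepRel G s q u)ᶜ, w u +
        ∑ u ∈ ((Accᶜ.filter fun u => Aco (fun x y => stepRel G s y x) μ u t).filter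
          fun u => stepRel G s p u).filter fun u => stepRel G s q u, w u ≤
        ∑ u ∈ Accᶜ, w u := by
      rw [← Finset.sum_union]
      · refine Finset.sum_le_sum_of_subset_of_nonneg ?_ fun u _ _ => hw u
        intro u hu
        simp only [Finset.mem_union, Finset.mem_compl, Finset.mem_filter, Finset.mem_univ,
          true_and, not_or] at hu ⊢
        rcases hu with hu | hu
        · exact fun h => hu.1 (hsub h)
        · exact hu.1.1.1
      · rw [Finset.disjoint_left]
        intro u hu hu'
        simp only [Finset.mem_union, Finset.mem_compl, Finset.mem_filter, Finset.mem_univ,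
          true_and, not_or] at hu hu'
        exact hu.2 ⟨hu'.1.2, hu'.2⟩
    have h3 : (μ / 2) ^ 3 * ∑ u ∈ Accᶜ, w u ≤
        ∑ u ∈ ((Accᶜ.filter fun u => Aco (fun x y => stepRel G s y x) μ u t).filter
          fun u => stepRel G s p u).filter fun u => stepRel G s q u, w u := by
      refine le_trans ?_ hq
      have e2 := mul_le_mul_of_nonneg_left ht (show 0 ≤ (μ / 2) ^ 2 by positivity)
      have e1 := mul_le_mul_of_nonneg_left hp (show 0 ≤ μ / 2 by positivity)
      calc (μ / 2) ^ 3 * ∑ u ∈ Accᶜ, w u = (μ / 2) ^ 2 * (μ / 2 * ∑ u ∈ Accᶜ, w u) := by ring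
        _ ≤ _ := e2
        _ = _ := by rw [pow_two, mul_assoc]
        _ ≤ _ := e1
    linarith

theorem SlotAbs.sink_rounds (hG : Expander G κ μ)
    (hA : Expander (Aco (fun x y => stepRel G s y x) μ) κ μ) (hμ : 0 < μ) (hμ1 : μ ≤ 1)
    (hμκ : μ ≤ κ) (hL : 1 ≤ κ + μ * (L - 1)) (hL1 : 1 ≤ L) (M : ℕ) (ls : List (List Bool))
    (hls : ∀ l ∈ ls, L ≤ l.length) (hlen : ls.length = M * (L + 1))
    {β : List Bool} {x y : V} {W Acc Z : Finset V}
    (h : SlotAbs G β x y W Acc) (hAcc : μ * Fintype.card V ≤ Acc.card) (hWZ : Disjoint W Z)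
    (w : V → ℝ) (hw : ∀ v, 0 ≤ w v)
    (hn : (Z.card : ℝ) + β.length + (sinkWord s ls).length + L + 10
      ≤ μ / 2 * Fintype.card V) :
    ∃ y' W' Acc', SlotAbs G (β ++ sinkWord s ls) x y' W' Acc' ∧ Disjoint W' Z ∧
      ∑ u ∈ Acc'ᶜ, w u ≤ (1 - (μ / 2) ^ 3) ^ M * ∑ u ∈ Accᶜ, w u := by
  induction M generalizing ls β y W Acc with
  | zero =>
    obtain rfl : ls = [] := List.length_eq_zero_iff.1 (by simpa using hlen)
    exact ⟨y, W, Acc, by simpa [sinkWord] using h, hWZ, by simp⟩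
  | succ M ih =>
    obtain ⟨l₁, l, l₂, rfl, hl₁, hl₂⟩ : ∃ l₁ l l₂, ls = l₁ ++ [l] ++ l₂ ∧ l₁.length = L ∧
        l₂.length = M * (L + 1) := by
      have hlt : L < ls.length := by rw [hlen]; nlinarith
      refine ⟨ls.take L, ls[L], ls.drop (L + 1), ?_, ?_, ?_⟩
      · rw [List.take_append_getElem hlt, List.take_append_drop]
      · simp; omega
      · rw [List.length_drop, hlen, Nat.succ_mul]; omega
    have hlen' : (sinkWord s (l₁ ++ [l] ++ l₂)).length =
        (sinkWord s (l₁ ++ [l])).length + (sinkWord s l₂).length := by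
      rw [sinkWord_append, List.length_append]
    rw [hlen'] at hn
    push_cast at hn
    obtain ⟨y₁, W₁, Acc₁, h1, h2, h3, h4⟩ := h.sink_round hG hA hμ hμκ hL hL1 l₁ l
      (fun a ha => hls a (by simp [ha])) (hls l (by simp)) hl₁ hAcc hWZ w hw (by
        have : (0 : ℝ) ≤ (sinkWord s l₂).length := by positivity
        linarith)
    obtain ⟨y₂, W₂, Acc₂, h5, h6, h7⟩ := ih l₂ (fun a ha => hls a (by simp [ha])) hl₂ h1
      (hAcc.trans (by exact_mod_cast Finset.card_le_card h3)) h2 (by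
        rw [List.length_append]; push_cast; linarith)
    refine ⟨y₂, W₂, Acc₂, ?_, h6, h7.trans ?_⟩
    · rw [sinkWord_append, ← List.append_assoc]; exact h5
    · rw [pow_succ (1 - (μ / 2) ^ 3), mul_assoc]
      refine mul_le_mul_of_nonneg_left h4 (pow_nonneg ?_ _)
      have : (μ / 2) ^ 3 ≤ 1 := pow_le_one₀ (by positivity) (by linarith)
      linarith

/-- Words with many well-spaced sinks are slottable. -/
theorem slottable_sinkWord (hG : Expander G κ μ)
    (hA : Expander (Aco (fun x y => stepRel G s y x) μ) κ μ)
    (hA' : Expander (Aco (stepRel G s) μ) κ μ) (hμ : 0 < μ) (hμ1 : μ ≤ 1)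
    (hμκ : μ ≤ κ) (hL : 1 ≤ κ + μ * (L - 1)) (hL1 : 1 ≤ L) (M : ℕ) (ls : List (List Bool))
    (tail : List Bool)
    (hls : ∀ l ∈ ls, L ≤ l.length) (hlen : ls.length = M * (L + 1) + 1) {δ : ℝ}
    (hδ : (1 - (μ / 2) ^ 3) ^ M ≤ δ)
    (hn : ((sinkWord s ls ++ tail).length : ℝ) + L + 10 ≤ μ / 4 * Fintype.card V) :
    Slottable G δ (μ / 4) (sinkWord s ls ++ tail) := by
  intro x Z hZ w hw
  rcases ls with _ | ⟨l, ls⟩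
  · simp at hlen
  have hnn : (0 : ℝ) ≤ Fintype.card V := by positivity
  have hκn : μ * Fintype.card V ≤ κ * Fintype.card V := by gcongr
  have hl := hls l (by simp)
  have hsw : sinkWord s (l :: ls) = (l ++ [s, !s]) ++ sinkWord s ls := by
    simp [sinkWord]
  rw [hsw] at hn ⊢
  simp only [List.length_append, List.length_cons, List.length_nil] at hn
  push_cast at hn
  have hp1 : (0 : ℝ) ≤ (sinkWord s ls).length := by positivity
  have hp2 : (0 : ℝ) ≤ l.length := by positivity
  have hp3 : (0 : ℝ) ≤ L := by positivity
  have hp4 : (0 : ℝ) ≤ Z.card := by positivity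
  have hp5 : (0 : ℝ) ≤ tail.length := by positivity
  obtain ⟨y₀, hy₀, hy₀F⟩ := exists_mem_filter_notMem (A := univ) (F := Z)
    (show μ * Fintype.card V ≤ _ from hκn.trans
      ((hA.outDeg_ge x).trans (cast_card_le_univ _ |>.trans (by simp)))) (by linarith)
  obtain ⟨x₀, hx₀, hx₀F⟩ := exists_mem_filter_notMem (hκn.trans (hA'.inDeg_ge y₀))
    (F := insert y₀ Z) (by
      have := card_insert_le_cast y₀ Z; linarith)
  obtain ⟨C, hxC, hCF, hC⟩ := exists_connecting_trail hG.stepRel hμ.le hL l hl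
    (by rintro rfl; simp at hl; omega) x x₀ (insert y₀ Z) (by
      have := card_insert_le_cast y₀ Z; linarith)
  simp only [Finset.mem_insert, not_or, Finset.disjoint_insert_right] at hx₀F hCF
  have hinit := SlotAbs.sink_init (s := s) (y₀ := y₀)
    (Acc := univ.filter fun u => stepRel G s x₀ u ∧ stepRel G s y₀ u) hC (by grind) (by simp)
  obtain ⟨y₁, W₁, Acc₁, h1, h2, h3⟩ := hinit.sink_rounds (s := s) hG hA hμ hμ1 hμκ hL hL1 M ls
    (fun a ha => hls a (by simp [ha])) (by simpa using hlen) (Finset.mem_filter.1 hx₀).2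
    (Z := Z) (by
      simp only [Finset.disjoint_insert_left]
      grind) w hw (by
      simp only [List.length_append, List.length_cons, List.length_nil]
      push_cast
      linarith)
  have hW1c : (W₁.card : ℝ) + 1 = l.length + 2 + (sinkWord s ls).length := by
    have := h1.card_eq
    simp only [List.length_append, List.length_cons, List.length_nil] at this
    exact_mod_cast this
  obtain ⟨y₂, S, hS, hT⟩ := exists_free_trail (R := stepRel G) (κ := κ)
    (fun s x => (hG.stepRel s).outDeg_ge x) tail y₁ (W₁ ∪ Z) (by
      have := card_union_le_cast W₁ Z; linarith)
  rw [Finset.disjoint_union_right] at hS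
  refine ⟨y₂, W₁ ∪ S, Acc₁, h1.append hT hS.1.symm, ?_, h3.trans ?_⟩
  · rw [Finset.disjoint_union_left]; exact ⟨h2, hS.2⟩
  · refine mul_le_mul hδ (Finset.sum_le_sum_of_subset_of_nonneg (Finset.subset_univ _)
      fun u _ _ => hw u) (Finset.sum_nonneg fun u _ => hw u) (le_trans (pow_nonneg ?_ _) hδ)
    have : (μ / 2) ^ 3 ≤ 1 := pow_le_one₀ (by positivity) (by linarith)
    linarith

end SinkRounds

/-- A trail from `x` to `y` in direction `s` with a gap, such that the gap can be placed between
`p` and `q` for any pair in `Sl`. -/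
structure GapTrail {V : Type*} (G : V → V → Prop) (s : Bool) (N : ℕ) (x y : V) (W : Finset V)
    (Sl : V → V → Prop) : Prop where
  card_eq : W.card = N
  end_mem : y ∈ W
  plug : ∀ p q, Sl p q → ∀ (k : ℕ) (d d' : V) (S : Finset V),
    Trail (stepRel G) (List.replicate k s) d d' S → d ∉ S → stepRel G s p d → stepRel G s d' q →
    Disjoint (insert d S) W →
    Trail (stepRel G) (List.replicate (N + k + 1) s) x y (W ∪ insert d S)

theorem Trail.replicate_congr {V : Type*} {G : V → V → Prop} {s : Bool} {k k' : ℕ} {x y : V}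
    {S S' : Finset V} (h : Trail (stepRel G) (List.replicate k s) x y S) (hk : k = k')
    (hS : S = S') : Trail (stepRel G) (List.replicate k' s) x y S' := by
  subst hk hS; exact h

theorem Trail.replicate_append {V : Type*} {G : V → V → Prop} {s : Bool} {k k' : ℕ} {x y z : V}
    {S S' : Finset V} (h : Trail (stepRel G) (List.replicate k s) x y S)
    (h' : Trail (stepRel G) (List.replicate k' s) y z S') (hd : Disjoint S S') :
    Trail (stepRel G) (List.replicate (k + k') s) x z (S ∪ S') := by
  rw [List.replicate_add]; exact h.append h' hd

theorem Trail.replicate_cons {V : Type*} {G : V → V → Prop} {s : Bool} {k : ℕ} {x y z : V}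
    {S : Finset V} (h : stepRel G s x y) (h' : Trail (stepRel G) (List.replicate k s) y z S)
    (hd : y ∉ S) : Trail (stepRel G) (List.replicate (k + 1) s) x z (insert y S) := by
  rw [List.replicate_succ]; exact .cons h h' hd

theorem Trail.replicate_one {V : Type*} {G : V → V → Prop} {s : Bool} {x y : V}
    (h : stepRel G s x y) : Trail (stepRel G) (List.replicate 1 s) x y {y} :=
  Trail.single h

namespace GapTrail

variable {V : Type*} {G : V → V → Prop} {s : Bool}

theorem init {x x₀ y₀ : V} {C : Finset V} {j : ℕ}
    (hC : Trail (stepRel G) (List.replicate j s) x x₀ (insert x₀ C)) (hy₀ : y₀ ∉ insert x₀ C) :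
    GapTrail G s (j + 1) x y₀ (insert y₀ (insert x₀ C)) (fun p q => p = x₀ ∧ q = y₀) where
  card_eq := by
    rw [Finset.card_insert_of_notMem hy₀, hC.card_eq, List.length_replicate]
  end_mem := by simp
  plug := by
    rintro p q ⟨rfl, rfl⟩ k d d' S hS hd hpd hdq hdis
    have h1 := Trail.replicate_cons hpd (hS.replicate_append (Trail.replicate_one hdq)
        (Finset.disjoint_singleton_right.2 (by grind)))
      (by grind)
    refine (hC.replicate_append h1 (by grind)).replicate_congr (by omega) ?_
    ext; simp

theorem extend {N j k₀ : ℕ} {x y p q p' q' d₀ d₀' : V} {W D C : Finset V} {Sl : V → V → Prop}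
    (h : GapTrail G s N x y W Sl) (hpq : Sl p q)
    (hD : Trail (stepRel G) (List.replicate k₀ s) d₀ d₀' D) (hd₀ : d₀ ∉ D)
    (hDW : Disjoint (insert d₀ D) W)
    (hpd : stepRel G s p d₀) (hp'd : stepRel G s p' d₀) (hdq : stepRel G s d₀' q)
    (hdq' : stepRel G s d₀' q')
    (hC : Trail (stepRel G) (List.replicate j s) y p' (insert p' C))
    (hCW : Disjoint (insert p' C) W) (hCD : Disjoint (insert p' C) (insert d₀ D))
    (hq'W : q' ∉ W) (hq'C : q' ∉ insert p' C) (hq'D : q' ∉ insert d₀ D) :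
    GapTrail G s (N + (k₀ + 1) + j + 1) x q' (insert q' (W ∪ insert d₀ D ∪ insert p' C))
      (fun a b => Sl a b ∨ (a = p' ∧ b = q')) where
  card_eq := by
    have h1 : (insert d₀ D).card = k₀ + 1 := by
      rw [Finset.card_insert_of_notMem hd₀, hD.card_eq, List.length_replicate]
    have h2 : (insert p' C).card = j := by rw [hC.card_eq, List.length_replicate]
    rw [Finset.card_insert_of_notMem (by simp only [Finset.mem_union]; tauto),
      Finset.card_union_of_disjoint
        (Finset.disjoint_union_left.2 ⟨hCW.symm, hCD.symm⟩),
      Finset.card_union_of_disjoint hDW.symm, h1, h2, h.card_eq]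
  end_mem := by simp
  plug := by
    have hdd : ∀ (d : V) (S : Finset V), Disjoint (insert d S)
        (insert q' (W ∪ insert d₀ D ∪ insert p' C)) → Disjoint (insert d S) W ∧
        Disjoint (insert d S) (insert d₀ D) ∧ Disjoint (insert d S) (insert p' C) ∧
        q' ∉ insert d S := by
      intro d S hdis
      rw [Finset.disjoint_insert_right, Finset.disjoint_union_right,
        Finset.disjoint_union_right] at hdis
      exact ⟨hdis.2.1.1, hdis.2.1.2, hdis.2.2, hdis.1⟩
    rintro a b (hab | ⟨rfl, rfl⟩) k d d' S hS hd hpd' hdq'' hdis <;>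
      obtain ⟨e1, e2, e3, e4⟩ := hdd d S hdis
    · have h1 := h.plug a b hab k d d' S hS hd hpd' hdq'' e1
      have h2 := Trail.replicate_cons hp'd
        (hD.replicate_append (Trail.replicate_one hdq')
          (Finset.disjoint_singleton_right.2 (by grind))) (by grind)
      have h3 := h1.replicate_append (hC.replicate_append h2 (by
        simp only [Finset.disjoint_left] at *; grind)) (by
        simp only [Finset.disjoint_left] at *; grind)
      refine h3.replicate_congr (by omega) ?_
      ext; simp; tauto
    · have h1 := h.plug p q hpq k₀ d₀ d₀' D hD hd₀ hpd hdq hDW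
      have h2 := Trail.replicate_cons hpd'
        (hS.replicate_append (Trail.replicate_one hdq'')
          (Finset.disjoint_singleton_right.2 (by grind))) (by grind)
      have h3 := h1.replicate_append (hC.replicate_append h2 (by
        simp only [Finset.disjoint_left] at *; grind)) (by
        simp only [Finset.disjoint_left] at *; grind)
      refine h3.replicate_congr (by omega) ?_
      ext; simp

theorem slotAbs {N : ℕ} {x y : V} {W Acc : Finset V} {Sl : V → V → Prop}
    (h : GapTrail G s N x y W Sl)
    (hAcc : ∀ u ∈ Acc, ∃ p q, Sl p q ∧ stepRel G s p u ∧ stepRel G s u q) :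
    SlotAbs G (List.replicate (N + 1) s) x y W Acc where
  card_eq := by simp [h.card_eq]
  end_mem := h.end_mem
  trail u hu huW := by
    obtain ⟨p, q, hpq, hpu, huq⟩ := hAcc u hu
    refine (h.plug p q hpq 0 u u ∅ (.nil u) (by simp) hpu huq (by simpa using huW)).replicate_congr
      rfl ?_
    ext; simp

end GapTrail

section GapWalk

variable {V : Type*} [Fintype V] {G : V → V → Prop} {s : Bool} {κ μ : ℝ} {L : ℕ}

set_option maxHeartbeats 1000000 in
theorem GapTrail.walk (hG : Expander G κ μ) (hμ : 0 ≤ μ) (hL : 1 ≤ κ + μ * (L - 1))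
    (hL1 : 1 ≤ L) {t : List Unit} {p p' q q' : V} {P Q : Finset V}
    (hP : Trail (fun _ => Aco (stepRel G s) μ) t p p' P)
    (hQ : Trail (fun _ => Aco (fun x y => stepRel G s y x) μ) t q q' Q)
    {N : ℕ} {x y : V} {W Z : Finset V} {Sl : V → V → Prop}
    (h : GapTrail G s N x y W Sl) (hpq : Sl p q) (hWZ : Disjoint W Z)
    (hPZ : Disjoint P Z) (hPW : Disjoint P W) (hQZ : Disjoint Q Z) (hQW : Disjoint Q W)
    (hPQ : Disjoint P Q)
    (hn : (Z.card : ℝ) + N + t.length * (2 * L + 5) + L + 5 ≤ μ * Fintype.card V) :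
    ∃ y' W' Sl', GapTrail G s (N + t.length * (2 * L + 2)) x y' W' Sl' ∧ Sl' p' q' ∧
      Disjoint W' Z ∧ ∀ a b, Sl a b → Sl' a b := by
  induction hP generalizing q Q N y W Sl with
  | nil p =>
    cases hQ
    exact ⟨y, W, Sl, by simpa using h, hpq, hWZ, fun _ _ h => h⟩
  | @cons a t p z p' P hA hP hz ih =>
    obtain _ | @⟨_, _, _, z₂, _, Q, hA₂, hQ, hz₂⟩ := hQ
    have hPc : (P.card : ℝ) = t.length := by exact_mod_cast hP.card_eq
    have hQc : (Q.card : ℝ) = t.length := by exact_mod_cast hQ.card_eq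
    have hWc : (W.card : ℝ) = N := by exact_mod_cast h.card_eq
    have hL0 : (1 : ℝ) ≤ L := by exact_mod_cast hL1
    have ht0 : (0 : ℝ) ≤ t.length := by positivity
    have htL : (0 : ℝ) ≤ t.length * L := by positivity
    rw [List.length_cons] at hn
    push_cast at hn
    obtain ⟨F, hF⟩ : ∃ F, F = W ∪ (Z ∪ (insert z (insert z₂ (P ∪ Q)))) := ⟨_, rfl⟩
    have hFcard : (F.card : ℝ) ≤ N + (Z.card + (t.length + t.length + 2)) := by
      have h1 := card_union_le_cast W (Z ∪ (insert z (insert z₂ (P ∪ Q))))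
      have h2 := card_union_le_cast Z (insert z (insert z₂ (P ∪ Q)))
      have h3 := card_insert_le_cast z (insert z₂ (P ∪ Q))
      have h4 := card_insert_le_cast z₂ (P ∪ Q)
      have h5 := card_union_le_cast P Q
      rw [hF]; linarith
    obtain ⟨d, hd, hdF⟩ := exists_mem_filter_notMem hA (F := F) (by nlinarith)
    obtain ⟨d', hd', hd'F⟩ := exists_mem_filter_notMem hA₂ (F := insert d F) (by
      have := card_insert_le_cast d F
      nlinarith)
    rw [Finset.mem_filter] at hd hd'
    obtain ⟨D, hd'D, hDF, hD⟩ := exists_connecting_trail hG.stepRel hμ hL (List.replicate L s)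
      (by simp) (by simp; omega) d d' (insert d F) (by
        have := card_insert_le_cast d F
        rw [List.length_replicate]
        nlinarith)
    have hDc : (D.card : ℝ) + 1 = L := by
      have := hD.card_eq
      rw [Finset.card_insert_of_notMem hd'D, List.length_replicate] at this
      exact_mod_cast this
    obtain ⟨C, hzC, hCF, hC⟩ := exists_connecting_trail hG.stepRel hμ hL (List.replicate L s)
      (by simp) (by simp; omega) y z (insert d (insert d' (D ∪ F))) (by
        have := card_insert_le_cast d (insert d' (D ∪ F))
        have := card_insert_le_cast d' (D ∪ F)
        have := card_union_le_cast D F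
        rw [List.length_replicate]
        nlinarith)
    rw [hF] at hdF hd'F hDF hCF
    simp only [Finset.disjoint_insert_right, Finset.disjoint_union_right, Finset.mem_insert,
      Finset.mem_union, not_or, Finset.disjoint_insert_left] at *
    have hext := h.extend (p' := z) (q' := z₂) hpq hD
      (by simp only [Finset.mem_insert]; grind)
      (by simp only [Finset.disjoint_insert_left]; grind)
      hd.2.1 hd.2.2 hd'.2.1 hd'.2.2 hC
      (by simp only [Finset.disjoint_insert_left]; grind)
      (by simp only [Finset.disjoint_insert_left, Finset.disjoint_insert_right,
            Finset.mem_insert]; grind) (by grind) (by simp only [Finset.mem_insert]; grind)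
      (by simp only [Finset.mem_insert]; grind)
    obtain ⟨y', W', Sl', h1, h2, h3, h4⟩ := ih hQ hext (Or.inr ⟨rfl, rfl⟩)
      (by
        simp only [Finset.disjoint_insert_left, Finset.disjoint_union_left]
        grind) (by grind) (by
        simp only [Finset.disjoint_insert_right, Finset.disjoint_union_right]
        grind) (by grind) (by
        simp only [Finset.disjoint_insert_right, Finset.disjoint_union_right]
        grind) (by grind) (by
        push_cast
        nlinarith)
    refine ⟨y', W', Sl', ?_, h2, h3, fun a b hab => h4 a b (Or.inl hab)⟩
    convert h1 using 1
    rw [List.length_cons]; ring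

/-- The vertices which can be plugged into the gap. -/
noncomputable def gapAcc (G : V → V → Prop) (s : Bool) (Sl : V → V → Prop) : Finset V :=
  univ.filter fun u => ∃ p q, Sl p q ∧ stepRel G s p u ∧ stepRel G s u q

set_option maxHeartbeats 1000000 in
/-- One round: the weight of the rejected vertices decreases by a constant factor. -/
theorem GapTrail.round (hG : Expander G κ μ)
    (hA : Expander (Aco (stepRel G s) μ) κ μ)
    (hA' : Expander (Aco (fun x y => stepRel G s y x) μ) κ μ) (hμ : 0 < μ) (hμκ : μ ≤ κ)
    (hL : 1 ≤ κ + μ * (L - 1)) (hL1 : 1 ≤ L) {N : ℕ} {x y p q : V} {W Z : Finset V}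
    {Sl : V → V → Prop} (h : GapTrail G s N x y W Sl) (hpq : Sl p q) (hWZ : Disjoint W Z)
    (w : V → ℝ) (hw : ∀ v, 0 ≤ w v)
    (hn : (Z.card : ℝ) + N + L * (2 * L + 5) + 2 * L + 10 ≤ μ / 2 * Fintype.card V) :
    ∃ y' W' Sl', GapTrail G s (N + L * (2 * L + 2)) x y' W' Sl' ∧ (∃ p' q', Sl' p' q') ∧
      Disjoint W' Z ∧
      ∑ u ∈ (gapAcc G s Sl')ᶜ, w u ≤ (1 - (μ / 2) ^ 2) * ∑ u ∈ (gapAcc G s Sl)ᶜ, w u := by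
  have hnn : (0 : ℝ) ≤ Fintype.card V := by positivity
  have hκn : μ * Fintype.card V ≤ κ * Fintype.card V := by gcongr
  have hWr : (W.card : ℝ) = N := by exact_mod_cast h.card_eq
  have hp3 : (0 : ℝ) ≤ L := by positivity
  have hp5 : (0 : ℝ) ≤ N := by positivity
  have hp6 : (0 : ℝ) ≤ L * (2 * L + 5) := by positivity
  have hp4 : (0 : ℝ) ≤ Z.card := by positivity
  have hFc := card_union_le_cast W Z
  have hμ2 : μ / 2 * Fintype.card V ≤ μ * Fintype.card V := by nlinarith
  have huniv : μ * Fintype.card V ≤ (univ : Finset V).card := hκn.trans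
    ((hA.outDeg_ge x).trans (cast_card_le_univ _ |>.trans (by simp)))
  obtain ⟨p', -, hpF, hp⟩ := exists_average_notMem (gapAcc G s Sl)ᶜ univ (W ∪ Z)
    (fun u a => stepRel G s a u) w hw hμ.le huniv
    (fun u _ => hκn.trans ((hG.stepRel s).inDeg_ge u)) (by linarith)
  obtain ⟨q', -, hqF, hq⟩ := exists_average_notMem
    ((gapAcc G s Sl)ᶜ.filter fun u => stepRel G s p' u) univ (insert p' (W ∪ Z))
    (fun u a => stepRel G s u a) w hw hμ.le huniv
    (fun u _ => hκn.trans ((hG.stepRel s).outDeg_ge u)) (by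
      have := card_insert_le_cast p' (W ∪ Z); linarith)
  obtain ⟨P, hpP, hPF, hP⟩ := exists_connecting_trail (σ := Unit) (fun _ => hA) hμ.le hL
    (List.replicate L ()) (by simp) (by simp; omega) p p' (insert q' (W ∪ Z)) (by
      have := card_insert_le_cast q' (W ∪ Z)
      rw [List.length_replicate]; linarith)
  have hPc : (P.card : ℝ) + 1 = L := by
    have := hP.card_eq
    rw [Finset.card_insert_of_notMem hpP, List.length_replicate] at this
    exact_mod_cast this
  obtain ⟨Q, hqQ, hQF, hQ⟩ := exists_connecting_trail (σ := Unit) (fun _ => hA') hμ.le hL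
    (List.replicate L ()) (by simp) (by simp; omega) q q' (insert p' P ∪ (W ∪ Z)) (by
      have := card_insert_le_cast p' P
      have := card_union_le_cast (insert p' P) (W ∪ Z)
      rw [List.length_replicate]; linarith)
  simp only [Finset.mem_insert, Finset.mem_union, not_or, Finset.disjoint_insert_right,
    Finset.disjoint_union_right] at hpF hqF hPF hQF
  obtain ⟨y', W', Sl', h1, h2, h3, h4⟩ := GapTrail.walk hG hμ.le hL hL1 hP hQ h hpq hWZ
    (by simp only [Finset.disjoint_insert_left]; grind)
    (by simp only [Finset.disjoint_insert_left]; grind)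
    (by simp only [Finset.disjoint_insert_left]; grind)
    (by simp only [Finset.disjoint_insert_left]; grind)
    (by simp only [Finset.disjoint_insert_left, Finset.disjoint_insert_right,
          Finset.mem_insert]; grind)
    (by rw [List.length_replicate]; linarith)
  rw [List.length_replicate] at h1
  refine ⟨y', W', Sl', h1, ⟨p', q', h2⟩, h3, ?_⟩
  have hle : ∑ u ∈ (gapAcc G s Sl')ᶜ, w u +
      ∑ u ∈ (((gapAcc G s Sl)ᶜ.filter fun u => stepRel G s p' u).filter
        fun u => stepRel G s u q'), w u ≤ ∑ u ∈ (gapAcc G s Sl)ᶜ, w u := by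
    rw [← Finset.sum_union]
    · refine Finset.sum_le_sum_of_subset_of_nonneg ?_ fun u _ _ => hw u
      intro u hu
      simp only [Finset.mem_union, Finset.mem_compl, Finset.mem_filter, Finset.mem_univ,
        true_and, gapAcc] at hu ⊢
      rcases hu with hu | hu
      · rintro ⟨a, b, hab, hu'⟩
        exact hu ⟨a, b, h4 a b hab, hu'⟩
      · exact hu.1.1
    · rw [Finset.disjoint_left]
      intro u hu hu'
      simp only [Finset.mem_compl, Finset.mem_filter, Finset.mem_univ, true_and, gapAcc] at hu hu'
      exact hu ⟨p', q', h2, hu'.1.2, hu'.2⟩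
  have e1 := mul_le_mul_of_nonneg_left hp (show 0 ≤ μ / 2 by positivity)
  linarith [pow_two (μ / 2)]

theorem GapTrail.rounds (hG : Expander G κ μ)
    (hA : Expander (Aco (stepRel G s) μ) κ μ)
    (hA' : Expander (Aco (fun x y => stepRel G s y x) μ) κ μ) (hμ : 0 < μ) (hμ1 : μ ≤ 1)
    (hμκ : μ ≤ κ) (hL : 1 ≤ κ + μ * (L - 1)) (hL1 : 1 ≤ L) (M : ℕ) {N : ℕ} {x y p q : V}
    {W Z : Finset V} {Sl : V → V → Prop} (h : GapTrail G s N x y W Sl) (hpq : Sl p q)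
    (hWZ : Disjoint W Z) (w : V → ℝ) (hw : ∀ v, 0 ≤ w v)
    (hn : (Z.card : ℝ) + N + (M + 1) * (L * (2 * L + 5)) + 2 * L + 10 ≤
      μ / 2 * Fintype.card V) :
    ∃ y' W' Sl', GapTrail G s (N + M * (L * (2 * L + 2))) x y' W' Sl' ∧ Disjoint W' Z ∧
      ∑ u ∈ (gapAcc G s Sl')ᶜ, w u ≤ (1 - (μ / 2) ^ 2) ^ M * ∑ u ∈ (gapAcc G s Sl)ᶜ, w u := by
  induction M generalizing N y p q W Sl with
  | zero => exact ⟨y, W, Sl, by simpa using h, hWZ, by simp⟩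
  | succ M ih =>
    have hp3 : (0 : ℝ) ≤ L := by positivity
    push_cast at hn
    have h7 : (0 : ℝ) ≤ M * (L * (2 * L + 5)) := by positivity
    obtain ⟨y₁, W₁, Sl₁, h1, ⟨p', q', h2⟩, h3, h4⟩ := h.round hG hA hA' hμ hμκ hL hL1 hpq hWZ w hw
      (by nlinarith)
    obtain ⟨y₂, W₂, Sl₂, h5, h6, h7⟩ := ih h1 h2 h3 (by push_cast; nlinarith)
    refine ⟨y₂, W₂, Sl₂, ?_, h6, h7.trans ?_⟩
    · convert h5 using 1; ring
    · rw [pow_succ (1 - (μ / 2) ^ 2), mul_assoc]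
      refine mul_le_mul_of_nonneg_left h4 (pow_nonneg ?_ _)
      have : (μ / 2) ^ 2 ≤ 1 := pow_le_one₀ (by positivity) (by linarith)
      linarith

/-- Long constant words are slottable. -/
theorem slottable_replicate (hG : Expander G κ μ)
    (hA : Expander (Aco (stepRel G s) μ) κ μ)
    (hA' : Expander (Aco (fun x y => stepRel G s y x) μ) κ μ) (hμ : 0 < μ) (hμ1 : μ ≤ 1)
    (hμκ : μ ≤ κ) (hL : 1 ≤ κ + μ * (L - 1)) (hL1 : 1 ≤ L) (M K : ℕ)
    (hK : L + 2 + M * (L * (2 * L + 2)) ≤ K) {δ : ℝ}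
    (hδ : (1 - (μ / 2) ^ 2) ^ M ≤ δ)
    (hn : (K : ℝ) + (M + 1) * (L * (2 * L + 5)) + 4 * L + 15 ≤ μ / 4 * Fintype.card V) :
    Slottable G δ (μ / 4) (List.replicate K s) := by
  intro x Z hZ w hw
  have hnn : (0 : ℝ) ≤ Fintype.card V := by positivity
  have hκn : μ * Fintype.card V ≤ κ * Fintype.card V := by gcongr
  have hp3 : (0 : ℝ) ≤ L := by positivity
  have hp4 : (0 : ℝ) ≤ Z.card := by positivity
  have hp5 : (0 : ℝ) ≤ K := by positivity
  have hp6 : (0 : ℝ) ≤ (M + 1) * (L * (2 * L + 5)) := by positivity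
  have huniv : μ * Fintype.card V ≤ (univ : Finset V).card := hκn.trans
    ((hA.outDeg_ge x).trans (cast_card_le_univ _ |>.trans (by simp)))
  obtain ⟨y₀, -, hy₀F⟩ := exists_mem_filter_notMem (F := Z) huniv (by linarith)
  obtain ⟨x₀, -, hx₀F⟩ := exists_mem_filter_notMem (F := insert y₀ Z) huniv (by
      have := card_insert_le_cast y₀ Z; linarith)
  obtain ⟨C, hxC, hCF, hC⟩ := exists_connecting_trail hG.stepRel hμ.le hL (List.replicate L s)
    (by simp) (by simp; omega) x x₀ (insert y₀ Z) (by
      have := card_insert_le_cast y₀ Z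
      rw [List.length_replicate]; linarith)
  simp only [Finset.mem_insert, not_or, Finset.disjoint_insert_right] at hx₀F hCF
  have hinit := GapTrail.init (y₀ := y₀) hC (by grind)
  obtain ⟨y₁, W₁, Sl₁, h1, h2, h3⟩ := hinit.rounds hG hA hA' hμ hμ1 hμκ hL hL1 M
    ⟨rfl, rfl⟩ (Z := Z) (by
      simp only [Finset.disjoint_insert_left]
      grind) w hw (by push_cast; linarith)
  have hW1c : (W₁.card : ℝ) = L + 1 + M * (L * (2 * L + 2)) := by exact_mod_cast h1.card_eq
  have hKr : (L : ℝ) + 2 + M * (L * (2 * L + 2)) ≤ K := by exact_mod_cast hK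
  obtain ⟨k, rfl⟩ := Nat.exists_eq_add_of_le hK
  obtain ⟨y₂, S, hS, hT⟩ := exists_free_trail (R := stepRel G) (κ := κ)
    (fun s x => (hG.stepRel s).outDeg_ge x) (List.replicate k s) y₁ (W₁ ∪ Z) (by
      have := card_union_le_cast W₁ Z
      rw [List.length_replicate]
      push_cast at hn
      have : (0 : ℝ) ≤ M * (L * (2 * L + 2)) := by positivity
      linarith)
  rw [Finset.disjoint_union_right] at hS
  refine ⟨y₂, W₁ ∪ S, gapAcc G s Sl₁, ?_, ?_, h3.trans ?_⟩
  · have := (h1.slotAbs (Acc := gapAcc G s Sl₁) fun u hu =>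
      (Finset.mem_filter.1 hu).2).append hT hS.1.symm
    rw [← List.replicate_add] at this
    convert this using 2; ring
  · rw [Finset.disjoint_union_left]; exact ⟨h2, hS.2⟩
  · refine mul_le_mul hδ (Finset.sum_le_sum_of_subset_of_nonneg (Finset.subset_univ _)
      fun u _ _ => hw u) (Finset.sum_nonneg fun u _ => hw u) (le_trans (pow_nonneg ?_ _) hδ)
    have : (μ / 2) ^ 2 ≤ 1 := pow_le_one₀ (by positivity) (by linarith)
    linarith

end GapWalk

/-- Concatenation of finitely many trails. -/
theorem Trail.chain {V σ : Type*} {R : σ → V → V → Prop} (w : ℕ → List σ) (v : ℕ → V)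
    (S : ℕ → Finset V) (k : ℕ) (h : ∀ i < k, Trail R (w i) (v i) (v (i + 1)) (S i))
    (hd : ∀ i < k, ∀ j < k, i ≠ j → Disjoint (S i) (S j)) :
    Trail R ((List.range k).flatMap w) (v 0) (v k) ((range k).biUnion S) := by
  induction k with
  | zero => exact .nil _
  | succ k ih =>
    have h1 := (ih (fun i hi => h i (by omega))
      (fun i hi j hj => hd i (by omega) j (by omega))).append (h k (by omega)) (by
        rw [Finset.disjoint_biUnion_left]
        intro i hi
        have := Finset.mem_range.1 hi
        exact hd i (by omega) k (by omega) (by omega))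
    rw [List.range_succ, List.flatMap_append, Finset.range_add_one, Finset.biUnion_insert,
      Finset.union_comm]
    simpa using h1

/-- Hall's theorem under a degree condition. -/
theorem exists_matching_of_degree {V : Type*} [Nonempty V] (s : ℕ) (acc : ℕ → V → Prop)
    (T : Finset V)
    (hT : T.card = s) (hu : ∀ u ∈ T, 3 * s ≤ 4 * ((range s).filter fun j => acc j u).card)
    (hj : ∀ j < s, s ≤ 4 * (T.filter fun u => acc j u).card) :
    ∃ u : ℕ → V, (∀ j < s, u j ∈ T ∧ acc j (u j)) ∧ ∀ i < s, ∀ j < s, u i = u j → i = j := by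
  have hall : ∀ J : Finset (Fin s), J.card ≤
      (J.biUnion fun j => T.filter fun u => acc j u).card := by
    intro J
    by_contra! hcon
    set N := J.biUnion fun j => T.filter fun u => acc j u with hN
    obtain ⟨j, hjJ⟩ : J.Nonempty := Finset.card_pos.1 (by omega)
    have h1 : (T.filter fun u => acc j u).card ≤ N.card :=
      Finset.card_le_card (Finset.subset_biUnion_of_mem (fun j : Fin s => T.filter fun u => acc j u)
        hjJ)
    have h2 := hj j j.2
    have h3 : J.card ≤ s := by simpa using Finset.card_le_univ J
    obtain ⟨u, huT, huN⟩ := Finset.exists_mem_notMem_of_card_lt_card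
      (show N.card < T.card by omega)
    have h4 := hu u huT
    have h5 : (J.image Fin.val).card = J.card :=
      Finset.card_image_of_injective _ Fin.val_injective
    have h6 : ((range s).filter fun j => acc j u).card + (J.image Fin.val).card ≤ s := by
      rw [← Finset.card_union_of_disjoint]
      · refine (Finset.card_le_card (t := range s) ?_).trans (by simp)
        intro i hi
        simp only [Finset.mem_union, Finset.mem_filter, Finset.mem_image] at hi
        rcases hi with hi | ⟨i, -, rfl⟩
        · exact hi.1
        · simp
      · rw [Finset.disjoint_left]
        intro i hi hi'
        obtain ⟨i, hiJ, rfl⟩ := Finset.mem_image.1 hi'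
        exact huN (Finset.mem_biUnion.2 ⟨i, hiJ, Finset.mem_filter.2
          ⟨huT, (Finset.mem_filter.1 hi).2⟩⟩)
    omega
  obtain ⟨f, hf, hfm⟩ := (Finset.all_card_le_biUnion_card_iff_exists_injective _).1 hall
  rcases Nat.eq_zero_or_pos s with rfl | hs
  · exact ⟨fun _ => Classical.arbitrary V, by simp, by simp⟩
  · refine ⟨fun j => if h : j < s then f ⟨j, h⟩ else f ⟨0, hs⟩, fun j hj => ?_,
      fun i hi j hj hij => ?_⟩
    · simpa [hj] using hfm ⟨j, hj⟩
    · simp only [hi, hj, dif_pos] at hij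
      simpa using hf hij

theorem sum_range_mul {M : Type*} [AddCommMonoid M] (f : ℕ → M) (p B : ℕ) :
    ∑ j ∈ range (p * B), f j = ∑ a ∈ range p, ∑ i ∈ range B, f (a * B + i) := by
  induction p with
  | zero => simp
  | succ p ih => rw [Nat.succ_mul, Finset.sum_range_add, ih, Finset.sum_range_succ]

set_option maxHeartbeats 1000000 in
/-- Given starting points `ξ a` and words which are concatenations of `B` slottable words each,
there are vertex sets which can be completed to trails along these words by absorbing an
arbitrary set of the right size containing a given set `T₀`. -/
theorem exists_absorbing_frames {V : Type*} [Fintype V] {G : V → V → Prop} {z : ℝ}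
    (p B : ℕ) (hB : 0 < B) (wd : ℕ → ℕ → List Bool)
    (hwd : ∀ a < p, ∀ i < B, Slottable G (1 / 2 ^ 9) z (wd a i)) (ξ : ℕ → V) (T₀ : Finset V)
    (hT₀ : p * B ≤ 3 * T₀.card) (hV : Fintype.card V ≤ 2 ^ (p * B))
    (hz : ((T₀.card + p + ∑ a ∈ range p, ((List.range B).flatMap (wd a)).length : ℕ) : ℝ) ≤
      z * Fintype.card V) :
    ∃ (Y : ℕ → V) (A : ℕ → Finset V),
      (∀ a < p, (A a).card + B = ((List.range B).flatMap (wd a)).length) ∧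
      (∀ a < p, Disjoint (A a) T₀ ∧ ∀ b < p, ξ b ∉ A a) ∧
      (∀ a < p, ∀ b < p, a ≠ b → Disjoint (A a) (A b)) ∧
      ∀ T, T₀ ⊆ T → T.card = p * B → (∀ a < p, Disjoint (A a) T) →
        ∃ τ : ℕ → Finset V, (∀ a < p, τ a ⊆ T) ∧ (∀ a < p, ∀ b < p, a ≠ b → Disjoint (τ a) (τ b)) ∧
          ∀ a < p, Trail (stepRel G) ((List.range B).flatMap (wd a)) (ξ a) (Y a) (A a ∪ τ a) := by
  have hlen : ∀ a k, ((List.range k).flatMap (wd a)).length =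
      ∑ i ∈ range k, (wd a i).length := by
    intro a k
    induction k with
    | zero => simp
    | succ k ih => rw [List.range_succ, List.flatMap_append, List.length_append, ih,
        Finset.sum_range_succ]; simp
  have hdiv : ∀ a, ∀ i < B, (a * B + i) / B = a ∧ (a * B + i) % B = i := fun a i hi => by
    rw [Nat.mul_comm, Nat.mul_add_div hB, Nat.mul_add_mod, Nat.div_eq_of_lt hi,
      Nat.mod_eq_of_lt hi]
    simp
  have hlt : ∀ a < p, ∀ i < B, a * B + i < p * B := fun a ha i hi => by
    calc a * B + i < a * B + B := by omega
      _ = (a + 1) * B := by ring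
      _ ≤ p * B := Nat.mul_le_mul_right _ ha
  have hinj : ∀ a i b j, i < B → j < B → a * B + i = b * B + j → a = b ∧ i = j := by
    intro a i b j hi hj h
    have h1 := hdiv a i hi
    have h2 := hdiv b j hj
    rw [h] at h1
    exact ⟨h1.1.symm.trans h2.1, h1.2.symm.trans h2.2⟩
  have : Nonempty V := ⟨ξ 0⟩
  obtain ⟨f, -, hok, hused, hdis, hacc⟩ := exists_sequence_passing (ι := V)
    (O := V × V × Finset V × Finset V) (fun o u => u ∈ o.2.2.2) (fun o => o.2.2.1)
    (fun j prev o => SlotAbs G (wd (j / B) (j % B)) o.1 o.2.1 o.2.2.1 o.2.2.2 ∧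
      o.1 = (if j % B = 0 then ξ (j / B) else prev.2.1) ∧
      p * B ≤ 4 * (T₀.filter fun u => u ∈ o.2.2.2).card)
    (T₀ ∪ (range p).image ξ) (fun j => (wd (j / B) (j % B)).length) (p * B) (ξ 0, ξ 0, ∅, ∅)
    (a := 1 - 1 / 2 ^ 8) (θ := 1 / 2 ^ 8) (by norm_num) (by norm_num) (by
      intro j hj prev Z hZ₀ hZc w hw
      have hjp : j / B < p := Nat.div_lt_of_lt_mul (by rwa [Nat.mul_comm])
      have hZn : (Z.card : ℝ) ≤ z * Fintype.card V := by
        refine le_trans ?_ hz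
        have h1 : ∑ i ∈ range j, (wd (i / B) (i % B)).length ≤
            ∑ i ∈ range (p * B), (wd (i / B) (i % B)).length :=
          Finset.sum_le_sum_of_subset (Finset.range_mono hj.le)
        have h2 : ∑ i ∈ range (p * B), (wd (i / B) (i % B)).length =
            ∑ a ∈ range p, ((List.range B).flatMap (wd a)).length := by
          rw [sum_range_mul]
          refine Finset.sum_congr rfl fun a _ => ?_
          rw [hlen]
          refine Finset.sum_congr rfl fun i hi => ?_
          obtain ⟨e1, e2⟩ := hdiv a i (Finset.mem_range.1 hi)
          rw [e1, e2]
        have h3 : (T₀ ∪ (range p).image ξ).card ≤ T₀.card + p :=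
          (Finset.card_union_le _ _).trans
            (Nat.add_le_add_left (Finset.card_image_le.trans (by simp)) _)
        exact_mod_cast show Z.card ≤ _ by omega
      have hWpos : 0 < ∑ i, w i := Finset.sum_pos (fun i _ => hw i) Finset.univ_nonempty
      have hT₀pos : (0 : ℝ) < T₀.card := by
        have : 0 < T₀.card := by omega
        exact_mod_cast this
      obtain ⟨y, W, Acc, h1, h2, h3⟩ := hwd _ hjp _ (Nat.mod_lt j hB)
        (if j % B = 0 then ξ (j / B) else prev.2.1) Z hZn
        (fun v => T₀.card * w v + if v ∈ T₀ then ∑ i, w i else 0) (fun v => by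
          have := (hw v).le
          split_ifs <;> positivity)
      refine ⟨(_, y, W, Acc), ⟨h1, rfl, ?_⟩, h2, by have := h1.card_eq; simp only; omega, ?_⟩
      all_goals
        rw [Finset.sum_add_distrib, Finset.sum_add_distrib, ← Finset.mul_sum, ← Finset.mul_sum,
          ← Finset.sum_filter, ← Finset.sum_filter, Finset.sum_const, Finset.sum_const,
          nsmul_eq_mul, nsmul_eq_mul, Finset.filter_mem_eq_inter, Finset.filter_univ_mem] at h3
        dsimp only
        have hrej : 0 ≤ ∑ u ∈ Accᶜ, w u := Finset.sum_nonneg fun u _ => (hw u).le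
      · have h4 : ((Accᶜ ∩ T₀).card : ℝ) * ∑ i, w i ≤ 1 / 2 ^ 8 * T₀.card * ∑ i, w i := by
          have := mul_nonneg hT₀pos.le hrej
          linarith
        have h5 := le_of_mul_le_mul_right h4 hWpos
        have h6 : T₀.card = (T₀.filter fun u => u ∈ Acc).card + (Accᶜ ∩ T₀).card := by
          rw [← Finset.card_filter_add_card_filter_not (s := T₀) (fun u => u ∈ Acc)]
          congr 2
          ext; simp [and_comm]
        have h7 : ((p * B : ℕ) : ℝ) ≤ 3 * T₀.card := by exact_mod_cast hT₀
        have h8 : (T₀.card : ℝ) = (T₀.filter fun u => u ∈ Acc).card + (Accᶜ ∩ T₀).card := by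
          exact_mod_cast h6
        have h9 : ((p * B : ℕ) : ℝ) ≤ 4 * (T₀.filter fun u => u ∈ Acc).card := by linarith
        exact_mod_cast h9
      · have h4 : (T₀.card : ℝ) * ∑ u ∈ Accᶜ, w u ≤ T₀.card * (1 / 2 ^ 8 * ∑ i, w i) := by
          have : (0 : ℝ) ≤ (Accᶜ ∩ T₀).card * ∑ i, w i := by positivity
          linarith
        have h5 := le_of_mul_le_mul_left h4 hT₀pos
        have h6 : ∑ u ∈ Accᶜ, w u + ∑ u with u ∈ Acc, w u = ∑ u, w u := by
          rw [← Finset.sum_compl_add_sum Acc]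
          simp
        have h7 : (1 - 1 / 2 ^ 8) * ∑ i, w i ≤ ∑ u with u ∈ Acc, w u := by linarith
        convert h7)
  have hacc' : ∀ u, 3 * (p * B) ≤
      4 * ((range (p * B)).filter fun j => u ∈ (f (j + 1)).2.2.2).card := by
    intro u
    by_contra! hcon
    have h1 : (1 / 2 ^ 8 : ℝ) ^ ((range (p * B)).filter fun j => u ∈ (f (j + 1)).2.2.2).card ≤
        Fintype.card V * (1 - (1 - 1 / 2 ^ 8) * (1 - 1 / 2 ^ 8)) ^ (p * B) := by
      convert hacc u
    have h2 : ((Fintype.card V : ℕ) : ℝ) ≤ 2 ^ (p * B) := by exact_mod_cast hV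
    have h3 : (Fintype.card V : ℝ) * (1 - (1 - 1 / 2 ^ 8) * (1 - 1 / 2 ^ 8)) ^ (p * B) ≤
        (1 / 2) ^ (6 * (p * B)) := by
      calc _ ≤ (2 : ℝ) ^ (p * B) * (1 / 2 ^ 7) ^ (p * B) := by
            refine mul_le_mul h2 (pow_le_pow_left₀ (by norm_num) (by norm_num) _) (by positivity)
              (by positivity)
        _ = (1 / 2) ^ (6 * (p * B)) := by
            rw [← mul_pow, pow_mul (1 / 2 : ℝ) 6]; norm_num
    have h4 := h1.trans h3
    rw [show (1 / 2 ^ 8 : ℝ) = (1 / 2) ^ 8 by norm_num, ← pow_mul,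
      pow_le_pow_iff_right_of_lt_one₀ (by norm_num) (by norm_num)] at h4
    omega
  refine ⟨fun a => (f (a * B + B)).2.1,
    fun a => (range B).biUnion fun i => (f (a * B + i + 1)).2.2.1, fun a ha => ?_, fun a ha => ?_,
    fun a ha b hb hab => ?_, fun T hT hTc hTA => ?_⟩
  · rw [Finset.card_biUnion, hlen]
    · calc _ = ∑ i ∈ range B, ((f (a * B + i + 1)).2.2.1.card + 1) := by
            rw [Finset.sum_add_distrib]; simp
        _ = _ := Finset.sum_congr rfl fun i hi => by
            have hi := Finset.mem_range.1 hi
            have := (hok _ (hlt a ha i hi)).1.card_eq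
            rwa [(hdiv a i hi).1, (hdiv a i hi).2] at this
    · intro i hi j hj hij
      have hi := Finset.mem_range.1 hi
      have hj := Finset.mem_range.1 hj
      exact hdis _ (hlt a ha i hi) _ (hlt a ha j hj) (by omega)
  · have h1 : ∀ i ∈ range B, Disjoint (f (a * B + i + 1)).2.2.1 (T₀ ∪ (range p).image ξ) :=
      fun i hi => (hused _ (hlt a ha i (Finset.mem_range.1 hi))).1
    rw [Finset.disjoint_biUnion_left]
    refine ⟨fun i hi => (Finset.disjoint_union_right.1 (h1 i hi)).1, fun b hb hmem => ?_⟩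
    obtain ⟨i, hi, hmem⟩ := Finset.mem_biUnion.1 hmem
    exact Finset.disjoint_left.1 (h1 i hi) hmem (Finset.mem_union_right _
      (Finset.mem_image_of_mem ξ (Finset.mem_range.2 hb)))
  · rw [Finset.disjoint_biUnion_left]
    intro i hi
    rw [Finset.disjoint_biUnion_right]
    intro j hj
    have hi := Finset.mem_range.1 hi
    have hj := Finset.mem_range.1 hj
    exact hdis _ (hlt a ha i hi) _ (hlt b hb j hj) fun h => hab (hinj a i b j hi hj h).1
  · obtain ⟨u, hu, huinj⟩ := exists_matching_of_degree (p * B)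
      (fun j v => v ∈ (f (j + 1)).2.2.2) T hTc
      (fun v _ => by convert hacc' v) (fun j hj =>
        (hok j hj).2.2.trans (Nat.mul_le_mul_left _ (Finset.card_le_card fun v hv => by
          simp only [Finset.mem_filter] at hv ⊢
          exact ⟨hT hv.1, hv.2⟩)))
    refine ⟨fun a => (range B).image fun i => u (a * B + i), fun a ha => ?_,
      fun a ha b hb hab => ?_, fun a ha => ?_⟩
    · rw [Finset.image_subset_iff]
      exact fun i hi => (hu _ (hlt a ha i (Finset.mem_range.1 hi))).1
    · rw [Finset.disjoint_left]
      intro v hv hv'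
      obtain ⟨i, hi, rfl⟩ := Finset.mem_image.1 hv
      obtain ⟨j, hj, hij⟩ := Finset.mem_image.1 hv'
      have hi := Finset.mem_range.1 hi
      have hj := Finset.mem_range.1 hj
      exact hab (hinj a i b j hi hj (huinj _ (hlt a ha i hi) _ (hlt b hb j hj) hij.symm)).1
    · have hW : ∀ i < B, ∀ j < B, u (a * B + j) ∉ (f (a * B + i + 1)).2.2.1 := by
        intro i hi j hj h
        exact Finset.disjoint_left.1 (hTA a ha) (Finset.mem_biUnion.2
          ⟨i, Finset.mem_range.2 hi, h⟩) (hu _ (hlt a ha j hj)).1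
      have := Trail.chain (R := stepRel G) (wd a)
        (fun i => if i = 0 then ξ a else (f (a * B + i)).2.1)
        (fun i => insert (u (a * B + i)) (f (a * B + i + 1)).2.2.1) B (fun i hi => by
          have h1 := hok _ (hlt a ha i hi)
          rw [(hdiv a i hi).1, (hdiv a i hi).2] at h1
          have h2 := h1.1.trail _ (hu _ (hlt a ha i hi)).2 (hW i hi i hi)
          rw [h1.2.1] at h2
          simpa [add_assoc] using h2) (fun i hi j hj hij => by
          rw [Finset.disjoint_insert_left, Finset.disjoint_insert_right, Finset.mem_insert, not_or]
          refine ⟨⟨fun h => hij (hinj a i a j hi hj (huinj _ (hlt a ha i hi) _ (hlt a ha j hj)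
            h)).2, hW j hj i hi⟩, hW i hi j hj,
            hdis _ (hlt a ha i hi) _ (hlt a ha j hj) (by omega)⟩)
      simp only [if_pos, if_neg hB.ne'] at this
      convert this using 1
      ext v
      simp only [Finset.mem_union, Finset.mem_biUnion, Finset.mem_image, Finset.mem_insert,
        ← exists_or, ← and_or_left]
      exact exists_congr fun i => and_congr_right fun _ => or_comm.trans (or_congr_left eq_comm)

/-- Choosing distinct representatives from large sets. -/
theorem exists_injOn_of_card_le {α : Type*} [Nonempty α] (q : ℕ) (t : ℕ → Finset α)
    (ht : ∀ b < q, q ≤ (t b).card) :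
    ∃ φ : ℕ → α, (∀ b < q, φ b ∈ t b) ∧ ∀ b < q, ∀ b' < q, φ b = φ b' → b = b' := by
  have hall : ∀ J : Finset (Fin q), J.card ≤ (J.biUnion fun b => t b).card := by
    intro J
    rcases J.eq_empty_or_nonempty with rfl | ⟨b, hb⟩
    · simp
    · have h1 : (t b).card ≤ (J.biUnion fun b => t b).card :=
        Finset.card_le_card (Finset.subset_biUnion_of_mem (fun b : Fin q => t b) hb)
      have h2 : J.card ≤ q := by simpa using Finset.card_le_univ J
      exact h2.trans ((ht b b.2).trans h1)
  obtain ⟨f, hf, hfm⟩ := (Finset.all_card_le_biUnion_card_iff_exists_injective _).1 hall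
  refine ⟨fun b => if h : b < q then f ⟨b, h⟩ else Classical.arbitrary α, fun b hb => ?_,
    fun b hb b' hb' h => ?_⟩
  · simpa [hb] using hfm ⟨b, hb⟩
  · simp only [hb, hb', dif_pos] at h
    simpa using hf h

set_option maxHeartbeats 1000000 in
/-- There is a family of disjoint small sets such that any `q` pairs of vertices can be connected,
along arbitrary words, through distinct members of the family. -/
theorem exists_connector_family {V : Type*} [Fintype V] [Nonempty V] {G : V → V → Prop}
    {κ μ : ℝ} {L C q : ℕ}
    (hG : Expander G κ μ) (hμ : 0 < μ) (hμκ : μ ≤ κ) (hκ1 : κ ≤ 1)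
    (hL : 1 ≤ κ + μ * (L - 1)) (hL1 : 1 ≤ L)
    (hC : (1 - 1 / 2 ^ L * (κ / 2) ^ 2 / 2) ^ C ≤ 1 / 4)
    (hq : Fintype.card V * Fintype.card V * 2 ^ (L + 2) ≤ 2 ^ q) (Z₀ : Finset V)
    (hn : (Z₀.card : ℝ) + C * q * (L + 1) + L + 5 ≤ μ / 2 * Fintype.card V) :
    ∃ D : ℕ → Finset V, (∀ j < C * q, Disjoint (D j) Z₀ ∧ (D j).card = L + 1) ∧
      (∀ i < C * q, ∀ j < C * q, i ≠ j → Disjoint (D i) (D j)) ∧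
      ∀ (x y : ℕ → V) (l : ℕ → List Bool), (∀ b < q, (l b).length = L + 2) →
        ∃ φ : ℕ → ℕ, (∀ b < q, φ b < C * q) ∧ (∀ b < q, ∀ b' < q, φ b = φ b' → b = b') ∧
          ∀ b < q, y b ∉ D (φ b) → Trail (stepRel G) (l b) (x b) (y b)
            (insert (y b) (D (φ b))) := by
  have hnn : (0 : ℝ) ≤ Fintype.card V := by positivity
  have hκ : 0 < κ := by linarith
  have hp3 : (0 : ℝ) ≤ L := by positivity
  have hκn : μ / 2 * Fintype.card V ≤ κ / 2 * Fintype.card V := by gcongr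
  have hμn : μ / 2 * Fintype.card V ≤ μ * Fintype.card V := by nlinarith
  have huniv : κ * Fintype.card V ≤ (univ : Finset V).card := by
    rw [Finset.card_univ]; nlinarith
  obtain ⟨f, -, hok, hused, hdis, hacc⟩ := exists_sequence_passing
    (ι := (V × V) × (Bool × Bool) × List.Vector Bool L)
    (O := (V × V) × List.Vector Bool L × Finset V)
    (fun o i => o.2.1 = i.2.2 ∧ stepRel G i.2.1.1 i.1.1 o.1.1 ∧ stepRel G i.2.1.2 o.1.2 i.1.2)
    (fun o => insert o.1.1 o.2.2)
    (fun _ _ o => o.1.1 ∉ o.2.2 ∧ Trail (stepRel G) o.2.1.toList o.1.1 o.1.2 o.2.2)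
    Z₀ (fun _ => L + 1) (C * q)
    ((Classical.arbitrary V, Classical.arbitrary V), List.Vector.replicate L true, ∅)
    (a := 1 / 2 ^ L * (κ / 2) ^ 2) (θ := 1 / 2) (by norm_num) (by norm_num) (by
      intro j hj prev Z hZ₀ hZc w hw
      rw [Finset.sum_const, Finset.card_range, smul_eq_mul] at hZc
      have hZn : (Z.card : ℝ) + L + 5 ≤ μ / 2 * Fintype.card V := by
        refine le_trans ?_ hn
        have h1 : Z.card ≤ Z₀.card + C * q * (L + 1) :=
          hZc.trans (Nat.add_le_add_left (Nat.mul_le_mul_right _ hj.le) _)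
        have h2 : (Z.card : ℝ) ≤ Z₀.card + C * q * (L + 1) := by exact_mod_cast h1
        linarith
      obtain ⟨v, -, hv⟩ := exists_weighted_average
        (univ : Finset ((V × V) × (Bool × Bool) × List.Vector Bool L))
        (univ : Finset (List.Vector Bool L)) Finset.univ_nonempty (fun i v => v = i.2.2) w
        (fun i _ => (hw i).le) (N := 2 ^ L) (ρ := 1 / 2 ^ L) (by positivity)
        (by rw [Finset.card_univ, card_vector]; simp) (fun i _ => by
          have h1 : 1 ≤ (univ.filter fun v : List.Vector Bool L => v = i.2.2).card :=
            Finset.card_pos.2 ⟨i.2.2, by simp⟩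
          rw [one_div, inv_mul_cancel₀ (by positivity)]
          convert (by exact_mod_cast h1 : (1 : ℝ) ≤
            (univ.filter fun v : List.Vector Bool L => v = i.2.2).card))
      obtain ⟨a, -, haZ, ha⟩ := exists_average_notMem (univ.filter fun i => v = i.2.2) univ Z
        (fun (i : (V × V) × (Bool × Bool) × List.Vector Bool L) a => stepRel G i.2.1.1 i.1.1 a) w
        (fun i => (hw i).le) hκ.le huniv (fun i _ => (hG.stepRel _).outDeg_ge _) (by linarith)
      have hc1 := card_insert_le_cast a Z
      obtain ⟨b, -, hbZ, hb⟩ := exists_average_notMem ((univ.filter fun i => v = i.2.2).filter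
          fun (i : (V × V) × (Bool × Bool) × List.Vector Bool L) => stepRel G i.2.1.1 i.1.1 a)
        univ (insert a Z)
        (fun (i : (V × V) × (Bool × Bool) × List.Vector Bool L) b => stepRel G i.2.1.2 b i.1.2) w
        (fun i => (hw i).le) hκ.le huniv (fun i _ => (hG.stepRel _).inDeg_ge _) (by linarith)
      obtain ⟨S, hbS, hSZ, hS⟩ := exists_connecting_trail hG.stepRel hμ.le hL v.toList (by simp)
        (by rw [← List.length_pos_iff]; simp; omega) a b (insert a Z) (by
          rw [List.Vector.toList_length]; linarith)
      rw [Finset.mem_insert, not_or] at hbZ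
      rw [Finset.disjoint_insert_right] at hSZ
      refine ⟨((a, b), v, insert b S), ⟨by simp only [Finset.mem_insert]; grind, hS⟩, ?_, ?_, ?_⟩
      · simp only [Finset.disjoint_insert_left]; grind
      · refine (Finset.card_insert_le _ _).trans ?_
        simp only [hS.card_eq, List.Vector.toList_length]
        exact le_rfl
      · have e1 := mul_le_mul_of_nonneg_left hv (show 0 ≤ (κ / 2) ^ 2 by positivity)
        have e2 := mul_le_mul_of_nonneg_left ha (show 0 ≤ κ / 2 by positivity)
        have e3 : 1 / 2 ^ L * (κ / 2) ^ 2 * ∑ i, w i ≤ ∑ i ∈ ((univ.filter fun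
            i : (V × V) × (Bool × Bool) × List.Vector Bool L => v = i.2.2).filter
            fun i => stepRel G i.2.1.1 i.1.1 a).filter fun i => stepRel G i.2.1.2 b i.1.2, w i := by
          refine le_trans ?_ hb
          refine le_trans ?_ e2
          refine le_trans (le_of_eq (by ring)) (e1.trans (le_of_eq ?_))
          rw [pow_two, mul_assoc]
          congr!
        refine le_trans (le_of_eq (by ring)) (e3.trans (le_of_eq ?_))
        refine Finset.sum_congr ?_ fun _ _ => rfl
        ext i
        simp only [Finset.mem_filter, Finset.mem_univ, true_and, and_assoc])
  refine ⟨fun j => insert (f (j + 1)).1.1 (f (j + 1)).2.2, fun j hj => ⟨(hused j hj).1, ?_⟩, hdis,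
    fun x y l hl => ?_⟩
  · rw [Finset.card_insert_of_notMem (hok j hj).1, (hok j hj).2.card_eq, List.Vector.toList_length]
  · have hdec : ∀ b < q, ∃ i : (Bool × Bool) × List.Vector Bool L,
        l b = i.1.1 :: (i.2.toList ++ [i.1.2]) := by
      intro b hb
      have h1 := hl b hb
      rcases hlb : l b with _ | ⟨s₁, t⟩
      · rw [hlb] at h1; simp at h1
      · rw [hlb] at h1
        simp only [List.length_cons, Nat.add_right_cancel_iff] at h1
        obtain ⟨t', s₂, rfl⟩ : ∃ t' s₂, t = t' ++ [s₂] :=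
          ⟨_, _, (List.dropLast_append_getLast (by rintro rfl; simp at h1)).symm⟩
        exact ⟨((s₁, s₂), ⟨t', by simpa using h1⟩), rfl⟩
    choose! i hi using hdec
    obtain ⟨φ, hφ, hφi⟩ := exists_injOn_of_card_le q (fun b => (range (C * q)).filter fun j =>
      (f (j + 1)).2.1 = (i b).2 ∧ stepRel G (i b).1.1 (x b) (f (j + 1)).1.1 ∧
        stepRel G (i b).1.2 (f (j + 1)).1.2 (y b)) (fun b hb => by
      have h1 : (1 / 2 : ℝ) ^ ((range (C * q)).filter fun j => (f (j + 1)).2.1 = (i b).2 ∧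
          stepRel G (i b).1.1 (x b) (f (j + 1)).1.1 ∧
          stepRel G (i b).1.2 (f (j + 1)).1.2 (y b)).card ≤ (1 / 2) ^ q := by
        refine le_trans (le_of_eq ?_) ((hacc ((x b, y b), i b)).trans ?_)
        · congr!
        · have h2 : (1 - 1 / 2 ^ L * (κ / 2) ^ 2 * (1 - 1 / 2) : ℝ) ^ (C * q) ≤ (1 / 4) ^ q := by
            rw [pow_mul]
            refine pow_le_pow_left₀ (pow_nonneg ?_ _) (le_trans (le_of_eq ?_) hC) _
            · have : (1 / 2 ^ L : ℝ) ≤ 1 := by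
                rw [div_le_one (by positivity)]; exact one_le_pow₀ (by norm_num)
              have : (κ / 2) ^ 2 ≤ 1 := pow_le_one₀ (by positivity) (by linarith)
              have : (1 / 2 ^ L : ℝ) * (κ / 2) ^ 2 ≤ 1 := mul_le_one₀ (by assumption)
                (by positivity) (by assumption)
              linarith
            · congr 2; ring
          have h3 : (Fintype.card ((V × V) × (Bool × Bool) × List.Vector Bool L) : ℝ) ≤ 2 ^ q := by
            have : Fintype.card ((V × V) × (Bool × Bool) × List.Vector Bool L) ≤ 2 ^ q := by
              refine le_trans (le_of_eq ?_) hq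
              simp only [Fintype.card_prod, Fintype.card_bool, card_vector]
              ring
            exact_mod_cast this
          refine (mul_le_mul h3 h2 (by
            refine pow_nonneg ?_ _
            have : (1 / 2 ^ L : ℝ) ≤ 1 := by
              rw [div_le_one (by positivity)]; exact one_le_pow₀ (by norm_num)
            have : (κ / 2) ^ 2 ≤ 1 := pow_le_one₀ (by positivity) (by linarith)
            have : (1 / 2 ^ L : ℝ) * (κ / 2) ^ 2 ≤ 1 := mul_le_one₀ (by assumption)
              (by positivity) (by assumption)
            linarith) (by positivity)).trans ?_
          rw [← mul_pow]; norm_num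
      exact (pow_le_pow_iff_right_of_lt_one₀ (by norm_num) (by norm_num)).1 h1)
    refine ⟨φ, fun b hb => Finset.mem_range.1 (Finset.mem_filter.1 (hφ b hb)).1, hφi,
      fun b hb hy => ?_⟩
    obtain ⟨-, h1, h2, h3⟩ := Finset.mem_filter.1 (hφ b hb)
    rw [Finset.mem_insert, not_or] at hy
    have hj := Finset.mem_range.1 (Finset.mem_filter.1 (hφ b hb)).1
    have h4 := (hok _ hj).2
    rw [h1] at h4
    have h5 := Trail.cons (R := stepRel G) h2 (h4.append (Trail.single h3)
      (Finset.disjoint_singleton_right.2 hy.2)) (by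
        simp only [Finset.mem_union, Finset.mem_singleton, not_or]
        exact ⟨(hok _ hj).1, fun h => hy.1 h.symm⟩)
    rw [hi b hb]
    convert h5 using 1
    ext; simp; tauto

/-- Inside a set with small complement, an expander contains many disjoint one-regular digraphs. -/
theorem Expander.exists_perms {V : Type*} [Fintype V] {G : V → V → Prop} {κ μ : ℝ}
    (h : Expander G κ μ)
    (hdeg : ∀ x, (κ + μ) * Fintype.card V ≤ (univ.filter fun z => G x z).card) (U : Finset V)
    (r : ℕ) (hr : (Uᶜ.card : ℝ) + r ≤ μ * Fintype.card V) :
    ∃ σ : ℕ → Equiv.Perm U, (∀ i < r, ∀ x : U, G x (σ i x)) ∧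
      ∀ i < r, ∀ j < r, ∀ x, σ i x = σ j x → i = j := by
  induction r with
  | zero => exact ⟨fun _ => 1, by simp, by simp⟩
  | succ k ih =>
    push_cast at hr
    obtain ⟨σ, hσ, hσi⟩ := ih (by linarith)
    have hUn : (U.card : ℝ) + Uᶜ.card = Fintype.card V := by
      exact_mod_cast Finset.card_add_card_compl U
    have hall : ∀ X : Finset U, X.card ≤
        (X.biUnion fun x => univ.filter fun z : U => G x z ∧ ∀ i < k, σ i x ≠ z).card := by
      intro X
      set N := X.biUnion fun x => univ.filter fun z : U => G x z ∧ ∀ i < k, σ i x ≠ z with hN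
      have hmap : (N.map (Function.Embedding.subtype _)).card = N.card := Finset.card_map _
      have hXm : (X.map (Function.Embedding.subtype _)).card = X.card := Finset.card_map _
      have hXU : (X.card : ℝ) ≤ U.card := by
        have := Finset.card_le_univ X
        rw [Fintype.card_coe] at this
        exact_mod_cast this
      by_cases hX : κ * Fintype.card V ≤ X.card
      · have h1 := h.succ_ge (X.map (Function.Embedding.subtype _)) (by rwa [hXm])
        rw [hXm] at h1
        set Y := univ.filter fun x : V => μ * Fintype.card V ≤
          ((X.map (Function.Embedding.subtype _)).filter fun z => G z x).card with hY
        have h2 : Y ⊆ N.map (Function.Embedding.subtype _) ∪ Uᶜ := by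
          intro z hz
          by_cases hzU : z ∈ U
          · refine Finset.mem_union_left _ (Finset.mem_map.2 ⟨⟨z, hzU⟩, ?_, rfl⟩)
            have h3 := (Finset.mem_filter.1 hz).2
            have h4 : ((range k).image fun i => ((σ i).symm ⟨z, hzU⟩ : V)).card <
                ((X.map (Function.Embedding.subtype _)).filter fun y => G y z).card := by
              have h5 : ((range k).image fun i => ((σ i).symm ⟨z, hzU⟩ : V)).card ≤ k :=
                Finset.card_image_le.trans (by simp)
              have h6 : (k : ℝ) + 1 ≤
                  ((X.map (Function.Embedding.subtype _)).filter fun y => G y z).card := by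
                have : (0 : ℝ) ≤ Uᶜ.card := by positivity
                linarith
              have h7 : k + 1 ≤
                  ((X.map (Function.Embedding.subtype _)).filter fun y => G y z).card := by
                exact_mod_cast h6
              omega
            obtain ⟨x, hx, hxn⟩ := Finset.exists_mem_notMem_of_card_lt_card h4
            obtain ⟨hx, hxz⟩ := Finset.mem_filter.1 hx
            obtain ⟨x, hxX, rfl⟩ := Finset.mem_map.1 hx
            refine Finset.mem_biUnion.2 ⟨x, hxX, Finset.mem_filter.2 ⟨Finset.mem_univ _, hxz,
              fun i hi hix => hxn (Finset.mem_image.2 ⟨i, Finset.mem_range.2 hi, ?_⟩)⟩⟩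
            rw [← hix]; simp
          · exact Finset.mem_union_right _ (by simpa using hzU)
        have h3 : (Y.card : ℝ) ≤ N.card + Uᶜ.card := by
          have := (Finset.card_le_card h2).trans (Finset.card_union_le _ _)
          rw [hmap] at this
          exact_mod_cast this
        have h4 : (X.card : ℝ) ≤ N.card := by
          rcases min_le_iff.1 h1 with h5 | h5
          · linarith
          · linarith [Nat.cast_nonneg (α := ℝ) k]
        exact_mod_cast h4
      · push Not at hX
        rcases X.eq_empty_or_nonempty with rfl | ⟨x, hx⟩
        · simp
        · have h2 : (univ.filter fun z => G x z) ⊆ (N.map (Function.Embedding.subtype _) ∪ Uᶜ) ∪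
              (range k).image fun i => (σ i x : V) := by
            intro z hz
            have hz := (Finset.mem_filter.1 hz).2
            simp only [Finset.mem_union]
            by_cases hzU : z ∈ U
            · by_cases hzk : ∃ i < k, (σ i x : V) = z
              · obtain ⟨i, hi, hiz⟩ := hzk
                exact Or.inr (Finset.mem_image.2 ⟨i, Finset.mem_range.2 hi, hiz⟩)
              · push Not at hzk
                refine Or.inl (Or.inl (Finset.mem_map.2 ⟨⟨z, hzU⟩, Finset.mem_biUnion.2
                  ⟨x, hx, Finset.mem_filter.2 ⟨Finset.mem_univ _, hz, fun i hi hix => ?_⟩⟩, rfl⟩))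
                exact hzk i hi (by rw [hix])
            · exact Or.inl (Or.inr (by simpa using hzU))
          have h3 : ((univ.filter fun z => G x z).card : ℝ) ≤ N.card + Uᶜ.card + k := by
            have h5 : ((range k).image fun i => (σ i x : V)).card ≤ k :=
              Finset.card_image_le.trans (by simp)
            have := (Finset.card_le_card h2).trans ((Finset.card_union_le _ _).trans
              (Nat.add_le_add (Finset.card_union_le _ _) h5))
            rw [hmap] at this
            exact_mod_cast this
          have h4 := hdeg x
          have h5 : (X.card : ℝ) ≤ N.card := by linarith
          exact_mod_cast h5
    obtain ⟨f, hf, hfm⟩ := (Finset.all_card_le_biUnion_card_iff_exists_injective _).1 hall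
    have hfb : Function.Bijective f := Finite.injective_iff_bijective.1 hf
    have hfm' : ∀ x : U, G x (f x) ∧ ∀ i < k, σ i x ≠ f x := fun x =>
      (Finset.mem_filter.1 (hfm x)).2
    refine ⟨fun i => if i < k then σ i else Equiv.ofBijective f hfb, fun i hi x => ?_,
      fun i hi j hj x hij => ?_⟩
    · by_cases hik : i < k
      · simpa [hik] using hσ i hik x
      · simpa [hik] using (hfm' x).1
    · by_cases hik : i < k <;> by_cases hjk : j < k <;> simp only [hik, hjk, if_true, if_false,
        Equiv.ofBijective_apply] at hij
      · exact hσi i hik j hjk x hij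
      · exact absurd hij ((hfm' x).2 i hik)
      · exact absurd hij.symm ((hfm' x).2 j hjk)
      · omega

/-- A colouring under which each of the given tuples is balanced on average. -/
theorem exists_balanced_coloring {A W C : Type*} [Fintype A] [Fintype W] [Fintype C] [Nonempty C]
    (r : ℕ) (t : A → Fin r → W) (ht : ∀ a, Function.Injective (t a)) :
    ∃ f : W → C, ∑ a, ∑ c, (((univ.filter fun i => f (t a i) = c).card : ℝ) -
      r / Fintype.card C) ^ 2 ≤ Fintype.card A * r := by
  set Q : ℝ := (Fintype.card C : ℝ) with hQ
  have hQ0 : 0 < Q := by rw [hQ]; exact_mod_cast Fintype.card_pos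
  have hF0 : (0 : ℝ) < Fintype.card (W → C) := by exact_mod_cast Fintype.card_pos
  have hpair : ∀ x y : W, x ≠ y → ((univ.filter fun f : W → C => f x = f y).card : ℝ) ≤
      Fintype.card (W → C) / Q := by
    intro x y hxy
    rw [le_div_iff₀ hQ0, hQ, ← Finset.card_univ (α := C), ← Nat.cast_mul, ← Finset.card_product,
      ← Finset.card_univ (α := W → C)]
    refine Nat.cast_le.2 (Finset.card_le_card_of_injOn (fun p => Function.update p.1 x p.2)
      (fun _ _ => Finset.mem_coe.2 (Finset.mem_univ _)) ?_)
    rintro ⟨f, c⟩ hf ⟨g, d⟩ hg hfg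
    simp only [Finset.coe_product, Set.mem_prod, Finset.mem_coe, Finset.mem_filter,
      Finset.mem_univ, true_and, and_true] at hf hg
    have h1 : ∀ z, z ≠ x → f z = g z := fun z hz => by
      simpa [hz] using congrFun hfg z
    have h2 : c = d := by simpa using congrFun hfg x
    refine Prod.ext (funext fun z => ?_) h2
    by_cases hz : z = x
    · subst hz
      simp only
      rw [hf, hg, h1 y hxy.symm]
    · exact h1 z hz
  have hconf : ∀ (f : W → C) (a : A),
      ∑ c, (((univ.filter fun i => f (t a i) = c).card : ℝ) - r / Q) ^ 2 =
      (∑ i, ∑ j, if f (t a i) = f (t a j) then (1 : ℝ) else 0) - r ^ 2 / Q := by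
    intro f a
    have h1 : ∑ c, ((univ.filter fun i => f (t a i) = c).card : ℝ) = r := by
      have h := Finset.card_eq_sum_card_fiberwise (s := univ) (t := univ)
        (f := fun i => f (t a i)) (fun _ _ => Finset.mem_coe.2 (Finset.mem_univ _))
      rw [Finset.card_univ, Fintype.card_fin] at h
      exact_mod_cast h.symm
    have h2 : ∑ c, ((univ.filter fun i => f (t a i) = c).card : ℝ) ^ 2 =
        ∑ i, ∑ j, if f (t a i) = f (t a j) then (1 : ℝ) else 0 := by
      have h3 : ∀ c, ((univ.filter fun i => f (t a i) = c).card : ℝ) ^ 2 =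
          ∑ i, ∑ j, if f (t a i) = c then if f (t a j) = c then (1 : ℝ) else 0 else 0 := by
        intro c
        rw [Finset.card_filter, Nat.cast_sum, pow_two, Finset.sum_mul_sum]
        refine Finset.sum_congr rfl fun i _ => Finset.sum_congr rfl fun j _ => ?_
        split_ifs <;> simp
      rw [Finset.sum_congr rfl fun c _ => h3 c, Finset.sum_comm]
      refine Finset.sum_congr rfl fun i _ => ?_
      rw [Finset.sum_comm]
      refine Finset.sum_congr rfl fun j _ => ?_
      rw [Finset.sum_ite_eq]
      simp only [Finset.mem_univ, if_true]
      congr 1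
      exact propext eq_comm
    have h4 : ∀ c, (((univ.filter fun i => f (t a i) = c).card : ℝ) - r / Q) ^ 2 =
        ((univ.filter fun i => f (t a i) = c).card : ℝ) ^ 2 -
          2 * (r / Q) * ((univ.filter fun i => f (t a i) = c).card : ℝ) + (r / Q) ^ 2 :=
      fun c => by ring
    rw [Finset.sum_congr rfl fun c _ => h4 c, Finset.sum_add_distrib, Finset.sum_sub_distrib,
      ← Finset.mul_sum, h1, h2, Finset.sum_const, Finset.card_univ, nsmul_eq_mul, ← hQ]
    field_simp
    ring
  have htot : ∑ f : W → C, ∑ a, ∑ i, ∑ j, (if f (t a i) = f (t a j) then (1 : ℝ) else 0) ≤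
      ∑ _f : W → C, Fintype.card A * (r + r ^ 2 / Q) := by
    rw [Finset.sum_comm]
    rw [Finset.sum_const, Finset.card_univ, nsmul_eq_mul, mul_left_comm, ← nsmul_eq_mul,
      ← Finset.card_univ (α := A)]
    refine Finset.sum_le_card_nsmul _ _ _ fun a _ => ?_
    rw [Finset.sum_comm]
    have h1 : ∀ i, ∑ f : W → C, ∑ j, (if f (t a i) = f (t a j) then (1 : ℝ) else 0) ≤
        Fintype.card (W → C) * (1 + r / Q) := by
      intro i
      rw [Finset.sum_comm, ← Finset.sum_erase_add _ _ (Finset.mem_univ i)]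
      have h2 : ∑ j ∈ univ.erase i, ∑ f : W → C, (if f (t a i) = f (t a j) then (1 : ℝ) else 0) ≤
          (univ.erase i).card • (Fintype.card (W → C) / Q) := by
        refine Finset.sum_le_card_nsmul _ _ _ fun j hj => ?_
        rw [← Finset.sum_filter, Finset.sum_const, nsmul_one]
        exact hpair _ _ fun h => (Finset.mem_erase.1 hj).1 (ht a h.symm)
      have h3 : ((univ.erase i).card : ℝ) ≤ r := by
        exact_mod_cast (Finset.card_le_univ _).trans (by simp)
      have h4 : ((univ.erase i).card : ℝ) * (Fintype.card (W → C) / Q) ≤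
          r * (Fintype.card (W → C) / Q) := by gcongr
      rw [nsmul_eq_mul] at h2
      simp only [if_true, Finset.sum_const, Finset.card_univ, nsmul_one]
      calc _ ≤ (r : ℝ) * (Fintype.card (W → C) / Q) + Fintype.card (W → C) := by linarith
        _ = _ := by ring
    refine (Finset.sum_le_card_nsmul _ _ _ fun i _ => h1 i).trans (le_of_eq ?_)
    rw [Finset.card_univ, Fintype.card_fin, nsmul_eq_mul]
    ring
  obtain ⟨f, -, hf⟩ := Finset.exists_le_of_sum_le Finset.univ_nonempty htot
  refine ⟨f, ?_⟩
  rw [Finset.sum_congr rfl fun a _ => hconf f a, Finset.sum_sub_distrib, Finset.sum_const,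
    Finset.card_univ, nsmul_eq_mul]
  linarith

set_option maxHeartbeats 1000000 in
/-- A colouring for which passing from any colour class to any other one almost preserves sizes,
in both directions of a digraph which is a union of many disjoint permutations. -/
theorem exists_expanding_coloring {W C : Type*} [Fintype W] [Fintype C] [Nonempty C] {r : ℕ}
    (hr : 0 < r) (R : Bool → W → W → Prop) (σ : Fin r → Equiv.Perm W)
    (hσ : ∀ x, Function.Injective fun i => σ i x) (hR : ∀ i x, R true x (σ i x))
    (hR' : ∀ i x, R false (σ i x) x) {d : ℝ} (hd0 : 0 ≤ d)
    (hd : 16 * (Fintype.card W : ℝ) ^ 2 * Fintype.card C ^ 3 ≤ d ^ 2 * r) :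
    ∃ f : W → C,
      (∀ c, (Fintype.card W : ℝ) / Fintype.card C - d ≤ (univ.filter fun x => f x = c).card) ∧
      ∀ s c c' (S : Finset W), (∀ x ∈ S, f x = c) →
        (S.card : ℝ) ≤ (univ.filter fun z => f z = c' ∧ ∃ x ∈ S, R s x z).card + d := by
  set t : Bool × W → Fin r → W := fun a i => if a.1 then σ i a.2 else (σ i).symm a.2 with htdef
  have htt : ∀ s x i, t (!s, t (s, x) i) i = x := by
    intro s x i
    cases s <;> simp [htdef]
  have htR : ∀ s x i, R s x (t (s, x) i) := by
    intro s x i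
    cases s
    · simpa [htdef] using hR' i ((σ i).symm x)
    · simpa [htdef] using hR i x
  have ht : ∀ a, Function.Injective (t a) := by
    rintro ⟨s, x⟩ i j hij
    cases s
    · have h1 : (σ i).symm x = (σ j).symm x := by simpa [htdef] using hij
      refine hσ ((σ i).symm x) ?_
      simp only
      rw [Equiv.apply_symm_apply, h1, Equiv.apply_symm_apply]
    · exact hσ x (by simpa [htdef] using hij)
  obtain ⟨f, hf⟩ := exists_balanced_coloring (C := C) r t ht
  set Q : ℝ := (Fintype.card C : ℝ) with hQ
  have hQ0 : 0 < Q := by rw [hQ]; exact_mod_cast Fintype.card_pos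
  have hr0 : (0 : ℝ) < r := by exact_mod_cast hr
  set g : (Bool × W) × C → ℝ := fun p =>
    |((univ.filter fun i => f (t p.1 i) = p.2).card : ℝ) - r / Q| with hg
  set E : ℝ := ∑ p, g p with hE
  have hE0 : 0 ≤ E := Finset.sum_nonneg fun p _ => abs_nonneg _
  have hEd : 2 * E ≤ d * (r / Q) := by
    have h1 : E ^ 2 ≤ (2 * Fintype.card W * Q) * (2 * Fintype.card W * r) := by
      refine (sq_sum_le_card_mul_sum_sq).trans ?_
      have h2 : ((univ : Finset ((Bool × W) × C)).card : ℝ) = 2 * Fintype.card W * Q := by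
        rw [Finset.card_univ]
        simp [hQ]
      rw [h2]
      refine mul_le_mul_of_nonneg_left ?_ (by positivity)
      rw [Fintype.sum_prod_type]
      refine (le_of_eq (Finset.sum_congr rfl fun a _ => Finset.sum_congr rfl fun c _ =>
        sq_abs _)).trans (hf.trans (le_of_eq ?_))
      simp
    refine abs_le_of_sq_le_sq' ?_ (by positivity) |>.2
    rw [mul_pow, mul_pow d, div_pow, mul_div_assoc', le_div_iff₀ (by positivity)]
    calc 2 ^ 2 * E ^ 2 * Q ^ 2 ≤
          2 ^ 2 * ((2 * Fintype.card W * Q) * (2 * Fintype.card W * r)) * Q ^ 2 := by gcongr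
      _ = (16 * (Fintype.card W : ℝ) ^ 2 * Q ^ 3) * r := by ring
      _ ≤ d ^ 2 * r * r := by gcongr
      _ = _ := by ring
  have hgE : ∀ s c (S : Finset W), ∑ x ∈ S, g ((s, x), c) ≤ E := by
    intro s c S
    have h1 := Finset.sum_map S ⟨fun x => ((s, x), c), fun x y h => by simpa using h⟩ g
    refine h1.symm.le.trans ?_
    exact Finset.sum_le_univ_sum_of_nonneg fun p => abs_nonneg _
  have hlow : ∀ s c (S : Finset W), (S.card : ℝ) * (r / Q) - E ≤
      ∑ x ∈ S, ((univ.filter fun i => f (t (s, x) i) = c).card : ℝ) := by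
    intro s c S
    have h1 := hgE s c S
    have h2 : ∑ x ∈ S, (r / Q - g ((s, x), c)) ≤
        ∑ x ∈ S, ((univ.filter fun i => f (t (s, x) i) = c).card : ℝ) :=
      Finset.sum_le_sum fun x _ => by
        have := neg_abs_le (((univ.filter fun i => f (t (s, x) i) = c).card : ℝ) - r / Q)
        simp only [hg]
        linarith
    rw [Finset.sum_sub_distrib, Finset.sum_const, nsmul_eq_mul] at h2
    linarith
  have hupp : ∀ s c (S : Finset W), 
      ∑ x ∈ S, ((univ.filter fun i => f (t (s, x) i) = c).card : ℝ) ≤ S.card * (r / Q) + E := by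
    intro s c S
    have h1 := hgE s c S
    have h2 : ∑ x ∈ S, ((univ.filter fun i => f (t (s, x) i) = c).card : ℝ) ≤ 
        ∑ x ∈ S, (r / Q + g ((s, x), c)) :=
      Finset.sum_le_sum fun x _ => by
        have := le_abs_self (((univ.filter fun i => f (t (s, x) i) = c).card : ℝ) - r / Q)
        simp only [hg]
        linarith
    rw [Finset.sum_add_distrib, Finset.sum_const, nsmul_eq_mul] at h2
    linarith
  have hrQ : 0 < r / Q := by positivity
  refine ⟨f, fun c => ?_, fun s c c' S hS => ?_⟩
  · have h1 := hlow true c univ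
    have h2 : ∑ x, ((univ.filter fun i => f (t (true, x) i) = c).card : ℝ) =
        r * (univ.filter fun x => f x = c).card := by
      have h3 : ∀ x, ((univ.filter fun i => f (t (true, x) i) = c).card : ℝ) =
          ∑ i, if f (σ i x) = c then (1 : ℝ) else 0 := by
        intro x
        simp [htdef]
      rw [Finset.sum_congr rfl fun x _ => h3 x, Finset.sum_comm]
      have h4 : ∀ i, ∑ x, (if f (σ i x) = c then (1 : ℝ) else 0) =
          (univ.filter fun x => f x = c).card := by
        intro i
        rw [Equiv.sum_comp (σ i) fun x => if f x = c then (1 : ℝ) else 0]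
        simp
      rw [Finset.sum_congr rfl fun i _ => h4 i]
      simp
    rw [h2, Finset.card_univ] at h1
    refine le_of_mul_le_mul_left ?_ hr0
    calc (r : ℝ) * (Fintype.card W / Q - d) = Fintype.card W * (r / Q) - d * r := by ring
      _ ≤ Fintype.card W * (r / Q) - d * (r / Q) := by
        have h5 : (1 : ℝ) ≤ Q := by rw [hQ]; exact_mod_cast Fintype.card_pos
        have : r / Q ≤ r := div_le_self hr0.le h5
        have := mul_le_mul_of_nonneg_left this hd0
        linarith
      _ ≤ _ := by linarith
  · set N := univ.filter fun z => f z = c' ∧ ∃ x ∈ S, R s x z with hN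
    have h1 := hlow s c' S
    have h2 := hupp (!s) c N
    have h3 : ∑ x ∈ S, (univ.filter fun i => f (t (s, x) i) = c').card ≤
        ∑ z ∈ N, (univ.filter fun i => f (t (!s, z) i) = c).card := by
      rw [← Finset.card_sigma, ← Finset.card_sigma]
      refine Finset.card_le_card_of_injOn (fun p => ⟨t (s, p.1) p.2, p.2⟩) ?_ ?_
      · rintro ⟨x, i⟩ hx
        simp only [Finset.coe_sigma, Set.mem_sigma_iff, Finset.mem_coe, Finset.mem_filter,
          Finset.mem_univ, true_and, hN] at hx ⊢
        exact ⟨⟨hx.2, x, hx.1, htR s x i⟩, by rw [htt]; exact hS x hx.1⟩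
      · rintro ⟨x, i⟩ - ⟨y, j⟩ - hxy
        simp only [Sigma.mk.injEq, heq_eq_eq] at hxy
        obtain ⟨h4, rfl⟩ := hxy
        have h5 := congrArg (fun z => t (!s, z) i) h4
        simp only [htt] at h5
        rw [h5]
    have h4 : ∑ x ∈ S, ((univ.filter fun i => f (t (s, x) i) = c').card : ℝ) ≤
        ∑ z ∈ N, ((univ.filter fun i => f (t (!s, z) i) = c).card : ℝ) := by exact_mod_cast h3
    refine le_of_mul_le_mul_right ?_ hrQ
    rw [add_mul]
    linarith

/-- A matching which misses few elements, from a deficient Hall condition. -/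
theorem exists_deficient_matching {W : Type*} (X : Finset W) (t : W → Finset W) (d : ℕ)
    (h : ∀ S ⊆ X, S.card ≤ (S.biUnion t).card + d) :
    ∃ X' ⊆ X, X.card ≤ X'.card + d ∧ ∃ g : W → W, (∀ x ∈ X', g x ∈ t x) ∧
      ∀ x ∈ X', ∀ y ∈ X', g x = g y → x = y := by
  set t' : X → Finset (W ⊕ Fin d) := fun x => (t x).disjSum univ with ht'
  have hall : ∀ S : Finset X, S.card ≤ (S.biUnion t').card := by
    intro S
    rcases S.eq_empty_or_nonempty with rfl | ⟨x₀, hx₀⟩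
    · simp
    have h1 : S.biUnion t' = ((S.map (Function.Embedding.subtype _)).biUnion t).disjSum univ := by
      ext z
      rcases z with z | z
      · simp [ht', Finset.mem_biUnion]
      · simp only [ht', Finset.mem_biUnion, Finset.inr_mem_disjSum, Finset.mem_univ, and_true,
          iff_true]
        exact ⟨x₀, hx₀⟩
    rw [h1, Finset.card_disjSum, Finset.card_univ, Fintype.card_fin]
    have := h (S.map (Function.Embedding.subtype _)) (by
      intro z hz
      obtain ⟨z, -, rfl⟩ := Finset.mem_map.1 hz
      exact z.2)
    rwa [Finset.card_map] at this
  obtain ⟨f, hf, hfm⟩ := (Finset.all_card_le_biUnion_card_iff_exists_injective t').1 hall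
  set X' := X.filter fun x => ∃ hx : x ∈ X, ∃ w, f ⟨x, hx⟩ = Sum.inl w with hX'
  have hinl : ∀ x ∈ X', ∃ w, ∃ hx : x ∈ X, f ⟨x, hx⟩ = Sum.inl w := by
    intro x hx
    obtain ⟨-, hx, w, hw⟩ := Finset.mem_filter.1 hx
    exact ⟨w, hx, hw⟩
  choose! g hg using hinl
  refine ⟨X', Finset.filter_subset _ _, ?_, g, fun x hx => ?_, fun x hx y hy hxy => ?_⟩
  · rw [← Finset.card_filter_add_card_filter_not (s := X) fun x =>
      ∃ hx : x ∈ X, ∃ w, f ⟨x, hx⟩ = Sum.inl w]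
    refine Nat.add_le_add_left ?_ _
    have h2 : ((univ : Finset (Fin d)).map (Function.Embedding.inr (α := W))).card = d := by simp
    refine (Finset.card_le_card_of_injOn (fun x => if hx : x ∈ X then f ⟨x, hx⟩ else Sum.inl x)
      ?_ ?_).trans h2.le
    · intro x hx
      obtain ⟨hx, hn⟩ := Finset.mem_filter.1 hx
      simp only [hx, dif_pos]
      rcases hfx : f ⟨x, hx⟩ with w | i
      · exact absurd ⟨hx, w, hfx⟩ hn
      · simp
    · intro x hx y hy hxy
      simp only [(Finset.mem_filter.1 hx).1, (Finset.mem_filter.1 hy).1, dif_pos] at hxy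
      simpa using hf hxy
  · obtain ⟨hxX, h1⟩ := hg x hx
    have h2 := hfm ⟨x, hxX⟩
    rw [h1] at h2
    simpa [ht'] using h2
  · obtain ⟨hxX, h1⟩ := hg x hx
    obtain ⟨hyX, h2⟩ := hg y hy
    rw [hxy, ← h2] at h1
    simpa using hf h1

/-- Many disjoint trails following a given word through a sequence of layers. -/
theorem exists_fan {W : Type*} [Fintype W] (R : Bool → W → W → Prop) (d : ℕ) (l : List Bool)
    (P : ℕ → Finset W) (hP : ∀ i ≤ l.length, ∀ j ≤ l.length, i ≠ j → Disjoint (P i) (P j))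
    (h : ∀ j < l.length, ∀ s, ∀ S ⊆ P j,
      S.card ≤ ((P (j + 1)).filter fun z => ∃ x ∈ S, R s x z).card + d) :
    ∀ X ⊆ P 0, ∃ X' ⊆ X, X.card ≤ X'.card + l.length * d ∧ ∃ (y : W → W) (S : W → Finset W),
      (∀ x ∈ X', Trail R l x (y x) (S x) ∧ ∀ z ∈ S x, ∃ j < l.length, z ∈ P (j + 1)) ∧
      ∀ x ∈ X', ∀ x' ∈ X', x ≠ x' → Disjoint (S x) (S x') := by
  induction l generalizing P with
  | nil =>
    exact fun X _ => ⟨X, subset_rfl, by simp, id, fun _ => ∅, fun x _ => ⟨.nil x, by simp⟩, by simp⟩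
  | cons s l ih =>
    intro X hX
    obtain ⟨X₁, hX₁, hc₁, g, hg, hgi⟩ := exists_deficient_matching X
      (fun x => (P 1).filter fun z => R s x z) d (fun S hS => by
        refine (h 0 (by simp) s S (hS.trans hX)).trans (Nat.add_le_add_right
          (Finset.card_le_card fun z hz => ?_) _)
        obtain ⟨hz, x, hx, hxz⟩ := Finset.mem_filter.1 hz
        exact Finset.mem_biUnion.2 ⟨x, hx, Finset.mem_filter.2 ⟨hz, hxz⟩⟩)
    obtain ⟨Y, hY, hcY, y, S, hS, hSd⟩ := ih (fun j => P (j + 1))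
      (fun i hi j hj hij => hP _ (by simpa using hi) _ (by simpa using hj) (by omega))
      (fun j hj => h (j + 1) (by simpa using hj)) (X₁.image g) (fun z hz => by
        obtain ⟨x, hx, rfl⟩ := Finset.mem_image.1 hz
        exact (Finset.mem_filter.1 (hg x hx)).1)
    have hXY : (X₁.filter fun x => g x ∈ Y).card = Y.card := by
      rw [← Finset.card_image_of_injOn (s := X₁.filter fun x => g x ∈ Y) (f := g)
        fun x hx x' hx' => hgi x (Finset.mem_filter.1 hx).1 x' (Finset.mem_filter.1 hx').1]
      congr 1
      ext z
      simp only [Finset.mem_image, Finset.mem_filter]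
      constructor
      · rintro ⟨x, ⟨-, hx⟩, rfl⟩; exact hx
      · intro hz
        obtain ⟨x, hx, rfl⟩ := Finset.mem_image.1 (hY hz)
        exact ⟨x, ⟨hx, hz⟩, rfl⟩
    rw [Finset.card_image_of_injOn fun x hx x' hx' => hgi x hx x' hx'] at hcY
    have hP1 : ∀ w ∈ Y, w ∈ P 1 := by
      intro w hw
      obtain ⟨x, hx, rfl⟩ := Finset.mem_image.1 (hY hw)
      exact (Finset.mem_filter.1 (hg x hx)).1
    have hnot : ∀ w ∈ Y, ∀ w' ∈ Y, w ∉ S w' := by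
      intro w hw w' hw' hmem
      obtain ⟨j, hj, hz⟩ := (hS w' hw').2 w hmem
      exact Finset.disjoint_left.1 (hP 1 (by simp) (j + 1 + 1) (by simpa using hj) (by omega))
        (hP1 w hw) hz
    refine ⟨X₁.filter fun x => g x ∈ Y, (Finset.filter_subset _ _).trans hX₁, ?_,
      fun x => y (g x), fun x => insert (g x) (S (g x)), fun x hx => ?_, fun x hx x' hx' hne => ?_⟩
    · rw [hXY, List.length_cons, Nat.succ_mul]
      omega
    · obtain ⟨hx, hxY⟩ := Finset.mem_filter.1 hx
      refine ⟨.cons (Finset.mem_filter.1 (hg x hx)).2 (hS _ hxY).1 (hnot _ hxY _ hxY), ?_⟩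
      intro z hz
      rcases Finset.mem_insert.1 hz with rfl | hz
      · exact ⟨0, by simp, hP1 _ hxY⟩
      · obtain ⟨j, hj, hz⟩ := (hS _ hxY).2 z hz
        exact ⟨j + 1, by simpa using hj, hz⟩
    · obtain ⟨hx, hxY⟩ := Finset.mem_filter.1 hx
      obtain ⟨hx', hxY'⟩ := Finset.mem_filter.1 hx'
      have hgne : g x ≠ g x' := fun h => hne (hgi x hx x' hx' h)
      simp only [Finset.disjoint_insert_left, Finset.disjoint_insert_right, Finset.mem_insert,
        not_or]
      exact ⟨⟨hgne.symm, hnot _ hxY' _ hxY⟩, hnot _ hxY _ hxY', hSd _ hxY _ hxY' hgne⟩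

/-- An injection between finite sets, as a total function. -/
theorem exists_injOn_mapsTo {α β : Type*} [Nonempty β] {s : Finset α} {t : Finset β}
    (h : s.card ≤ t.card) :
    ∃ g : α → β, (∀ a ∈ s, g a ∈ t) ∧ ∀ a ∈ s, ∀ b ∈ s, g a = g b → a = b := by
  obtain ⟨e⟩ := Function.Embedding.nonempty_of_card_le (α := s) (β := t) (by simpa using h)
  refine ⟨fun a => if ha : a ∈ s then e ⟨a, ha⟩ else Classical.arbitrary β, fun a ha => ?_,
    fun a ha b hb hab => ?_⟩
  · simp [ha]
  · simp only [ha, hb, dif_pos] at hab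
    simpa using e.injective (Subtype.ext hab)

/-- Coloured items can be distributed to few boxes so that all boxes are monochromatic and no box
receives more than `cap` items. -/
theorem exists_monochromatic_distribution {T : Type*} [Fintype T] {N cap J : ℕ} (hcap : 0 < cap)
    (w : ℕ → T) (h : N / cap + Fintype.card T ≤ J) :
    ∃ φ : ℕ → ℕ, (∀ b < N, φ b < J) ∧ (∀ b < N, ∀ b' < N, φ b = φ b' → w b = w b') ∧
      ∀ j, ((range N).filter fun b => φ b = j).card ≤ cap := by
  set rank : ℕ → ℕ := fun b => ((range b).filter fun b' => w b' = w b).card with hrank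
  have hrank_lt : ∀ b b', b < b' → w b = w b' → rank b < rank b' := by
    intro b b' hbb hw
    refine Finset.card_lt_card ⟨fun a ha => ?_, fun hsub => ?_⟩
    · simp only [Finset.mem_filter, Finset.mem_range] at ha ⊢
      exact ⟨ha.1.trans hbb, ha.2.trans hw⟩
    · have := hsub (Finset.mem_filter.2 ⟨Finset.mem_range.2 hbb, hw⟩)
      simp at this
  set num : T → ℕ := fun a => ((range N).filter fun b => w b = a).card with hnum
  set I : Finset ((_ : T) × ℕ) := univ.sigma fun a => range (num a / cap + 1) with hI
  have hkey : ∀ b ∈ range N, (⟨w b, rank b / cap⟩ : (_ : T) × ℕ) ∈ I := by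
    intro b hb
    refine Finset.mem_sigma.2 ⟨Finset.mem_univ _, Finset.mem_range.2 (Nat.lt_succ_of_le ?_)⟩
    refine Nat.div_le_div_right (Finset.card_le_card fun a ha => ?_)
    simp only [Finset.mem_filter, Finset.mem_range] at ha hb ⊢
    exact ⟨ha.1.trans hb, ha.2⟩
  have hIJ : I.card ≤ (range J).card := by
    rw [hI, Finset.card_sigma, Finset.card_range]
    refine le_trans ?_ h
    simp only [Finset.card_range]
    rw [Finset.sum_add_distrib, Finset.sum_const, smul_eq_mul, mul_one, Finset.card_univ]
    refine Nat.add_le_add_right ((Nat.le_div_iff_mul_le hcap).2 ?_) _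
    have h1 : ∑ a, num a = N := by
      have := Finset.card_eq_sum_card_fiberwise (s := range N) (t := univ) (f := w)
        (fun _ _ => Finset.mem_coe.2 (Finset.mem_univ _))
      rw [Finset.card_range] at this
      exact this.symm
    rw [Finset.sum_mul, ← h1]
    exact Finset.sum_le_sum fun a _ => Nat.div_mul_le_self _ _
  obtain ⟨g, hg, hgi⟩ := exists_injOn_mapsTo hIJ
  have hinj : ∀ b < N, ∀ b' < N, g ⟨w b, rank b / cap⟩ = g ⟨w b', rank b' / cap⟩ →
      w b = w b' ∧ rank b / cap = rank b' / cap := by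
    intro b hb b' hb' hbb
    have := hgi _ (hkey b (Finset.mem_range.2 hb)) _ (hkey b' (Finset.mem_range.2 hb')) hbb
    simpa using this
  refine ⟨fun b => g ⟨w b, rank b / cap⟩,
    fun b hb => Finset.mem_range.1 (hg _ (hkey b (Finset.mem_range.2 hb))),
    fun b hb b' hb' hbb => (hinj b hb b' hb' hbb).1, fun j => ?_⟩
  refine (Finset.card_le_card_of_injOn (t := range cap) (fun b => rank b % cap)
    (fun b _ => Finset.mem_coe.2 (Finset.mem_range.2 (Nat.mod_lt _ hcap))) ?_).trans
    (Finset.card_range cap).le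
  intro b hb b' hb' hbb
  simp only [Finset.coe_filter, Set.mem_ofPred_eq, Finset.mem_range] at hb hb'
  obtain ⟨h1, h2⟩ := hinj b hb.1 b' hb'.1 (hb.2.trans hb'.2.symm)
  have h3 : rank b = rank b' := by
    rw [← Nat.div_add_mod (rank b) cap, ← Nat.div_add_mod (rank b') cap, h2]
    simp only at hbb
    rw [hbb]
  rcases lt_trichotomy b b' with h4 | h4 | h4
  · exact absurd h3 (hrank_lt _ _ h4 h1).ne
  · exact h4
  · exact absurd h3 (hrank_lt _ _ h4 h1.symm).ne'

theorem Trail.map {V W σ : Type*} {R : σ → V → V → Prop} {R' : σ → W → W → Prop}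
    (f : V ↪ W) (hf : ∀ s x y, R s x y → R' s (f x) (f y)) {l : List σ} {x y : V} {S : Finset V}
    (h : Trail R l x y S) : Trail R' l (f x) (f y) (S.map f) := by
  induction h with
  | nil x => exact .nil _
  | cons hr _ hz ih =>
    rw [Finset.map_insert]
    exact .cons (hf _ _ _ hr) ih (by simpa using hz)

set_option maxHeartbeats 1000000 in
/-- In a digraph which is the union of sufficiently many disjoint permutations, almost all of the
vertices can be covered by disjoint trails following prescribed words of a given length. -/
theorem exists_trails_of_perms (m : ℕ) {ε : ℝ} (hε : 0 < ε) (hε1 : ε ≤ 1) :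
    ∃ r w₀ : ℕ, 0 < r ∧ ∀ (W : Type) [Fintype W] (R : Bool → W → W → Prop)
      (σ : Fin r → Equiv.Perm W), (∀ x, Function.Injective fun i => σ i x) →
      (∀ i x, R true x (σ i x)) → (∀ i x, R false (σ i x) x) → w₀ ≤ Fintype.card W →
      ∀ (N : ℕ) (β : ℕ → List Bool), (∀ b < N, (β b).length = m) →
      (N : ℝ) * (m + 1) ≤ (1 - ε) * Fintype.card W →
      ∃ (x y : ℕ → W) (S : ℕ → Finset W),
        (∀ b < N, x b ∉ S b ∧ Trail R (β b) (x b) (y b) (S b)) ∧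
        ∀ b < N, ∀ b' < N, b ≠ b' → Disjoint (insert (x b) (S b)) (insert (x b') (S b')) := by
  obtain ⟨J, hJ⟩ := exists_nat_ge (2 ^ m / (ε / 2))
  rw [div_le_iff₀ (by positivity)] at hJ
  have hJ0 : 0 < J := by
    rcases Nat.eq_zero_or_pos J with rfl | h
    · have : (0 : ℝ) < 2 ^ m := by positivity
      simp at hJ
      linarith
    · exact h
  set Q : ℝ := J * (m + 1) with hQ
  have hJ0' : (0 : ℝ) < J := by exact_mod_cast hJ0
  have hm0 : (0 : ℝ) < m + 1 := by positivity
  have hQ0 : 0 < Q := by positivity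
  set e : ℝ := ε / (8 * Q * (m + 1)) with he
  have he0 : 0 < e := by positivity
  obtain ⟨r, hr⟩ := exists_nat_ge (16 * Q ^ 3 / e ^ 2)
  rw [div_le_iff₀ (by positivity)] at hr
  obtain ⟨w₀, hw₀⟩ := exists_nat_ge (8 * Q / ε)
  rw [div_le_iff₀ (by positivity)] at hw₀
  have hr0 : 0 < r := by
    rcases Nat.eq_zero_or_pos r with rfl | h
    · have : 0 < 16 * Q ^ 3 := by positivity
      simp at hr
      linarith
    · exact h
  refine ⟨r, w₀, hr0, fun W _ R σ hσ hR hR' hW N β hβ hN => ?_⟩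
  set w : ℝ := (Fintype.card W : ℝ) with hw
  have hww : 8 * Q ≤ w * ε := hw₀.trans (by
    have : (w₀ : ℝ) ≤ w := by rw [hw]; exact_mod_cast hW
    gcongr)
  have hw0 : 0 < w := by
    by_contra! hcon
    have : w * ε ≤ 0 := mul_nonpos_of_nonpos_of_nonneg hcon hε.le
    linarith
  have hWne : Nonempty W := by
    rw [hw] at hw0
    exact Fintype.card_pos_iff.1 (by exact_mod_cast hw0)
  have hC : Nonempty (Fin J × Fin (m + 1)) := ⟨(⟨0, hJ0⟩, 0)⟩
  have hCard : ((Fintype.card (Fin J × Fin (m + 1)) : ℕ) : ℝ) = Q := by simp [hQ]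
  obtain ⟨f, hf, hfS⟩ := exists_expanding_coloring (C := Fin J × Fin (m + 1)) hr0 R σ hσ hR hR'
    (d := e * w) (by positivity) (by
      rw [hCard, ← hw]
      calc 16 * w ^ 2 * Q ^ 3 = w ^ 2 * (16 * Q ^ 3) := by ring
        _ ≤ w ^ 2 * (r * e ^ 2) := by gcongr
        _ = _ := by ring)
  rw [hCard, ← hw] at hf
  set d : ℕ := ⌊e * w⌋₊ with hd
  have hdw : (d : ℝ) ≤ e * w := Nat.floor_le (by positivity)
  have hmd : (m + 1) * (e * w) = ε * w / (8 * Q) := by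
    rw [he]; field_simp
  set cap : ℕ := ⌊w / Q - (m + 1) * (e * w)⌋₊ with hcap
  have h1w : 1 ≤ ε * w / (8 * Q) := by
    rw [le_div_iff₀ (by positivity)]; linarith
  have hcap_ge : w / Q * (1 - ε / 4) ≤ cap := by
    have h1 := (Nat.lt_floor_add_one (w / Q - (m + 1) * (e * w))).le
    rw [← hcap, hmd] at h1
    have h2 : w / Q * (1 - ε / 4) = w / Q - ε * w / (8 * Q) - ε * w / (8 * Q) := by
      field_simp; ring
    linarith
  have hcap_pos : (0 : ℝ) < cap := lt_of_lt_of_le (by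
    have : 0 < 1 - ε / 4 := by linarith
    positivity) hcap_ge
  have hcap0 : 0 < cap := by exact_mod_cast hcap_pos
  have hcap_le : (cap : ℝ) ≤ w / Q - (m + 1) * (e * w) := by
    exact Nat.floor_le (by
      by_contra! hcon
      rw [Nat.floor_of_nonpos hcon.le] at hcap
      omega)
  have hvec : ∀ b < N, ∃ v : List.Vector Bool m, v.toList = β b := fun b hb => ⟨⟨β b, hβ b hb⟩, rfl⟩
  choose! v hv using hvec
  obtain ⟨φ, hφJ, hφw, hφc⟩ := exists_monochromatic_distribution (J := J) (N := N) hcap0 v (by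
    have h1 : ((N / cap : ℕ) : ℝ) + 2 ^ m ≤ J := by
      have h2 : ((N / cap : ℕ) : ℝ) ≤ J * (1 - ε / 2) := by
        refine Nat.cast_div_le.trans ?_
        rw [div_le_iff₀ hcap_pos]
        refine le_trans ?_ (mul_le_mul_of_nonneg_left hcap_ge
          (mul_nonneg hJ0'.le (by linarith)))
        have h3 : (J : ℝ) * (1 - ε / 2) * (w / Q * (1 - ε / 4)) =
            w * ((1 - ε / 2) * (1 - ε / 4)) / (m + 1) := by
          rw [hQ]; field_simp
        rw [h3, le_div_iff₀ hm0]
        refine hN.trans ?_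
        rw [mul_comm]
        refine mul_le_mul_of_nonneg_left ?_ hw0.le
        nlinarith
      linarith
    rw [card_vector, Fintype.card_bool]
    exact_mod_cast h1)
  have hword : ∀ j, ∃ l : List Bool, l.length = m ∧ ∀ b < N, φ b = j → β b = l := by
    intro j
    by_cases h : ∃ b < N, φ b = j
    · obtain ⟨b, hb, rfl⟩ := h
      refine ⟨β b, hβ b hb, fun b' hb' hbb => ?_⟩
      rw [← hv b' hb', ← hv b hb, hφw b' hb' b hb hbb]
    · push Not at h
      exact ⟨List.replicate m true, by simp, fun b hb hbj => absurd hbj (h b hb)⟩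
  choose l hl hlβ using hword
  set P : ℕ → ℕ → Finset W := fun j i => univ.filter fun x => ((f x).1 : ℕ) = j ∧ ((f x).2 : ℕ) = i
    with hP
  have hPc : ∀ j (hj : j < J) i (hi : i < m + 1),
      P j i = univ.filter fun x => f x = (⟨j, hj⟩, ⟨i, hi⟩) := by
    intro j hj i hi
    ext x
    simp [hP, Prod.ext_iff, Fin.ext_iff]
  have hfan : ∀ j < J, ∃ X' ⊆ P j 0, cap ≤ X'.card ∧ ∃ (y : W → W) (S : W → Finset W),
      (∀ x ∈ X', Trail R (l j) x (y x) (S x) ∧ ∀ z ∈ S x, ∃ i < (l j).length, z ∈ P j (i + 1)) ∧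
      ∀ x ∈ X', ∀ x' ∈ X', x ≠ x' → Disjoint (S x) (S x') := by
    intro j hj
    obtain ⟨X', hX', hc, h⟩ := exists_fan R d (l j) (P j) (by
      intro i _ i' _ hii
      rw [Finset.disjoint_left]
      intro x hx hx'
      simp only [hP, Finset.mem_filter] at hx hx'
      exact hii (hx.2.2.symm.trans hx'.2.2)) (by
      intro i hi s S hS
      rw [hl] at hi
      have h1 := hfS s (⟨j, hj⟩, ⟨i, by omega⟩) (⟨j, hj⟩, ⟨i + 1, by omega⟩) S (by
        intro x hx
        have := hS hx
        rw [hPc j hj i (by omega)] at this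
        exact (Finset.mem_filter.1 this).2)
      have hset : ((P j (i + 1)).filter fun z => ∃ x ∈ S, R s x z) = univ.filter fun z =>
          f z = (⟨j, hj⟩, ⟨i + 1, by omega⟩) ∧ ∃ x ∈ S, R s x z := by
        ext z
        simp [hP, Prod.ext_iff, Fin.ext_iff]
      have h2 : (S.card : ℝ) ≤ ((P j (i + 1)).filter fun z => ∃ x ∈ S, R s x z).card + e * w := by
        rw [hset]
        convert h1
      have h3 : S.card - ((P j (i + 1)).filter fun z => ∃ x ∈ S, R s x z).card ≤ d := by
        refine Nat.le_floor ?_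
        rcases le_total S.card ((P j (i + 1)).filter fun z => ∃ x ∈ S, R s x z).card with h4 | h4
        · rw [Nat.sub_eq_zero_of_le h4, Nat.cast_zero]
          positivity
        · rw [Nat.cast_sub h4]
          linarith
      omega) (P j 0) subset_rfl
    refine ⟨X', hX', ?_, h⟩
    have h1 := hf (⟨j, hj⟩, ⟨0, by omega⟩)
    have h0 : w / Q - e * w ≤ (P j 0).card := by
      rw [hPc j hj 0 (by omega)]
      convert h1
    have h2 : ((P j 0).card : ℝ) ≤ X'.card + m * d := by rw [hl] at hc; exact_mod_cast hc
    have h3 : (cap : ℝ) ≤ X'.card := by nlinarith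
    exact_mod_cast h3
  choose! X' hX' hX'c y S hS hSd using hfan
  have hx : ∀ j < J, ∃ x : ℕ → W, (∀ b ∈ (range N).filter fun b => φ b = j, x b ∈ X' j) ∧
      ∀ b ∈ (range N).filter fun b => φ b = j, ∀ b' ∈ (range N).filter fun b => φ b = j,
        x b = x b' → b = b' := fun j hj =>
    exists_injOn_mapsTo ((hφc j).trans (hX'c j hj))
  choose! x hx hxi using hx
  have hmem : ∀ b < N, b ∈ (range N).filter fun b' => φ b' = φ b := fun b hb =>
    Finset.mem_filter.2 ⟨Finset.mem_range.2 hb, rfl⟩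
  have hxP : ∀ b < N, x (φ b) b ∈ P (φ b) 0 := fun b hb =>
    hX' _ (hφJ b hb) (hx _ (hφJ b hb) b (hmem b hb))
  have hSP : ∀ b < N, ∀ z ∈ S (φ b) (x (φ b) b), ((f z).1 : ℕ) = φ b ∧ 0 < ((f z).2 : ℕ) := by
    intro b hb z hz
    obtain ⟨i, -, hi⟩ := (hS _ (hφJ b hb) _ (hx _ (hφJ b hb) b (hmem b hb))).2 z hz
    simp only [hP, Finset.mem_filter] at hi
    omega
  have hxP' : ∀ b < N, ((f (x (φ b) b)).1 : ℕ) = φ b ∧ ((f (x (φ b) b)).2 : ℕ) = 0 := fun b hb =>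
    (Finset.mem_filter.1 (hxP b hb)).2
  refine ⟨fun b => x (φ b) b, fun b => y (φ b) (x (φ b) b), fun b => S (φ b) (x (φ b) b),
    fun b hb => ⟨fun h => ?_, ?_⟩, fun b hb b' hb' hbb => ?_⟩
  · have h1 := hSP b hb (x (φ b) b) h
    have h2 := hxP' b hb
    omega
  · rw [hlβ _ b hb rfl]
    exact (hS _ (hφJ b hb) _ (hx _ (hφJ b hb) b (hmem b hb))).1
  · by_cases hφφ : φ b = φ b'
    · have hne : x (φ b) b ≠ x (φ b') b' := by
        intro h
        rw [← hφφ] at h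
        exact hbb (hxi _ (hφJ b hb) b (hmem b hb) b' (by rw [hφφ]; exact hmem b' hb') h)
      simp only [Finset.disjoint_insert_left, Finset.disjoint_insert_right, Finset.mem_insert,
        not_or]
      refine ⟨⟨hne.symm, fun h => ?_⟩, fun h => ?_, ?_⟩
      · have h1 := hSP b hb _ h
        have h2 := hxP' b' hb'
        omega
      · have h1 := hSP b' hb' _ h
        have h2 := hxP' b hb
        omega
      · have h1 := hx _ (hφJ b hb) b (hmem b hb)
        have h2 := hx _ (hφJ b' hb') b' (hmem b' hb')
        rw [← hφφ] at h2 hne ⊢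
        exact hSd _ (hφJ b hb) _ h1 _ h2 hne
    · rw [Finset.disjoint_left]
      intro z hz hz'
      have h1 : ((f z).1 : ℕ) = φ b := by
        rcases Finset.mem_insert.1 hz with rfl | hz
        · exact (hxP' b hb).1
        · exact (hSP b hb z hz).1
      have h2 : ((f z).1 : ℕ) = φ b' := by
        rcases Finset.mem_insert.1 hz' with rfl | hz'
        · exact (hxP' b' hb').1
        · exact (hSP b' hb' z hz').1
      exact hφφ (h1.symm.trans h2)

/-- Almost all vertices of a large set with small complement in an expander can be covered by
disjoint trails following prescribed words of a given length. -/
theorem exists_cover (m : ℕ) {ε : ℝ} (hε : 0 < ε) (hε1 : ε ≤ 1) :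
    ∃ r w₀ : ℕ, ∀ (V : Type) [Fintype V] (G : V → V → Prop) (κ μ : ℝ), Expander G κ μ →
      (∀ x, (κ + μ) * Fintype.card V ≤ (univ.filter fun z => G x z).card) → ∀ U : Finset V,
      (Uᶜ.card : ℝ) + r ≤ μ * Fintype.card V → w₀ ≤ U.card →
      ∀ (N : ℕ) (β : ℕ → List Bool), (∀ b < N, (β b).length = m) →
      (N : ℝ) * (m + 1) ≤ (1 - ε) * U.card →
      ∃ (x y : ℕ → V) (S : ℕ → Finset V),
        (∀ b < N, insert (x b) (S b) ⊆ U ∧ x b ∉ S b ∧ Trail (stepRel G) (β b) (x b) (y b) (S b)) ∧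
        ∀ b < N, ∀ b' < N, b ≠ b' → Disjoint (insert (x b) (S b)) (insert (x b') (S b')) := by
  obtain ⟨r, w₀, -, h⟩ := exists_trails_of_perms m hε hε1
  refine ⟨r, w₀, fun V _ G κ μ hG hdeg U hU hw₀ N β hβ hN => ?_⟩
  obtain ⟨σ, hσ, hσi⟩ := hG.exists_perms hdeg U r hU
  obtain ⟨x, y, S, hS, hd⟩ := h U (fun s x y => stepRel G s x y) (fun i => σ i)
    (fun x i j hij => Fin.ext (hσi i i.2 j j.2 x hij)) (fun i x => hσ i i.2 x)
    (fun i x => hσ i i.2 x) (by rwa [Fintype.card_coe]) N β hβ (by rwa [Fintype.card_coe])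
  refine ⟨fun b => x b, fun b => y b, fun b => (S b).map (Function.Embedding.subtype _),
    fun b hb => ⟨?_, ?_, ?_⟩, fun b hb b' hb' hbb => ?_⟩
  · intro z hz
    rcases Finset.mem_insert.1 hz with rfl | hz
    · exact (x b).2
    · obtain ⟨z, -, rfl⟩ := Finset.mem_map.1 hz
      exact z.2
  · simpa using (hS b hb).1
  · exact (hS b hb).2.map (Function.Embedding.subtype _) fun _ _ _ h => h
  · have h1 := (Finset.disjoint_map (Function.Embedding.subtype (· ∈ U))).2 (hd b hb b' hb' hbb)
    rw [Finset.disjoint_left] at h1 ⊢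
    intro z hz hz'
    simp only [Finset.mem_map, Finset.mem_insert, Function.Embedding.subtype_apply] at h1 hz hz'
    refine @h1 z ?_ ?_
    · rcases hz with rfl | ⟨a, ha, rfl⟩
      exacts [⟨_, Or.inl rfl, rfl⟩, ⟨_, Or.inr ha, rfl⟩]
    · rcases hz' with rfl | ⟨a, ha, rfl⟩
      exacts [⟨_, Or.inl rfl, rfl⟩, ⟨_, Or.inr ha, rfl⟩]

/-- Joining bodies through connectors and absorbing all remaining vertices. -/
theorem exists_closed_trail {V : Type*} [Fintype V] {G : V → V → Prop} {L B q M : ℕ}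
    {I : Finset ℕ} (hI : I ⊆ range q) (conn body : ℕ → List Bool)
    (hconn : ∀ b < q, (conn b).length = L + 2)
    (hcard : Fintype.card V = ∑ b ∈ range q, ((conn b).length + (body b).length))
    {x y : ℕ → V} {S D : ℕ → Finset V} {T₀ : Finset V}
    (hSc : ∀ b < q, (S b).card + (if b ∈ I then B else 0) = (body b).length)
    (hxS : ∀ b < q, x b ∉ S b)
    (hE : ∀ b < q, ∀ b' < q, b ≠ b' → Disjoint (insert (x b) (S b)) (insert (x b') (S b')))
    (hET : ∀ b < q, Disjoint (insert (x b) (S b)) T₀)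
    (hED : ∀ b < q, ∀ j < M, Disjoint (insert (x b) (S b)) (D j))
    (hDT : ∀ j < M, Disjoint (D j) T₀) (hDc : ∀ j < M, (D j).card = L + 1)
    (hDD : ∀ i < M, ∀ j < M, i ≠ j → Disjoint (D i) (D j))
    (hD : ∀ (x y : ℕ → V) (l : ℕ → List Bool), (∀ b < q, (l b).length = L + 2) →
        ∃ φ : ℕ → ℕ, (∀ b < q, φ b < M) ∧ (∀ b < q, ∀ b' < q, φ b = φ b' → b = b') ∧
          ∀ b < q, y b ∉ D (φ b) → Trail (stepRel G) (l b) (x b) (y b)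
            (insert (y b) (D (φ b))))
    (hbody : ∀ b < q, b ∉ I → Trail (stepRel G) (body b) (x b) (y b) (S b))
    (habs : ∀ T : Finset V, T₀ ⊆ T → T.card = I.card * B → (∀ b ∈ I, Disjoint (S b) T) →
      ∃ τ : ℕ → Finset V, (∀ b ∈ I, τ b ⊆ T) ∧
        (∀ b ∈ I, ∀ b' ∈ I, b ≠ b' → Disjoint (τ b) (τ b')) ∧
        ∀ b ∈ I, Trail (stepRel G) (body b) (x b) (y b) (S b ∪ τ b)) :
    ∃ (v : V) (Z : Finset V),
      Trail (stepRel G) ((List.range q).flatMap fun b => conn b ++ body b) v v Z := by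
  set v : ℕ → V := fun b => if b = 0 then y (q - 1) else y (b - 1) with hv
  obtain ⟨φ, hφ, hφi, hφt⟩ := hD v x conn hconn
  set W : ℕ → Finset V := fun b => insert (x b) (S b) ∪ D (φ b) with hW
  have hWW : ∀ b < q, ∀ b' < q, b ≠ b' → Disjoint (W b) (W b') := by
    intro b hb b' hb' hne
    simp only [hW, Finset.disjoint_union_left, Finset.disjoint_union_right]
    exact ⟨⟨hE b hb b' hb' hne, (hED b' hb' _ (hφ b hb)).symm⟩, hED b hb _ (hφ b' hb'),
      hDD _ (hφ b hb) _ (hφ b' hb') fun h => hne (hφi b hb b' hb' h)⟩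
  have hWc : ∀ b < q, (W b).card + (if b ∈ I then B else 0) =
      (conn b).length + (body b).length := by
    intro b hb
    rw [hconn b hb, ← hSc b hb]
    simp only [hW]
    rw [Finset.card_union_of_disjoint (hED b hb _ (hφ b hb)),
      Finset.card_insert_of_notMem (hxS b hb), hDc _ (hφ b hb)]
    omega
  set T : Finset V := ((range q).biUnion W)ᶜ with hT
  have hWT : ∀ b < q, Disjoint (W b) T := fun b hb => by
    rw [hT]
    exact disjoint_compl_right.mono_left (Finset.subset_biUnion_of_mem W (Finset.mem_range.2 hb))
  have hTc : T.card = I.card * B := by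
    have h1 : ((range q).biUnion W).card = ∑ b ∈ range q, (W b).card :=
      Finset.card_biUnion fun b hb b' hb' hne =>
        hWW b (Finset.mem_range.1 hb) b' (Finset.mem_range.1 hb') hne
    have h2 := Finset.card_add_card_compl ((range q).biUnion W)
    have h3 : ∑ b ∈ range q, ((W b).card + (if b ∈ I then B else 0)) = Fintype.card V := by
      rw [hcard]
      exact Finset.sum_congr rfl fun b hb => hWc b (Finset.mem_range.1 hb)
    rw [Finset.sum_add_distrib, ← Finset.sum_filter, Finset.filter_mem_eq_inter,
      Finset.inter_eq_right.2 hI, Finset.sum_const, smul_eq_mul] at h3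
    rw [← hT] at h2
    omega
  have hT₀ : T₀ ⊆ T := by
    intro z hz
    rw [hT, Finset.mem_compl, Finset.mem_biUnion]
    rintro ⟨b, hb, hzb⟩
    have hb := Finset.mem_range.1 hb
    rcases Finset.mem_union.1 hzb with h | h
    · exact Finset.disjoint_left.1 (hET b hb) h hz
    · exact Finset.disjoint_left.1 (hDT _ (hφ b hb)) h hz
  have hIq : ∀ b ∈ I, b < q := fun b hb => Finset.mem_range.1 (hI hb)
  obtain ⟨τ, hτT, hτd, hτ⟩ := habs T hT₀ hTc fun b hb => (hWT b (hIq b hb)).mono_left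
    ((Finset.subset_insert _ _).trans Finset.subset_union_left)
  set τ' : ℕ → Finset V := fun b => if b ∈ I then τ b else ∅ with hτ'
  have hτ'T : ∀ b, τ' b ⊆ T := by
    intro b
    by_cases hb : b ∈ I
    · simpa [hτ', hb] using hτT b hb
    · simp [hτ', hb]
  have hτ'd : ∀ b b', b ≠ b' → Disjoint (τ' b) (τ' b') := by
    intro b b' hne
    by_cases hb : b ∈ I
    · by_cases hb' : b' ∈ I
      · simpa [hτ', hb, hb'] using hτd b hb b' hb' hne
      · simp [hτ', hb']
    · simp [hτ', hb]
  have htrail : ∀ b < q, Trail (stepRel G) (body b) (x b) (y b) (S b ∪ τ' b) := by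
    intro b hb
    by_cases hbI : b ∈ I
    · simpa [hτ', hbI] using hτ b hbI
    · simpa [hτ', hbI] using hbody b hb hbI
  refine ⟨v 0, (range q).biUnion fun b => W b ∪ τ' b, ?_⟩
  have hv0 : v q = v 0 := by simp [hv]
  have key := Trail.chain (R := stepRel G) (fun b => conn b ++ body b) v (fun b => W b ∪ τ' b) q
    (fun b hb => by
      have hxD : x b ∉ D (φ b) := fun h =>
        Finset.disjoint_left.1 (hED b hb _ (hφ b hb)) (Finset.mem_insert_self _ _) h
      have h1 := (hφt b hb hxD).append (htrail b hb) (by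
        have h2 := hED b hb _ (hφ b hb)
        have h3 := (hWT b hb).mono_right (hτ'T b)
        have h4 := hxS b hb
        simp only [hW, Finset.disjoint_union_left, Finset.disjoint_insert_left] at h2 h3
        simp only [Finset.disjoint_insert_left, Finset.disjoint_union_right]
        exact ⟨⟨h4, h2.2.symm⟩, h3.1.1, h3.2⟩)
      have h5 : v (b + 1) = y b := by simp [hv]
      rw [h5]
      convert h1 using 1
      ext z
      simp only [hW, Finset.mem_union, Finset.mem_insert]
      tauto)
    (fun b hb b' hb' hne => by
      simp only [Finset.disjoint_union_left, Finset.disjoint_union_right]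
      exact ⟨⟨hWW b hb b' hb' hne, ((hWT b' hb').mono_right (hτ'T b)).symm⟩,
        (hWT b hb).mono_right (hτ'T b'), hτ'd b b' hne⟩)
  rwa [hv0] at key

theorem exists_enumeration (s : Finset ℕ) :
    ∃ e r : ℕ → ℕ, (∀ a < s.card, e a ∈ s ∧ r (e a) = a) ∧ ∀ b ∈ s, r b < s.card ∧ e (r b) = b := by
  refine ⟨fun a => if h : a < s.card then s.equivFin.symm ⟨a, h⟩ else 0,
    fun b => if h : b ∈ s then s.equivFin ⟨b, h⟩ else 0, fun a ha => ?_, fun b hb => ?_⟩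
  · simp [ha]
  · simp [hb]

/-- Fresh vertices avoiding a small set. -/
theorem exists_injOn_notMem {V : Type*} [Fintype V] [Nonempty V] (p : ℕ) (Z : Finset V)
    (h : Z.card + p ≤ Fintype.card V) :
    ∃ ξ : ℕ → V, (∀ a < p, ξ a ∉ Z) ∧ ∀ a < p, ∀ b < p, ξ a = ξ b → a = b := by
  obtain ⟨ξ, h1, h2⟩ := exists_injOn_of_card_le p (fun _ => Zᶜ) fun b _ => by
    have := Finset.card_add_card_compl Z
    omega
  exact ⟨ξ, fun a ha => Finset.mem_compl.1 (h1 a ha), h2⟩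

set_option maxHeartbeats 1000000 in
/-- A closed spanning trail exists as soon as a small proportion of the frames into which its word
is cut have bodies that split into slottable words. -/
theorem exists_spanning_trail_of_slottable {L : ℕ} (C B m : ℕ) (hL1 : 1 ≤ L) (hB : 0 < B)
    (hBm : B ≤ m) :
    ∃ r w₀ : ℕ, ∀ (V : Type) [Fintype V] (G : V → V → Prop) (κ μ : ℝ), Expander G κ μ →
      (∀ x, (κ + μ) * Fintype.card V ≤ (univ.filter fun z => G x z).card) →
      0 < μ → μ ≤ κ → κ ≤ 1 → 1 ≤ κ + μ * (L - 1) →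
      (1 - 1 / 2 ^ L * (κ / 2) ^ 2 / 2) ^ C ≤ 1 / 4 →
      ∀ (q e p : ℕ) (I : Finset ℕ) (conn body : ℕ → List Bool) (wd : ℕ → ℕ → List Bool),
      0 < q → e < m + L + 2 → Fintype.card V = q * (m + L + 2) + e →
      I ⊆ range (q - 1) → I.card = p →
      (∀ b < q, (conn b).length = L + 2) → (∀ b < q - 1, (body b).length = m) →
      (body (q - 1)).length = m + e → (∀ b ∈ I, body b = (List.range B).flatMap (wd b)) →
      (∀ b ∈ I, ∀ i < B, Slottable G (1 / 2 ^ 9) (μ / 4) (wd b i)) →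
      2 * (C * q * (L + 1)) ≤ p * B → Fintype.card V ≤ 2 ^ (p * B) →
      Fintype.card V * Fintype.card V * 2 ^ (L + 2) ≤ 2 ^ q →
      ((3 * p * (m + L + 2) + 3 * (m + L + 2) + C * q * (L + 1) + L + 5 + r : ℕ) : ℝ) ≤
        μ / 4 * Fintype.card V →
      2 * w₀ ≤ Fintype.card V →
      ∃ (v : V) (Z : Finset V),
        Trail (stepRel G) ((List.range q).flatMap fun b => conn b ++ body b) v v Z := by
  have hF : (0 : ℝ) < 2 * (m + L + 2 : ℕ) := by positivity
  have hF1 : 1 / (2 * ((m + L + 2 : ℕ) : ℝ)) ≤ 1 := by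
    rw [div_le_one hF]
    push_cast
    linarith [(Nat.cast_nonneg m : (0 : ℝ) ≤ m), (Nat.cast_nonneg L : (0 : ℝ) ≤ L)]
  obtain ⟨r, w₀, hcov⟩ := exists_cover m (one_div_pos.2 hF) hF1
  refine ⟨r, w₀, fun V _ G κ μ hG hdeg hμ hμκ hκ1 hL hC q e p I conn body wd hq he hcard hI hp
    hconn hlen hlast hbodyI hslot hCB hV hVq hsize hw => ?_⟩
  have hnpos : 0 < Fintype.card V := by
    rw [hcard]
    positivity
  have hne : Nonempty V := Fintype.card_pos_iff.1 hnpos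
  have hn : (0 : ℝ) < Fintype.card V := by exact_mod_cast hnpos
  have hμ1 : μ ≤ 1 := hμκ.trans hκ1
  have hIq : ∀ b ∈ I, b < q - 1 := fun b hb => Finset.mem_range.1 (hI hb)
  have hpB : p * B ≤ p * m := Nat.mul_le_mul_left p hBm
  have hsizeN : 3 * p * (m + L + 2) + 3 * (m + L + 2) + C * q * (L + 1) + L + 5 + r ≤
      Fintype.card V := by
    have : ((3 * p * (m + L + 2) + 3 * (m + L + 2) + C * q * (L + 1) + L + 5 + r : ℕ) : ℝ) ≤
      Fintype.card V := hsize.trans (by nlinarith)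
    exact_mod_cast this
  have hpF : 3 * p * (m + L + 2) = 3 * (p * m) + 3 * (p * L) + 6 * p := by ring
  have hpp : p ≤ p * L := Nat.le_mul_of_pos_right p hL1
  obtain ⟨en, rk, hen, hrk⟩ := exists_enumeration I
  obtain ⟨en', rk', hen', hrk'⟩ := exists_enumeration (range (q - 1) \ I)
  have hN : (range (q - 1) \ I).card + p + 1 = q := by
    rw [Finset.card_sdiff_of_subset hI, hp, Finset.card_range]
    have := Finset.card_le_card hI
    rw [hp, Finset.card_range] at this
    omega
  set N := (range (q - 1) \ I).card with hNdef
  rw [hp] at hen hrk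
  -- vertices to be absorbed, and initial vertices of the absorbing frames
  obtain ⟨T₀, -, hT₀⟩ := Finset.exists_subset_card_eq
    (s := (univ : Finset V)) (n := p * B - p * B / 2) (by rw [Finset.card_univ]; omega)
  obtain ⟨ξ, hξT, hξ⟩ := exists_injOn_notMem p T₀ (by omega)
  have hlenI : ∀ b ∈ I, ((List.range B).flatMap (wd b)).length = m := fun b hb => by
    rw [← hbodyI b hb, hlen b (hIq b hb)]
  obtain ⟨Y, A, hAc, hAT, hAd, habs⟩ := exists_absorbing_frames p B hB (fun a => wd (en a))
    (fun a ha i hi => hslot _ (hen a ha).1 i hi) ξ T₀ (by omega) hV (by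
      refine le_trans ?_ hsize
      rw [Finset.sum_congr rfl fun a ha => hlenI _ (hen a (Finset.mem_range.1 ha)).1]
      rw [Finset.sum_const, Finset.card_range, smul_eq_mul]
      exact_mod_cast (by omega))
  have hAc' : ∀ a < p, (A a).card + B = m := fun a ha => by
    rw [hAc a ha, hlenI _ (hen a ha).1]
  have hAsum : ((range p).biUnion A).card + p * B = p * m := by
    rw [Finset.card_biUnion fun a ha b hb hab =>
      hAd a (Finset.mem_range.1 ha) b (Finset.mem_range.1 hb) hab]
    have : ∑ a ∈ range p, ((A a).card + B) = ∑ a ∈ range p, m :=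
      Finset.sum_congr rfl fun a ha => hAc' a (Finset.mem_range.1 ha)
    simpa [Finset.sum_add_distrib] using this
  set Z₁ : Finset V := T₀ ∪ ((range p).image ξ ∪ (range p).biUnion A) with hZ₁
  have hξc : ((range p).image ξ).card = p := by
    rw [Finset.card_image_of_injOn, Finset.card_range]
    intro a ha b hb h
    exact hξ a (by simpa using ha) b (by simpa using hb) h
  have hZ₁c : Z₁.card = T₀.card + (p + ((range p).biUnion A).card) := by
    rw [hZ₁, Finset.card_union_of_disjoint, Finset.card_union_of_disjoint, hξc]
    · rw [Finset.disjoint_left]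
      intro v hv hv'
      obtain ⟨a, ha, rfl⟩ := Finset.mem_image.1 hv
      obtain ⟨b, hb, hab⟩ := Finset.mem_biUnion.1 hv'
      exact (hAT b (Finset.mem_range.1 hb)).2 a (Finset.mem_range.1 ha) hab
    · rw [Finset.disjoint_left]
      intro v hv hv'
      rcases Finset.mem_union.1 hv' with hv' | hv'
      · obtain ⟨a, ha, rfl⟩ := Finset.mem_image.1 hv'
        exact hξT a (Finset.mem_range.1 ha) hv
      · obtain ⟨b, hb, hab⟩ := Finset.mem_biUnion.1 hv'
        exact Finset.disjoint_left.1 (hAT b (Finset.mem_range.1 hb)).1 hab hv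
  -- the last frame
  obtain ⟨xs, -, hxs⟩ : ∃ xs ∈ (univ : Finset V), xs ∉ Z₁ :=
    Finset.exists_mem_notMem_of_card_lt_card (by rw [Finset.card_univ]; omega)
  obtain ⟨ys, Ss, hSsd, hSst⟩ := exists_free_trail (R := stepRel G) (κ := κ)
    (fun s x => by
      cases s
      · exact le_trans (hG.inDeg_ge x) (by simp only [stepRel]; apply le_of_eq; congr!)
      · exact le_trans (hG.outDeg_ge x) (by simp only [stepRel]; apply le_of_eq; congr!))
    (body (q - 1)) xs (insert xs Z₁) (by
      have h1 : ((insert xs Z₁).card : ℝ) ≤ Z₁.card + 1 := card_insert_le_cast xs Z₁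
      have h2 : ((Z₁.card + 1 + (m + e) : ℕ) : ℝ) ≤ μ / 4 * Fintype.card V :=
        le_trans (by exact_mod_cast (by omega)) hsize
      rw [hlast]
      push_cast at h2 ⊢
      nlinarith)
  have hSsc : Ss.card = m + e := by rw [hSst.card_eq, hlast]
  rw [Finset.disjoint_insert_right] at hSsd
  set Z₀ : Finset V := Z₁ ∪ insert xs Ss with hZ₀
  have hZ₀d : Disjoint Z₁ (insert xs Ss) := by
    rw [Finset.disjoint_insert_right]
    exact ⟨hxs, hSsd.2.symm⟩
  have hZ₀c : Z₀.card = Z₁.card + (m + e + 1) := by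
    rw [hZ₀, Finset.card_union_of_disjoint hZ₀d, Finset.card_insert_of_notMem hSsd.1, hSsc]
  -- connectors
  obtain ⟨D, hD, hDD, hDt⟩ := exists_connector_family hG hμ hμκ hκ1 hL hL1 hC hVq Z₀ (by
    have h2 : ((Z₀.card + C * q * (L + 1) + L + 5 : ℕ) : ℝ) ≤ μ / 4 * Fintype.card V :=
      le_trans (by exact_mod_cast (by omega)) hsize
    push_cast at h2
    nlinarith)
  have hDsum : ((range (C * q)).biUnion D).card = C * q * (L + 1) := by
    rw [Finset.card_biUnion fun a ha b hb hab =>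
      hDD a (Finset.mem_range.1 ha) b (Finset.mem_range.1 hb) hab,
      Finset.sum_congr rfl fun a ha => (hD a (Finset.mem_range.1 ha)).2]
    simp
  have hZD : Disjoint Z₀ ((range (C * q)).biUnion D) := by
    rw [Finset.disjoint_biUnion_right]
    exact fun j hj => (hD j (Finset.mem_range.1 hj)).1.symm
  set U : Finset V := (Z₀ ∪ (range (C * q)).biUnion D)ᶜ with hU
  have hUc : Uᶜ.card = Z₀.card + C * q * (L + 1) := by
    rw [hU, compl_compl, Finset.card_union_of_disjoint hZD, hDsum]
  have hUU := Finset.card_add_card_compl U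
  -- the remaining frames
  have hqm : q * (m + L + 2) = q * (m + 1) + q * (L + 1) := by ring
  have hqN : q * (m + 1) = N * (m + 1) + p * (m + 1) + (m + 1) := by rw [← hN]; ring
  have hpm : p * (m + 1) = p * m + p := by ring
  have hcount : N * (m + 1) + q ≤ U.card := by
    have : q ≤ q * (L + 1) := Nat.le_mul_of_pos_right q (by omega)
    omega
  obtain ⟨x', y', S', hS', hSd'⟩ := hcov V G κ μ hG hdeg U (by
      have h2 : ((Uᶜ.card + r : ℕ) : ℝ) ≤ μ / 4 * Fintype.card V :=
        le_trans (by exact_mod_cast (by omega)) hsize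
      push_cast at h2
      nlinarith) (by
      have h2 : ((4 * Uᶜ.card : ℕ) : ℝ) ≤ Fintype.card V := by
        have : ((Uᶜ.card : ℕ) : ℝ) ≤ μ / 4 * Fintype.card V :=
          le_trans (by exact_mod_cast (by omega)) hsize
        push_cast
        nlinarith
      have h3 : 4 * Uᶜ.card ≤ Fintype.card V := by exact_mod_cast h2
      omega) N (fun a => body (en' a)) (fun a ha => hlen _ (by
        have := (hen' a ha).1
        exact Finset.mem_range.1 (Finset.mem_sdiff.1 this).1)) (by
      have h1 : ((N * (m + 1) + q : ℕ) : ℝ) ≤ U.card := by exact_mod_cast hcount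
      have h2 : 1 / (2 * ((m + L + 2 : ℕ) : ℝ)) * U.card ≤ q := by
        rw [one_div, inv_mul_le_iff₀ hF]
        have h3 : U.card ≤ 2 * (m + L + 2) * q := by
          have : q * (m + L + 2) = (m + L + 2) * q := mul_comm _ _
          have h4 : m + L + 2 ≤ (m + L + 2) * q := Nat.le_mul_of_pos_right _ hq
          have h5 : 2 * (m + L + 2) * q = (m + L + 2) * q + (m + L + 2) * q := by ring
          omega
        exact_mod_cast h3
      push_cast at h1 h2 ⊢
      linarith)
  have hUZ : ∀ {S : Finset V}, S ⊆ U → Disjoint S Z₁ ∧ Disjoint S (insert xs Ss) ∧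
      ∀ j < C * q, Disjoint S (D j) := by
    intro S hS
    have h1 : Disjoint S (Z₀ ∪ (range (C * q)).biUnion D) := by
      rw [← Finset.subset_compl_iff_disjoint_right]
      exact hS
    rw [Finset.disjoint_union_right, hZ₀, Finset.disjoint_union_right] at h1
    exact ⟨h1.1.1, h1.1.2, fun j hj => h1.2.mono_right
      (Finset.subset_biUnion_of_mem D (Finset.mem_range.2 hj))⟩
  have hZ₁E : ∀ a < p, insert (ξ a) (A a) ⊆ Z₁ := by
    intro a ha v hv
    rcases Finset.mem_insert.1 hv with rfl | hv
    · exact Finset.mem_union_right _ (Finset.mem_union_left _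
        (Finset.mem_image_of_mem _ (Finset.mem_range.2 ha)))
    · exact Finset.mem_union_right _ (Finset.mem_union_right _
        (Finset.mem_biUnion.2 ⟨a, Finset.mem_range.2 ha, hv⟩))
  have hclass : ∀ b < q, b ∈ I ∨ (b ∉ I ∧ b = q - 1) ∨
      (b ∉ I ∧ b ≠ q - 1 ∧ b ∈ range (q - 1) \ I) := by
    intro b hb
    by_cases h1 : b ∈ I
    · exact Or.inl h1
    · by_cases h2 : b = q - 1
      · exact Or.inr (Or.inl ⟨h1, h2⟩)
      · exact Or.inr (Or.inr ⟨h1, h2, Finset.mem_sdiff.2 ⟨Finset.mem_range.2 (by omega), h1⟩⟩)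
  have hq1 : q - 1 ∉ I := fun h => lt_irrefl _ (hIq _ h)
  set x : ℕ → V := fun b => if b ∈ I then ξ (rk b) else if b = q - 1 then xs else x' (rk' b) with hx
  set y : ℕ → V := fun b => if b ∈ I then Y (rk b) else if b = q - 1 then ys else y' (rk' b) with hy
  set S : ℕ → Finset V :=
    fun b => if b ∈ I then A (rk b) else if b = q - 1 then Ss else S' (rk' b) with hS
  have hxI : ∀ b ∈ I, x b = ξ (rk b) ∧ y b = Y (rk b) ∧ S b = A (rk b) := fun b hb => by
    simp [hx, hy, hS, hb]
  have hxq : x (q - 1) = xs ∧ y (q - 1) = ys ∧ S (q - 1) = Ss := by simp [hx, hy, hS, hq1]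
  have hxN : ∀ b, b ∉ I → b ≠ q - 1 → x b = x' (rk' b) ∧ y b = y' (rk' b) ∧ S b = S' (rk' b) :=
    fun b h1 h2 => by simp [hx, hy, hS, h1, h2]
  have hEZ₁ : ∀ b ∈ I, insert (x b) (S b) ⊆ Z₁ := fun b hb => by
    rw [(hxI b hb).1, (hxI b hb).2.2]
    exact hZ₁E _ (hrk b hb).1
  have hEU : ∀ b, b ∉ I → b ≠ q - 1 → b ∈ range (q - 1) \ I → insert (x b) (S b) ⊆ U :=
    fun b h1 h2 h3 => by
      rw [(hxN b h1 h2).1, (hxN b h1 h2).2.2]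
      exact (hS' _ (hrk' b h3).1).1
  have hξA : ∀ a < p, ∀ b < p, a ≠ b →
      Disjoint (insert (ξ a) (A a)) (insert (ξ b) (A b)) := by
    intro a ha b hb hab
    simp only [Finset.disjoint_insert_left, Finset.disjoint_insert_right, Finset.mem_insert, not_or]
    exact ⟨⟨fun h => hab (hξ a ha b hb h.symm), (hAT a ha).2 b hb⟩, (hAT b hb).2 a ha,
      hAd a ha b hb hab⟩
  have hE : ∀ b < q, ∀ b' < q, b ≠ b' → Disjoint (insert (x b) (S b)) (insert (x b') (S b')) := by
    have hE' : ∀ b < q, ∀ b' < q, b ≠ b' → b ∈ I →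
        Disjoint (insert (x b) (S b)) (insert (x b') (S b')) := by
      intro b hb b' hb' hne hI1
      rcases hclass b' hb' with h | ⟨h, rfl⟩ | ⟨h1, h2, h3⟩
      · rw [(hxI b hI1).1, (hxI b hI1).2.2, (hxI b' h).1, (hxI b' h).2.2]
        refine hξA _ (hrk b hI1).1 _ (hrk b' h).1 fun hr => hne ?_
        rw [← (hrk b hI1).2, hr, (hrk b' h).2]
      · rw [hxq.1, hxq.2.2]
        exact hZ₀d.mono_left (hEZ₁ b hI1)
      · exact (hUZ (hEU b' h1 h2 h3)).1.symm.mono_left (hEZ₁ b hI1)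
    intro b hb b' hb' hne
    rcases hclass b hb with h | ⟨h, rfl⟩ | ⟨h1, h2, h3⟩
    · exact hE' b hb b' hb' hne h
    · rcases hclass b' hb' with h' | ⟨h', rfl⟩ | ⟨h1', h2', h3'⟩
      · exact (hE' b' hb' _ hb hne.symm h').symm
      · exact absurd rfl hne
      · rw [hxq.1, hxq.2.2]
        exact (hUZ (hEU b' h1' h2' h3')).2.1.symm
    · rcases hclass b' hb' with h' | ⟨h', rfl⟩ | ⟨h1', h2', h3'⟩
      · exact (hE' b' hb' _ hb hne.symm h').symm
      · rw [hxq.1, hxq.2.2]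
        exact (hUZ (hEU b h1 h2 h3)).2.1
      · rw [(hxN b h1 h2).1, (hxN b h1 h2).2.2, (hxN b' h1' h2').1, (hxN b' h1' h2').2.2]
        refine hSd' _ (hrk' b h3).1 _ (hrk' b' h3').1 fun hr => hne ?_
        rw [← (hrk' b h3).2, hr, (hrk' b' h3').2]
  have hTZ : T₀ ⊆ Z₁ := Finset.subset_union_left
  have hDZ : ∀ j < C * q, Disjoint Z₁ (D j) ∧ Disjoint (insert xs Ss) (D j) := fun j hj => by
    have := (hD j hj).1.symm
    rwa [hZ₀, Finset.disjoint_union_left] at this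
  refine exists_closed_trail (M := C * q) (I := I) (B := B) (x := x) (y := y) (S := S) (D := D)
    (T₀ := T₀) (hI.trans (Finset.range_subset_range.2 (by omega))) conn body hconn ?_
    (fun b hb => ?_) (fun b hb => ?_) hE (fun b hb => ?_) (fun b hb j hj => ?_)
    (fun j hj => (hDZ j hj).1.symm.mono_right hTZ) (fun j hj => (hD j hj).2) hDD hDt
    (fun b hb hbI => ?_) (fun T hT hTc hTd => ?_)
  · obtain ⟨q, rfl⟩ : ∃ q', q = q' + 1 := ⟨q - 1, by omega⟩
    rw [Nat.add_sub_cancel] at hlen hlast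
    rw [Finset.sum_range_succ, hconn q (by omega), hlast, Finset.sum_congr rfl fun b hb => by
      rw [hconn b (by have := Finset.mem_range.1 hb; omega), hlen b (Finset.mem_range.1 hb)]]
    rw [Finset.sum_const, Finset.card_range, smul_eq_mul, hcard]
    ring
  · rcases hclass b hb with h | ⟨h, rfl⟩ | ⟨h1, h2, h3⟩
    · rw [(hxI b h).2.2, if_pos h, hlen b (hIq b h)]
      exact hAc' _ (hrk b h).1
    · rw [hxq.2.2, if_neg h, hlast, hSsc, add_zero]
    · rw [(hxN b h1 h2).2.2, if_neg h1, hlen b (Finset.mem_range.1 (Finset.mem_sdiff.1 h3).1),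
        (hS' _ (hrk' b h3).1).2.2.card_eq]
      simp only [(hrk' b h3).2]
      rw [hlen b (Finset.mem_range.1 (Finset.mem_sdiff.1 h3).1), add_zero]
  · rcases hclass b hb with h | ⟨h, rfl⟩ | ⟨h1, h2, h3⟩
    · rw [(hxI b h).1, (hxI b h).2.2]
      exact (hAT _ (hrk b h).1).2 _ (hrk b h).1
    · rw [hxq.1, hxq.2.2]
      exact hSsd.1
    · rw [(hxN b h1 h2).1, (hxN b h1 h2).2.2]
      exact (hS' _ (hrk' b h3).1).2.1
  · rcases hclass b hb with h | ⟨h, rfl⟩ | ⟨h1, h2, h3⟩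
    · rw [(hxI b h).1, (hxI b h).2.2, Finset.disjoint_insert_left]
      exact ⟨hξT _ (hrk b h).1, (hAT _ (hrk b h).1).1⟩
    · rw [hxq.1, hxq.2.2]
      exact hZ₀d.symm.mono_right hTZ
    · exact (hUZ (hEU b h1 h2 h3)).1.mono_right hTZ
  · rcases hclass b hb with h | ⟨h, rfl⟩ | ⟨h1, h2, h3⟩
    · exact (hDZ j hj).1.mono_left (hEZ₁ b h)
    · rw [hxq.1, hxq.2.2]
      exact (hDZ j hj).2
    · exact (hUZ (hEU b h1 h2 h3)).2.2 j hj
  · rcases hclass b hb with h | ⟨h, rfl⟩ | ⟨h1, h2, h3⟩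
    · exact absurd h hbI
    · rw [hxq.1, hxq.2.1, hxq.2.2]
      exact hSst
    · rw [(hxN b h1 h2).1, (hxN b h1 h2).2.1, (hxN b h1 h2).2.2]
      have := (hS' _ (hrk' b h3).1).2.2
      simpa only [(hrk' b h3).2] using this
  · obtain ⟨τ, h1, h2, h3⟩ := habs T hT (by rw [hTc, hp]) fun a ha => by
      have := hTd _ (hen a ha).1
      rwa [(hxI _ (hen a ha).1).2.2, (hen a ha).2] at this
    refine ⟨fun b => τ (rk b), fun b hb => h1 _ (hrk b hb).1, fun b hb b' hb' hne =>
      h2 _ (hrk b hb).1 _ (hrk b' hb').1 fun hr => hne ?_, fun b hb => ?_⟩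
    · rw [← (hrk b hb).2, hr, (hrk b' hb').2]
    · rw [(hxI b hb).1, (hxI b hb).2.1, (hxI b hb).2.2, hbodyI b hb]
      have := h3 _ (hrk b hb).1
      rwa [(hrk b hb).2] at this

theorem flatMap_seg (c : ℕ → Bool) (F k : ℕ) :
    ((List.range k).flatMap fun b => seg c (b * F) F) = seg c 0 (k * F) := by
  induction k with
  | zero => simp [seg]
  | succ k ih =>
    rw [List.range_succ, List.flatMap_append, ih, Nat.add_mul, Nat.one_mul, seg_add, Nat.zero_add]
    simp

theorem exists_mul_sq_le_two_pow (K : ℕ) : ∃ q₀ : ℕ, ∀ q ≥ q₀, (q + 1) ^ 2 * K ≤ 2 ^ q := by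
  have h := tendsto_pow_const_div_const_pow_of_one_lt 2 (r := (2 : ℝ)) (by norm_num)
  have h1 := h.eventually (gt_mem_nhds (show (0 : ℝ) < 1 / (4 * K + 1) by positivity))
  obtain ⟨q₀, hq₀⟩ := Filter.eventually_atTop.1 h1
  refine ⟨q₀ + 1, fun q hq => ?_⟩
  have h2 := hq₀ q (by omega)
  rw [div_lt_div_iff₀ (by positivity) (by positivity), one_mul] at h2
  have h3 : (q : ℝ) ^ 2 * (4 * K + 1) = ((q ^ 2 * (4 * K + 1) : ℕ) : ℝ) := by push_cast; ring
  have h4 : q ^ 2 * (4 * K + 1) < 2 ^ q := by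
    rw [h3] at h2
    exact_mod_cast h2
  have h5 : (q + 1) ^ 2 ≤ 4 * q ^ 2 := by nlinarith
  nlinarith [Nat.mul_le_mul_right K h5]

set_option maxHeartbeats 1000000 in
/-- Cut a word into frames of constant length. If a positive proportion of the frames have bodies
that split into slottable words, then there is a closed spanning trail following the word. -/
theorem exists_spanning_trail_of_frames {κ μ lam : ℝ} {L : ℕ} (hμ : 0 < μ) (hμκ : μ ≤ κ)
    (hκ1 : κ ≤ 1) (hL : 1 ≤ κ + μ * (L - 1)) (hL1 : 1 ≤ L) (hlam : 0 < lam) :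
    ∃ B m₀ : ℕ, 0 < B ∧ ∀ m ≥ m₀, ∃ n₀ : ℕ, ∀ (V : Type) [Fintype V] (G : V → V → Prop),
      n₀ ≤ Fintype.card V → Expander G κ μ →
      (∀ x, (κ + μ) * Fintype.card V ≤ (univ.filter fun z => G x z).card) →
      ∀ (c : ℕ → Bool) (q : ℕ) (I : Finset ℕ), q = Fintype.card V / (m + L + 2) →
      I ⊆ range (q - 1) → lam * q ≤ I.card →
      (∀ b ∈ I, ∃ w : ℕ → List Bool,
        seg c (b * (m + L + 2) + (L + 2)) m = (List.range B).flatMap w ∧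
        ∀ i < B, Slottable G (1 / 2 ^ 9) (μ / 4) (w i)) →
      ∃ (v : V) (Z : Finset V), Trail (stepRel G) (seg c 0 (Fintype.card V)) v v Z := by
  have hκ : 0 < κ := hμ.trans_le hμκ
  have hμ1 : μ ≤ 1 := hμκ.trans hκ1
  obtain ⟨C, hC⟩ : ∃ C : ℕ, (1 - 1 / 2 ^ L * (κ / 2) ^ 2 / 2) ^ C ≤ 1 / 4 := by
    obtain ⟨C, hC⟩ := exists_pow_lt_of_lt_one (show (0 : ℝ) < 1 / 4 by norm_num)
      (show 1 - 1 / 2 ^ L * (κ / 2) ^ 2 / 2 < 1 by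
        have : 0 < 1 / 2 ^ L * (κ / 2) ^ 2 / 2 := by positivity
        linarith)
    exact ⟨C, hC.le⟩
  have hC1 : 1 ≤ C := by
    rcases Nat.eq_zero_or_pos C with rfl | h
    · norm_num at hC
    · exact h
  set lam' := min lam (μ / 48) with hlam'
  have hl0 : 0 < lam' := lt_min hlam (by positivity)
  set B := ⌈4 * C * (L + 1) / lam'⌉₊ + 1 with hB
  have hBl : 4 * C * (L + 1) ≤ lam' * B := by
    have h1 : 4 * C * (L + 1) / lam' ≤ B := by
      refine (Nat.le_ceil _).trans ?_
      rw [hB]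
      push_cast
      linarith
    rwa [div_le_iff₀' hl0] at h1
  refine ⟨B, max B ⌈16 * C * (L + 1) / μ⌉₊, by omega, fun m hm => ?_⟩
  have hmB : B ≤ m := (le_max_left _ _).trans hm
  have hmC : 16 * C * (L + 1) ≤ μ * m := by
    have h1 : 16 * C * (L + 1) / μ ≤ m := (Nat.le_ceil _).trans
      (by exact_mod_cast (le_max_right _ _).trans hm)
    rwa [div_le_iff₀' hμ] at h1
  set F := m + L + 2 with hF
  obtain ⟨r, w₀, main⟩ := exists_spanning_trail_of_slottable C B m hL1 (by omega) hmB
  obtain ⟨q₀, hq₀⟩ := exists_mul_sq_le_two_pow (F ^ 2 * 2 ^ (L + 2))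
  refine ⟨F * (q₀ + ⌈2 / lam'⌉₊ + 2) + 2 * w₀ + ⌈64 * (3 * F + L + 5 + r) / μ⌉₊,
    fun V _ G hn hG hdeg c q I hq hI hIc hw => ?_⟩
  choose! wd hwd hslot using hw
  have hF0 : 0 < F := by omega
  have hdiv : Fintype.card V = q * F + Fintype.card V % F := by
    rw [hq, Nat.mul_comm, Nat.div_add_mod]
  have hmod := Nat.mod_lt (Fintype.card V) hF0
  set e := Fintype.card V % F with he
  have hq1 : q₀ + ⌈2 / lam'⌉₊ + 2 ≤ q := by
    rw [hq, Nat.le_div_iff_mul_le hF0, Nat.mul_comm]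
    omega
  have hq2 : 2 ≤ lam' * q := by
    have h1 : 2 / lam' ≤ q := (Nat.le_ceil _).trans (by exact_mod_cast (by omega))
    rwa [div_le_iff₀' hl0] at h1
  set p := ⌊lam' * q⌋₊ with hp
  have hp1 : (p : ℝ) ≤ lam' * q := Nat.floor_le (by positivity)
  have hp2 : lam' * q / 2 ≤ p := by
    have := Nat.lt_floor_add_one (lam' * q)
    rw [← hp] at this
    linarith
  have hpI : p ≤ I.card := by
    have h1 : lam' * q ≤ lam * q := by
      have := min_le_left lam (μ / 48)
      gcongr
    exact_mod_cast hp1.trans (h1.trans hIc)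
  obtain ⟨I', hI', hI'c⟩ := Finset.exists_subset_card_eq hpI
  have hnF : (q : ℝ) * F ≤ Fintype.card V := by
    rw [hdiv]
    push_cast
    linarith [(Nat.cast_nonneg e : (0 : ℝ) ≤ e)]
  have hpB : 2 * (C * q * (L + 1)) ≤ p * B := by
    have h1 : (2 * (C * q * (L + 1)) : ℝ) ≤ p * B := by
      have h2 : lam' * q / 2 * B ≤ p * B := by gcongr
      have h3 : 4 * C * (L + 1) * q ≤ lam' * B * q := by gcongr
      nlinarith
    exact_mod_cast h1
  have hVq : Fintype.card V * Fintype.card V * 2 ^ (L + 2) ≤ 2 ^ q := by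
    refine le_trans ?_ (hq₀ q (by omega))
    have h1 : Fintype.card V ≤ (q + 1) * F := by
      rw [Nat.add_mul, Nat.one_mul]
      omega
    calc Fintype.card V * Fintype.card V * 2 ^ (L + 2)
        ≤ ((q + 1) * F) * ((q + 1) * F) * 2 ^ (L + 2) := by gcongr
      _ = (q + 1) ^ 2 * (F ^ 2 * 2 ^ (L + 2)) := by ring
  have hnpos : 0 < Fintype.card V := by
    have : 0 < q * F := Nat.mul_pos (by omega) hF0
    omega
  have hVB : Fintype.card V ≤ 2 ^ (p * B) := by
    have h1 : q ≤ p * B := by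
      refine le_trans ?_ hpB
      have h2 : q ≤ C * q := Nat.le_mul_of_pos_left q hC1
      have h3 : C * q ≤ C * q * (L + 1) := Nat.le_mul_of_pos_right _ (by omega)
      omega
    have h2 : Fintype.card V ≤ Fintype.card V * Fintype.card V * 2 ^ (L + 2) := by
      rw [Nat.mul_assoc]
      exact Nat.le_mul_of_pos_right _ (by positivity)
    exact (h2.trans hVq).trans (Nat.pow_le_pow_right (by norm_num) h1)
  have hsize : ((3 * p * F + 3 * F + C * q * (L + 1) + L + 5 + r : ℕ) : ℝ) ≤
      μ / 4 * Fintype.card V := by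
    have h1 : (3 * p * F : ℝ) ≤ μ / 16 * Fintype.card V := by
      have h2 : lam' ≤ μ / 48 := min_le_right _ _
      have h3 : (p : ℝ) ≤ μ / 48 * q := hp1.trans (by gcongr)
      have h4 : (p : ℝ) * F ≤ μ / 48 * q * F := by gcongr
      nlinarith
    have h2 : (C * q * (L + 1) : ℝ) ≤ μ / 16 * Fintype.card V := by
      have h3 : 16 * C * (L + 1) ≤ μ * F := hmC.trans (by
        have : (m : ℝ) ≤ F := by exact_mod_cast (by omega)
        gcongr)
      have h4 : 16 * C * (L + 1) * q ≤ μ * F * q := by gcongr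
      nlinarith
    have h3 : (64 * (3 * F + L + 5 + r) : ℝ) ≤ μ * Fintype.card V := by
      have h4 : 64 * (3 * F + L + 5 + r) / μ ≤ Fintype.card V := (Nat.le_ceil _).trans
        (Nat.cast_le.2 (by omega))
      rwa [div_le_iff₀' hμ] at h4
    push_cast
    linarith [mul_pos hμ (show (0 : ℝ) < Fintype.card V by exact_mod_cast hnpos)]
  obtain ⟨v, Z, h⟩ := main V G κ μ hG hdeg hμ hμκ hκ1 hL hC q e p I'
    (fun b => seg c (b * F) (L + 2))
    (fun b => seg c (b * F + (L + 2)) (if b = q - 1 then m + e else m)) wd (by omega) hmod hdiv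
    (hI'.trans hI) hI'c (fun b _ => by simp) (fun b hb => by simp [hb.ne]) (by simp)
    (fun b hb => by
      rw [if_neg (Finset.mem_range.1 (hI (hI' hb))).ne]
      exact hwd b (hI' hb))
    (fun b hb => hslot b (hI' hb)) hpB hVB hVq hsize (by omega)
  refine ⟨v, Z, ?_⟩
  convert h using 1
  obtain ⟨k, rfl⟩ : ∃ k, q = k + 1 := ⟨q - 1, by omega⟩
  rw [List.range_succ, List.flatMap_append, hdiv,
    show (k + 1) * F + e = k * F + (L + 2 + (m + e)) by
    rw [hF]; ring, seg_add, ← flatMap_seg, seg_add, Nat.zero_add]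
  congr 1
  · refine List.flatMap_congr fun b hb => ?_
    rw [Nat.add_sub_cancel, if_neg (List.mem_range.1 hb).ne, ← seg_add, hF]
    congr 1
    omega
  · simp

theorem seg_eq_replicate (c : ℕ → Bool) (a m : ℕ)
    (h : ∀ i, i + 1 < m → c (a + i) = c (a + i + 1)) : seg c a m = List.replicate m (c a) := by
  induction m generalizing a with
  | zero => rfl
  | succ m ih =>
    rw [seg, List.replicate_succ, ih (a + 1) fun i hi => by
      have := h (i + 1) (by omega)
      rwa [show a + 1 + i = a + (i + 1) by omega]]
    rcases Nat.eq_zero_or_pos m with rfl | hm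
    · rfl
    · rw [show c a = c (a + 1) from h 0 (by omega)]

/-- A word with many occurrences of `[s, !s]` contains many such that are far apart. -/
theorem seg_eq_sinkWord_append (c : ℕ → Bool) (s : Bool) (L k a w : ℕ)
    (h : k * (L + 2) ≤
      ((Finset.Ico a (a + w - 1)).filter fun i => c i = s ∧ c (i + 1) = !s).card) :
    ∃ ls tail, seg c a w = sinkWord s ls ++ tail ∧ ls.length = k ∧ ∀ l ∈ ls, L ≤ l.length := by
  induction k generalizing a w with
  | zero => exact ⟨[], seg c a w, rfl, rfl, by simp⟩
  | succ k ih =>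
    set P : ℕ → Prop := fun i => c i = s ∧ c (i + 1) = !s with hP
    have hex : ∃ i, a + L ≤ i ∧ i < a + w - 1 ∧ P i := by
      by_contra! hcon
      have h1 : (Finset.Ico a (a + w - 1)).filter P ⊆ Finset.Ico a (a + L) := by
        intro i hi
        rw [Finset.mem_filter, Finset.mem_Ico] at hi
        rw [Finset.mem_Ico]
        by_contra hi'
        exact hcon i (by omega) hi.1.2 hi.2
      have h2 := (h.trans (Finset.card_le_card h1))
      rw [Nat.card_Ico, Nat.add_mul] at h2
      omega
    have hmin := fun j => @Nat.find_min _ _ hex j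
    obtain ⟨h1, h2, h3⟩ := Nat.find_spec hex
    set i := Nat.find hex with hi
    obtain ⟨r, hr⟩ : ∃ r, a + w = i + 2 + r := ⟨a + w - (i + 2), by omega⟩
    obtain ⟨ls, tail, e1, e2, e3⟩ := ih (i + 2) r (by
      have hsub : (Finset.Ico a (a + w - 1)).filter P ⊆
          ((Finset.Ico (i + 2) (i + 2 + r - 1)).filter P ∪ Finset.Ico a (a + L)) ∪
            Finset.Ico i (i + 2) := by
        intro j hj
        simp only [Finset.mem_union, Finset.mem_filter, Finset.mem_Ico] at hj ⊢
        by_cases hj1 : j < a + L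
        · omega
        · have : ¬ j < i := fun hlt => hmin j hlt ⟨by omega, hj.1.2, hj.2⟩
          by_cases hj2 : i + 2 ≤ j
          · exact Or.inl (Or.inl ⟨⟨hj2, by omega⟩, hj.2⟩)
          · omega
      have h4 := h.trans (Finset.card_le_card hsub)
      have h5 := Finset.card_union_le
        ((Finset.Ico (i + 2) (i + 2 + r - 1)).filter P ∪ Finset.Ico a (a + L))
        (Finset.Ico i (i + 2))
      have h6 := Finset.card_union_le
        ((Finset.Ico (i + 2) (i + 2 + r - 1)).filter P) (Finset.Ico a (a + L))
      rw [Nat.card_Ico] at h5 h6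
      rw [Nat.add_mul] at h4
      have h7 : k * (L + 2) ≤ ((Finset.Ico (i + 2) (i + 2 + r - 1)).filter P).card := by omega
      convert h7)
    refine ⟨seg c a (i - a) :: ls, tail, ?_, by simp [e2], ?_⟩
    · rw [show w = (i - a) + (2 + r) by omega, seg_add, show a + (i - a) = i by omega, seg_add, e1]
      simp [seg, sinkWord, h3.1, h3.2]
    · intro l hl
      rcases List.mem_cons.1 hl with rfl | hl
      · simp only [seg_length]
        omega
      · exact e3 l hl

/-- Splitting a sequence of words into consecutive blocks. -/
theorem exists_flatMap_eq_of_length {α : Type*} (ls : List α) (B R : ℕ) (h : ls.length = B * R) :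
    ∃ ch : ℕ → List α, ls = (List.range B).flatMap ch ∧ (∀ i < B, (ch i).length = R) ∧
      ∀ i, ∀ l ∈ ch i, l ∈ ls := by
  have key : ∀ k, (List.range k).flatMap (fun i => (ls.drop (i * R)).take R) = ls.take (k * R) := by
    intro k
    induction k with
    | zero => simp
    | succ k ih =>
      rw [List.range_succ, List.flatMap_append, ih, Nat.add_mul, Nat.one_mul, List.take_add]
      simp
  refine ⟨fun i => (ls.drop (i * R)).take R, ?_, fun i hi => ?_, fun i l hl => ?_⟩
  · rw [key, List.take_of_length_le h.le]
  · have : (i + 1) * R ≤ B * R := Nat.mul_le_mul_right R hi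
    rw [Nat.add_mul] at this
    rw [List.length_take, List.length_drop, h]
    omega
  · exact List.mem_of_mem_drop (List.mem_of_mem_take hl)

theorem flatMap_append_last {α : Type*} (B : ℕ) (hB : 0 < B) (f : ℕ → List α) (t : List α) :
    (List.range B).flatMap f ++ t =
      (List.range B).flatMap fun i => f i ++ if i = B - 1 then t else [] := by
  obtain ⟨k, rfl⟩ : ∃ k, B = k + 1 := ⟨B - 1, by omega⟩
  rw [List.range_succ, List.flatMap_append, List.flatMap_append, List.append_assoc]
  congr 1
  · refine List.flatMap_congr fun b hb => ?_
    have := List.mem_range.1 hb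
    rw [if_neg (by omega), List.append_nil]
  · simp

/-- If many frames contain a sign change then there are many sign changes of the same kind. -/
theorem exists_card_le_two_mul_card_sinks (c : ℕ → Bool) {F o m : ℕ} (hF : o + m ≤ F) (q : ℕ)
    (J : Finset ℕ) (hJ : J ⊆ range q)
    (h : ∀ b ∈ J, ∃ i, i + 1 < m ∧ c (b * F + o + i) ≠ c (b * F + o + i + 1)) :
    ∃ s, J.card ≤ 2 * ((range (q * F)).filter fun i => c i = s ∧ c (i + 1) = !s).card := by
  choose! f hf hfc using h
  have hdiv : ∀ b ∈ J, (b * F + o + f b) / F = b := fun b hb => by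
    have := hf b hb
    rw [Nat.add_assoc, Nat.add_comm, Nat.add_mul_div_right _ _ (by omega),
      Nat.div_eq_of_lt (by omega), Nat.zero_add]
  have h1 : J.card ≤ ((range (q * F)).filter fun i => c i ≠ c (i + 1)).card := by
    refine Finset.card_le_card_of_injOn (fun b => b * F + o + f b) (fun b hb => ?_)
      fun b hb b' hb' hbb => ?_
    · have h2 := hf b hb
      have h3 : (b + 1) * F ≤ q * F := Nat.mul_le_mul_right F (Finset.mem_range.1 (hJ hb))
      rw [Nat.add_mul] at h3
      simp only [Finset.coe_filter, Finset.mem_range]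
      exact ⟨by omega, hfc b hb⟩
    · rw [← hdiv b hb, ← hdiv b' hb']
      exact congrArg (· / F) hbb
  have h2 : ((range (q * F)).filter fun i => c i ≠ c (i + 1)) ⊆
      ((range (q * F)).filter fun i => c i = true ∧ c (i + 1) = !true) ∪
        ((range (q * F)).filter fun i => c i = false ∧ c (i + 1) = !false) := by
    intro i hi
    simp only [Finset.mem_union, Finset.mem_filter] at hi ⊢
    cases h3 : c i <;> cases h4 : c (i + 1) <;> simp_all
  have h3 := (h1.trans (Finset.card_le_card h2)).trans (Finset.card_union_le _ _)
  by_contra! hcon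
  have h4 := hcon true
  have h5 := hcon false
  omega

/-- Positions of a given kind are spread over many frames. -/
theorem card_filter_le_of_frames (P : ℕ → Prop) (q o m X : ℕ) :
    ((range (q * (m + o))).filter P).card ≤ q * (o + 1 + X) +
      ((range q).filter fun b => X ≤ ((Finset.Ico (b * (m + o) + o)
        (b * (m + o) + o + m - 1)).filter P).card).card * (m + o) := by
  have h1 : (range (q * (m + o))).filter P ⊆ (range q).biUnion fun b =>
      (Finset.Ico (b * (m + o)) (b * (m + o) + (m + o))).filter P := by
    intro i hi
    rw [Finset.mem_filter, Finset.mem_range] at hi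
    have hF : 0 < m + o := Nat.pos_of_ne_zero fun h => by
      rw [h] at hi
      omega
    refine Finset.mem_biUnion.2 ⟨i / (m + o), Finset.mem_range.2
      ((Nat.div_lt_iff_lt_mul hF).2 hi.1), Finset.mem_filter.2 ⟨Finset.mem_Ico.2 ⟨?_, ?_⟩, hi.2⟩⟩
    · exact Nat.div_mul_le_self i (m + o)
    · have := Nat.div_add_mod i (m + o)
      have h2 := Nat.mod_lt i hF
      rw [Nat.mul_comm] at this
      omega
  have h2 := (Finset.card_le_card h1).trans Finset.card_biUnion_le
  refine h2.trans ?_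
  rw [Finset.card_filter, Finset.sum_mul]
  have h3 : q * (o + 1 + X) = ∑ b ∈ range q, (o + 1 + X) := by simp
  rw [h3, ← Finset.sum_add_distrib]
  refine Finset.sum_le_sum fun b _ => ?_
  have h4 : (Finset.Ico (b * (m + o)) (b * (m + o) + (m + o))).filter P ⊆
      (Finset.Ico (b * (m + o)) (b * (m + o) + o) ∪
        Finset.Ico (b * (m + o) + o + m - 1) (b * (m + o) + o + m)) ∪
      (Finset.Ico (b * (m + o) + o) (b * (m + o) + o + m - 1)).filter P := by
    intro i hi
    simp only [Finset.mem_union, Finset.mem_filter, Finset.mem_Ico] at hi ⊢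
    by_cases h5 : i < b * (m + o) + o
    · exact Or.inl (Or.inl ⟨hi.1.1, h5⟩)
    · by_cases h6 : i < b * (m + o) + o + m - 1
      · exact Or.inr ⟨⟨by omega, h6⟩, hi.2⟩
      · exact Or.inl (Or.inr ⟨by omega, by omega⟩)
  have h5 := (Finset.card_le_card h4).trans (Finset.card_union_le _ _)
  have h6 := Finset.card_union_le (Finset.Ico (b * (m + o)) (b * (m + o) + o))
    (Finset.Ico (b * (m + o) + o + m - 1) (b * (m + o) + o + m))
  rw [Nat.card_Ico, Nat.card_Ico] at h6
  by_cases h7 : X ≤ ((Finset.Ico (b * (m + o) + o) (b * (m + o) + o + m - 1)).filter P).card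
  · rw [if_pos h7, Nat.one_mul]
    have h8 := Finset.card_filter_le (Finset.Ico (b * (m + o)) (b * (m + o) + (m + o))) P
    rw [Nat.card_Ico] at h8
    omega
  · rw [if_neg h7]
    omega

theorem replicate_eq_flatMap {α : Type*} (a : α) (B K m : ℕ) (hB : 0 < B) (h : B * K ≤ m) :
    ∃ k : ℕ → ℕ, (∀ i, K ≤ k i ∧ k i ≤ K + m) ∧
      List.replicate m a = (List.range B).flatMap fun i => List.replicate (k i) a := by
  have key : ∀ k, (List.range k).flatMap (fun _ => List.replicate K a) =
      List.replicate (k * K) a := by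
    intro k
    induction k with
    | zero => simp
    | succ k ih =>
      rw [List.range_succ, List.flatMap_append, ih, Nat.add_mul, List.replicate_add]
      simp
  refine ⟨fun i => K + if i = B - 1 then m - B * K else 0, fun i => ⟨by simp, ?_⟩, ?_⟩
  · dsimp only
    split_ifs <;> omega
  · rw [show m = B * K + (m - B * K) by omega, List.replicate_add, ← key, flatMap_append_last B hB]
    refine List.flatMap_congr fun i _ => ?_
    rw [List.replicate_add]
    congr 1
    split_ifs <;> simp

theorem length_le_length_flatMap {α : Type*} (B : ℕ) (f : ℕ → List α) {i : ℕ} (hi : i < B) :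
    (f i).length ≤ ((List.range B).flatMap f).length := by
  rw [List.length_flatMap]
  exact List.le_sum_of_mem (List.mem_map.2 ⟨i, List.mem_range.2 hi, rfl⟩)

set_option maxHeartbeats 1000000 in
/-- Every word has a closed spanning trail in a large expander all of whose link graphs expand. -/
theorem exists_spanning_trail {κ μ : ℝ} {L : ℕ} (hμ : 0 < μ) (hμκ : μ ≤ κ) (hκ1 : κ ≤ 1)
    (hL : 1 ≤ κ + μ * (L - 1)) (hL1 : 1 ≤ L) :
    ∃ n₀ : ℕ, ∀ (V : Type) [Fintype V] (G : V → V → Prop), n₀ ≤ Fintype.card V →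
      Expander G κ μ → (∀ x, (κ + μ) * Fintype.card V ≤ (univ.filter fun z => G x z).card) →
      (∀ s, Expander (Aco (stepRel G s) μ) κ μ) → ∀ c : ℕ → Bool,
      ∃ (v : V) (Z : Finset V), Trail (stepRel G) (seg c 0 (Fintype.card V)) v v Z := by
  have hμ1 : μ ≤ 1 := hμκ.trans hκ1
  have hpow : ∀ a : ℝ, 0 < a → ∃ M : ℕ, (1 - a) ^ M ≤ 1 / 2 ^ 9 := fun a ha => by
    obtain ⟨M, hM⟩ := exists_pow_lt_of_lt_one (show (0 : ℝ) < 1 / 2 ^ 9 by norm_num)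
      (show 1 - a < 1 by linarith)
    exact ⟨M, hM.le⟩
  obtain ⟨M₁, hM₁⟩ := hpow ((μ / 2) ^ 2) (by positivity)
  obtain ⟨M₂, hM₂⟩ := hpow ((μ / 2) ^ 3) (by positivity)
  set K := L + 2 + M₁ * (L * (2 * L + 2)) with hK
  obtain ⟨B₁, k₁, hB₁, main₁⟩ := exists_spanning_trail_of_frames hμ hμκ hκ1 hL hL1
    (show (0 : ℝ) < 1 / 4 by norm_num)
  set m₁ := max k₁ (B₁ * K) with hm₁
  obtain ⟨n₁, main₁⟩ := main₁ m₁ (le_max_left _ _)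
  set F₁ := m₁ + L + 2 with hF₁
  have hF₁0 : (0 : ℝ) < F₁ := by
    rw [hF₁]
    positivity
  set ε : ℝ := 1 / (8 * F₁) with hε
  have hε0 : 0 < ε := by positivity
  obtain ⟨B₂, k₂, hB₂, main₂⟩ := exists_spanning_trail_of_frames hμ hμκ hκ1 hL hL1
    (show (0 : ℝ) < ε / 2 by positivity)
  set R := M₂ * (L + 1) + 1 with hR
  set X := B₂ * R * (L + 2) with hX
  set m₂ := max k₂ ⌈4 * (X + L + 3) / ε⌉₊ with hm₂
  obtain ⟨n₂, main₂⟩ := main₂ m₂ (le_max_left _ _)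
  set F₂ := m₂ + L + 2 with hF₂
  refine ⟨n₁ + n₂ + 4 * F₁ + ⌈8 * F₂ / ε⌉₊ +
    ⌈(K + m₁ + (M₁ + 1) * (L * (2 * L + 5)) + 4 * L + 15) / (μ / 4)⌉₊ +
    ⌈(m₂ + L + 10) / (μ / 4)⌉₊, fun V _ G hn hG hdeg hA c => ?_⟩
  have hA' : ∀ s, Expander (Aco (fun x y => stepRel G s y x) μ) κ μ := fun s => by
    have h := hA !s
    have h1 : stepRel G (!s) = fun x y => stepRel G s y x := by
      funext x y
      exact propext (stepRel_not G s x y)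
    rwa [h1] at h
  have hs₁ : (K + m₁ + (M₁ + 1) * (L * (2 * L + 5)) + 4 * L + 15 : ℝ) ≤
      μ / 4 * Fintype.card V := by
    rw [← div_le_iff₀' (by positivity)]
    exact (Nat.le_ceil _).trans (Nat.cast_le.2 (by omega))
  have hs₂ : (m₂ + L + 10 : ℝ) ≤ μ / 4 * Fintype.card V := by
    rw [← div_le_iff₀' (by positivity)]
    exact (Nat.le_ceil _).trans (Nat.cast_le.2 (by omega))
  have hs₃ : (8 * F₂ : ℝ) ≤ ε * Fintype.card V := by
    rw [← div_le_iff₀' (by positivity)]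
    exact (Nat.le_ceil _).trans (Nat.cast_le.2 (by omega))
  -- frames with a constant body
  set q := Fintype.card V / F₁ with hq
  set I := (range (q - 1)).filter fun b =>
    ∀ i, i + 1 < m₁ → c (b * F₁ + (L + 2) + i) = c (b * F₁ + (L + 2) + i + 1) with hI
  by_cases hIc : 1 / 4 * (q : ℝ) ≤ I.card
  · refine main₁ V G (by omega) hG hdeg c q I hq (Finset.filter_subset _ _) hIc fun b hb => ?_
    obtain ⟨k, hk, hrep⟩ := replicate_eq_flatMap (c (b * F₁ + (L + 2))) B₁ K m₁ hB₁
      (le_max_right _ _)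
    refine ⟨_, (seg_eq_replicate c _ _ (Finset.mem_filter.1 hb).2).trans hrep, fun i _ => ?_⟩
    refine slottable_replicate hG (hA _) (hA' _) hμ hμ1 hμκ hL hL1 M₁ (k i) (hk i).1 hM₁ ?_
    have : (k i : ℝ) ≤ K + m₁ := by exact_mod_cast (hk i).2
    linarith
  -- many sign changes
  have hq4 : 4 ≤ q := by
    rw [hq, Nat.le_div_iff_mul_le (by omega)]
    omega
  have hqn : (q - 1) * F₁ ≤ Fintype.card V :=
    (Nat.mul_le_mul_right _ (Nat.sub_le _ _)).trans (Nat.div_mul_le_self _ _)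
  obtain ⟨s, hs⟩ := exists_card_le_two_mul_card_sinks c (F := F₁) (o := L + 2) (m := m₁) (by omega)
    (q - 1) (range (q - 1) \ I) Finset.sdiff_subset fun b hb => by
      rw [Finset.mem_sdiff] at hb
      by_contra! hcon
      exact hb.2 (Finset.mem_filter.2 ⟨hb.1, hcon⟩)
  set P : ℕ → Prop := fun i => c i = s ∧ c (i + 1) = !s with hP
  have hsinks : ε * Fintype.card V ≤ ((range (Fintype.card V)).filter P).card := by
    have h1 : ((range ((q - 1) * F₁)).filter P).card ≤ ((range (Fintype.card V)).filter P).card :=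
      Finset.card_le_card (Finset.filter_subset_filter _ (Finset.range_subset_range.2 hqn))
    have h2 : q - 1 ≤ I.card + 2 * ((range (Fintype.card V)).filter P).card := by
      have hIs : I ⊆ range (q - 1) := Finset.filter_subset _ _
      have h3 := Finset.card_sdiff_add_card_eq_card hIs
      rw [Finset.card_range] at h3
      have h4 : ((range ((q - 1) * F₁)).filter P).card =
        ((range ((q - 1) * F₁)).filter fun i => c i = s ∧ c (i + 1) = !s).card := by congr!
      omega
    have h3 : (q : ℝ) ≤ I.card + 2 * ((range (Fintype.card V)).filter P).card + 1 := by
      exact_mod_cast (by omega)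
    have h4 : (Fintype.card V : ℝ) ≤ 2 * q * F₁ := by
      have h5 : Fintype.card V < F₁ * (q + 1) := Nat.lt_mul_div_succ _ (by omega)
      have h6 : Fintype.card V ≤ 2 * q * F₁ := by nlinarith
      exact_mod_cast h6
    have h5 : (4 : ℝ) ≤ q := by exact_mod_cast hq4
    rw [hε, one_div, inv_mul_le_iff₀ (by positivity)]
    push Not at hIc
    nlinarith
  set q' := Fintype.card V / F₂ with hq'
  have hF₂n := Nat.div_add_mod (Fintype.card V) F₂
  have hF₂m := Nat.mod_lt (Fintype.card V) (show 0 < F₂ by omega)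
  rw [← hq'] at hF₂n
  set I' := (range (q' - 1)).filter fun b => X ≤ ((Finset.Ico (b * F₂ + (L + 2))
    (b * F₂ + (L + 2) + m₂ - 1)).filter P).card with hI'
  have hcnt : ((range ((q' - 1) * F₂)).filter P).card ≤
      (q' - 1) * (L + 2 + 1 + X) + I'.card * F₂ := by
    have h1 := card_filter_le_of_frames P (q' - 1) (L + 2) m₂ X
    rw [show m₂ + (L + 2) = F₂ by omega] at h1
    convert h1
  have hI'c : ε / 2 * (q' : ℝ) ≤ I'.card := by
    have h1 : (range (Fintype.card V)).filter P ⊆ (range ((q' - 1) * F₂)).filter P ∪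
        Finset.Ico ((q' - 1) * F₂) (Fintype.card V) := by
      intro i hi
      simp only [Finset.mem_union, Finset.mem_filter, Finset.mem_range, Finset.mem_Ico] at hi ⊢
      by_cases h : i < (q' - 1) * F₂
      · exact Or.inl ⟨h, hi.2⟩
      · exact Or.inr ⟨by omega, hi.1⟩
    have h2 := (Finset.card_le_card h1).trans (Finset.card_union_le _ _)
    rw [Nat.card_Ico] at h2
    have h3 : F₂ * q' ≤ (q' - 1) * F₂ + F₂ := by
      rcases Nat.eq_zero_or_pos q' with h | h
      · simp [h]
      · obtain ⟨k, hk⟩ : ∃ k, q' = k + 1 := ⟨q' - 1, by omega⟩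
        rw [hk, Nat.add_sub_cancel]
        exact le_of_eq (by ring)
    have h4 : (q' - 1) * (L + 2 + 1 + X) ≤ q' * (L + 2 + 1 + X) :=
      Nat.mul_le_mul_right _ (Nat.sub_le _ _)
    have h5 : ((range (Fintype.card V)).filter P).card ≤
        q' * (L + 2 + 1 + X) + I'.card * F₂ + 2 * F₂ := by omega
    have h6 : (((range (Fintype.card V)).filter P).card : ℝ) ≤
        q' * (L + 2 + 1 + X) + I'.card * F₂ + 2 * F₂ := by exact_mod_cast h5
    have h7 : 4 * (X + L + 3 : ℝ) ≤ ε * F₂ := by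
      rw [← div_le_iff₀' hε0]
      refine (Nat.le_ceil _).trans (Nat.cast_le.2 ((le_max_right k₂ _).trans ?_))
      omega
    have h8 : (q' : ℝ) * F₂ ≤ Fintype.card V := by
      exact_mod_cast Nat.div_mul_le_self (Fintype.card V) F₂
    have h9 : (0 : ℝ) < F₂ := by
      exact_mod_cast (show 0 < F₂ by omega)
    have h10 : 4 * (X + L + 3 : ℝ) * q' ≤ ε * F₂ * q' := by gcongr
    have h11 : ε * (q' * F₂) ≤ ε * Fintype.card V := by gcongr
    have h12 : ε / 2 * q' * F₂ ≤ I'.card * F₂ := by linarith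
    exact le_of_mul_le_mul_right h12 h9
  refine main₂ V G (by omega) hG hdeg c q' I' hq' (Finset.filter_subset _ _) hI'c fun b hb => ?_
  obtain ⟨ls, tail, e1, e2, e3⟩ := seg_eq_sinkWord_append c s L (B₂ * R) (b * F₂ + (L + 2)) m₂ (by
    have h1 := (Finset.mem_filter.1 hb).2
    convert h1)
  obtain ⟨ch, h1, h2, h3⟩ := exists_flatMap_eq_of_length ls B₂ R e2
  have h4 : seg c (b * F₂ + (L + 2)) m₂ = (List.range B₂).flatMap fun i =>
      sinkWord s (ch i) ++ if i = B₂ - 1 then tail else [] := by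
    rw [← flatMap_append_last B₂ hB₂, e1]
    congr 1
    conv_lhs => rw [h1]
    rw [sinkWord, List.flatMap_assoc]
    rfl
  refine ⟨_, h4, fun i hi => ?_⟩
  refine slottable_sinkWord hG (hA' s) (hA s) hμ hμ1 hμκ hL hL1 M₂ (ch i) _
    (fun l hl => e3 l (h3 i l hl)) (h2 i hi) hM₂ ?_
  have h5 := length_le_length_flatMap B₂
    (fun i => sinkWord s (ch i) ++ if i = B₂ - 1 then tail else []) hi
  rw [← h4, seg_length] at h5
  have h6 : ((sinkWord s (ch i) ++ if i = B₂ - 1 then tail else []).length : ℝ) ≤ m₂ := by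
    exact_mod_cast h5
  linarith

/-- **Arbitrary orientations of Hamilton cycles in robust outexpanders.** Every
sufficiently large digraph with minimum semidegree at least `ηn` which is a robust
`(ν,τ)`-outexpander contains every orientation of a Hamilton cycle, the orientation
being prescribed by a function `c : ℤ/nℤ → {+1, −1}`. -/
theorem robust_outexpander_any_orientation (η : ℝ) (hη0 : 0 < η) (hη1 : η < 1) :
    ∃ τ₀ : ℝ, 0 < τ₀ ∧ ∀ τ : ℝ, 0 < τ → τ ≤ τ₀ → ∀ ν : ℝ, 0 < ν → ν ≤ τ →
    ∃ n₀ : ℕ, ∀ (V : Type) [Fintype V] (G : V → V → Prop),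
      (∀ v : V, ¬ G v v) →
      n₀ ≤ Fintype.card V →
      (∀ v : V, η * (Fintype.card V : ℝ) ≤ (outDeg G v : ℝ) ∧
        η * (Fintype.card V : ℝ) ≤ (inDeg G v : ℝ)) →
      RobustOutexpander G ν τ →
      ∀ c : ZMod (Fintype.card V) → ℤ, (∀ i, c i = 1 ∨ c i = -1) →
      ∃ e : ZMod (Fintype.card V) ≃ V,
        ∀ i : ZMod (Fintype.card V),
          (c i = 1 → G (e i) (e (i + 1))) ∧ (c i = -1 → G (e (i + 1)) (e i)) := by
  refine ⟨η / 4, by linarith, fun τ hτ0 hτ ν hν hντ => ?_⟩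
  have hν4 : ν ≤ η / 4 := hντ.trans hτ
  have hμ₁ : 0 < ν ^ 2 / 2 := by positivity
  have hμ₁ν : ν ^ 2 / 2 ≤ ν := by nlinarith
  have hμ : 0 < (ν ^ 2 / 2) ^ 2 / 2 := by positivity
  have hμμ₁ : (ν ^ 2 / 2) ^ 2 / 2 ≤ ν ^ 2 / 2 := by nlinarith
  obtain ⟨L, hL1, hL⟩ :
      ∃ L : ℕ, 1 ≤ L ∧ 1 ≤ η / 2 + (ν ^ 2 / 2) ^ 2 / 2 * ((L : ℝ) - 1) := by
    obtain ⟨k, hk⟩ := exists_nat_ge (1 / ((ν ^ 2 / 2) ^ 2 / 2))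
    rw [div_le_iff₀' hμ] at hk
    refine ⟨k + 1, by omega, ?_⟩
    push_cast
    linarith
  obtain ⟨n₀, main⟩ := exists_spanning_trail hμ (by linarith) (by linarith) hL hL1
  refine ⟨n₀ + 1, fun V _ G _ hn hdeg hG c _ => ?_⟩
  have hpos : 0 < Fintype.card V := by omega
  have hE := hG.expander hη1 hν hντ hτ hpos hdeg
  obtain ⟨v, Z, h⟩ := main V G (by omega) (hE.mono hμμ₁)
    (fun x => by
      have h1 : (η / 2 + (ν ^ 2 / 2) ^ 2 / 2) * Fintype.card V ≤ η * Fintype.card V := by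
        gcongr
        linarith
      have h2 := h1.trans (hdeg x).1
      rw [outDeg] at h2
      convert h2)
    (fun s => (hE.stepRel s).aco hpos (by linarith) hμ₁ (by linarith))
    (fun k => decide (c (k : ZMod (Fintype.card V)) = 1))
  obtain ⟨e, he⟩ := h.exists_equiv rfl hpos
  have : NeZero (Fintype.card V) := ⟨hpos.ne'⟩
  refine ⟨e, fun i => ⟨fun hi => ?_, fun hi => ?_⟩⟩
  · have h1 := he i
    rw [ZMod.natCast_zmod_val, hi] at h1
    simpa [stepRel] using h1
  · have h1 := he i
    rw [ZMod.natCast_zmod_val, hi] at h1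
    simpa [stepRel] using h1
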